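/- Let K ⊂ ℝⁿ (n ≥ 3) be a compact set of Lebesgue measure 0 such that ℝⁿ \ K is connected. For every δ > 0 and every h ∈ C_c²(ℝⁿ), there exists f : ℝⁿ → ℝ satisfying Δf + f = 0 on ℝⁿ such that sup_K (|f − h| + ‖∇f − ∇h‖) ≤ δ. -/

import Mathlib

open MeasureTheory Metric Filter Real
open scoped RealInnerProductSpace

noncomputable section

/-- The Euclidean Laplacian of `f` at `x`: the sum of the pure second derivatives
in the coordinate directions. -/
def lap {n : ℕ} {F : Type*} [NormedAddCommGroup F] [NormedSpace ℝ F]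
    (f : EuclideanSpace ℝ (Fin n) → F) (x : EuclideanSpace ℝ (Fin n)) : F :=
  ∑ i : Fin n, iteratedFDeriv ℝ 2 f x ![EuclideanSpace.single i 1, EuclideanSpace.single i 1]

/-- Bessel function of the first kind of order `μ`, via its power series. -/
def besselJ (μ : ℝ) (r : ℝ) : ℝ :=
  ∑' k : ℕ, ((-1 : ℝ) ^ k / ((Nat.factorial k : ℝ) * Real.Gamma ((k : ℝ) + μ + 1)))
    * (r / 2) ^ (2 * k) * (r / 2) ^ μ

/-- Bessel function of the second kind of order `μ`, as the limit of the standard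
combination `(J_α cos(απ) - J_{-α}) / sin(απ)` as `α → μ`. -/
def besselY (μ : ℝ) (r : ℝ) : ℝ :=
  limUnder (nhdsWithin μ {μ}ᶜ)
    (fun α => (besselJ α r * Real.cos (α * Real.pi) - besselJ (-α) r) / Real.sin (α * Real.pi))

/-- `P` is a harmonic polynomial in `n` variables, homogeneous of degree `ℓ`.
Its restriction to the unit sphere is a spherical harmonic of degree `ℓ`. -/
def IsHarmonicHomogeneous (n ℓ : ℕ) (P : MvPolynomial (Fin n) ℝ) : Prop :=
  P.IsHomogeneous ℓ ∧
    ∀ x : EuclideanSpace ℝ (Fin n),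
      lap (fun y => MvPolynomial.eval (fun i => y i) P) x = 0

/-- The value at `v` of the spherical harmonic determined by the polynomial `P`. -/
def sphEval {n : ℕ} (P : MvPolynomial (Fin n) ℝ) (v : EuclideanSpace ℝ (Fin n)) : ℝ :=
  MvPolynomial.eval (fun i => v i) P

/-- The (unnormalized) surface measure on the unit sphere of `ℝⁿ`. -/
def sphereMeasure (n : ℕ) : Measure (sphere (0 : EuclideanSpace ℝ (Fin n)) 1) :=
  (volume : Measure (EuclideanSpace ℝ (Fin n))).toSphere

/-- The square root of the inverse complex time, along a curve on which the complex heat kernel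
is integrable against the exponential of time. -/
def contour (v : ℝ) : ℂ := v - (v / (1 + v ^ 2) : ℝ) * Complex.I

/-- The derivative of `contour`. -/
def contourDeriv (v : ℝ) : ℂ := 1 - ((1 - v ^ 2) / (1 + v ^ 2) ^ 2 : ℝ) * Complex.I

lemma hasDerivAt_contour (v : ℝ) : HasDerivAt contour (contourDeriv v) v := by
  have h1 : HasDerivAt (fun v : ℝ => v / (1 + v ^ 2)) ((1 - v ^ 2) / (1 + v ^ 2) ^ 2) v := by
    have hv : (1 + v ^ 2) ≠ 0 := by positivity
    have := (hasDerivAt_id v).div (((hasDerivAt_id v).pow 2).const_add 1) hv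
    refine this.congr_deriv ?_
    simp
    ring
  exact (hasDerivAt_id v).ofReal_comp.sub (h1.ofReal_comp.mul_const Complex.I)

lemma contour_re (v : ℝ) : (contour v).re = v := by
  rw [contour, Complex.sub_re, Complex.re_ofReal_mul, Complex.ofReal_re, Complex.I_re, mul_zero,
    sub_zero]

lemma contour_im (v : ℝ) : (contour v).im = -(v / (1 + v ^ 2)) := by
  rw [contour, Complex.sub_im, Complex.im_ofReal_mul, Complex.ofReal_im, Complex.I_im, mul_one,
    zero_sub]

lemma contour_sq_re (v : ℝ) : (contour v ^ 2).re = v ^ 2 - (v / (1 + v ^ 2)) ^ 2 := by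
  rw [pow_two, Complex.mul_re, contour_re, contour_im]; ring

lemma contour_sq_im (v : ℝ) : (contour v ^ 2).im = -(2 * v * (v / (1 + v ^ 2))) := by
  rw [pow_two, Complex.mul_im, contour_re, contour_im]; ring

lemma norm_contour_sq (v : ℝ) : ‖contour v ^ 2‖ = v ^ 2 + (v / (1 + v ^ 2)) ^ 2 := by
  rw [norm_pow, ← Complex.normSq_eq_norm_sq, Complex.normSq_apply, contour_re, contour_im]; ring

lemma abs_div_one_add_sq_le (v : ℝ) : (v / (1 + v ^ 2)) ^ 2 ≤ 1 / 4 := by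
  rw [div_pow, div_le_div_iff₀ (by positivity) (by norm_num)]
  nlinarith [sq_nonneg (1 - v ^ 2)]

lemma div_one_add_sq_le (v : ℝ) : (v / (1 + v ^ 2)) ^ 2 ≤ v ^ 2 := by
  rw [div_pow]
  exact div_le_self (by positivity) (by nlinarith [sq_nonneg v, sq_nonneg (v ^ 2)])

lemma contour_sq_re_ge (v : ℝ) : v ^ 2 - 1 / 4 ≤ (contour v ^ 2).re := by
  rw [contour_sq_re]; linarith [abs_div_one_add_sq_le v]

lemma contour_sq_re_nonneg (v : ℝ) : 0 ≤ (contour v ^ 2).re := by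
  rw [contour_sq_re]; linarith [div_one_add_sq_le v]

lemma abs_contour_sq_im_le (v : ℝ) : |(contour v ^ 2).im| ≤ 2 := by
  rw [contour_sq_im, abs_neg, show 2 * v * (v / (1 + v ^ 2)) = 2 * v ^ 2 / (1 + v ^ 2) by ring,
    abs_of_nonneg (by positivity), div_le_iff₀ (by positivity)]
  nlinarith [sq_nonneg v]

lemma contour_sq_im_nonpos (v : ℝ) : (contour v ^ 2).im ≤ 0 := by
  rw [contour_sq_im, show 2 * v * (v / (1 + v ^ 2)) = 2 * v ^ 2 / (1 + v ^ 2) by ring]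
  have : 0 ≤ 2 * v ^ 2 / (1 + v ^ 2) := by positivity
  linarith

lemma norm_contour_sq_le (v : ℝ) : ‖contour v ^ 2‖ ≤ v ^ 2 + 1 / 4 := by
  rw [norm_contour_sq]; linarith [abs_div_one_add_sq_le v]

lemma norm_contour_le (v : ℝ) : ‖contour v‖ ≤ 2 * |v| := by
  have h : ‖contour v‖ ^ 2 ≤ (2 * |v|) ^ 2 := by
    rw [← norm_pow, norm_contour_sq, mul_pow, sq_abs]
    nlinarith [div_one_add_sq_le v, sq_nonneg v]
  exact abs_le_of_sq_le_sq' h (by positivity) |>.2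

lemma contour_ne_zero {v : ℝ} (hv : 0 < v) : contour v ≠ 0 := by
  intro h
  have := contour_re v
  rw [h] at this
  simp at this
  linarith

lemma norm_contourDeriv_le (v : ℝ) : ‖contourDeriv v‖ ≤ 2 := by
  have h1 : |(1 - v ^ 2) / (1 + v ^ 2) ^ 2| ≤ 1 := by
    rw [abs_div, div_le_one₀ (by positivity), abs_of_pos (a := (1 + v ^ 2) ^ 2) (by positivity),
      abs_le]
    constructor <;> nlinarith [sq_nonneg v, sq_nonneg (v ^ 2)]
  unfold contourDeriv
  refine (norm_sub_le _ _).trans ?_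
  rw [norm_mul, Complex.norm_I, Complex.norm_real, Real.norm_eq_abs]
  simp
  linarith

lemma continuous_contour : Continuous contour := by
  unfold contour
  have : ∀ v : ℝ, 1 + v ^ 2 ≠ 0 := fun v => by positivity
  fun_prop (disch := assumption)

lemma continuous_contourDeriv : Continuous contourDeriv := by
  unfold contourDeriv
  have : ∀ v : ℝ, (1 + v ^ 2) ^ 2 ≠ 0 := fun v => by positivity
  fun_prop (disch := assumption)

lemma inv_contour_sq_re_le {v : ℝ} (hv : 0 < v) : ((contour v ^ 2)⁻¹).re ≤ 2 := by
  rw [Complex.inv_re, Complex.normSq_eq_norm_sq, norm_contour_sq, contour_sq_re,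
    div_le_iff₀ (by positivity)]
  have h1 : v ^ 2 - (v / (1 + v ^ 2)) ^ 2 ≤ 2 * (v ^ 2) ^ 2 := by
    rw [div_pow, sub_le_iff_le_add, ← sub_le_iff_le_add', le_div_iff₀ (by positivity)]
    have : (v ^ 2 - 2 * (v ^ 2) ^ 2) * (1 + v ^ 2) ^ 2 =
      v ^ 2 - (v ^ 2) ^ 2 * (3 * v ^ 2 + 2 * (v ^ 2) ^ 2) := by ring
    rw [this]
    have : 0 ≤ (v ^ 2) ^ 2 * (3 * v ^ 2 + 2 * (v ^ 2) ^ 2) := by positivity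
    linarith
  have h2 : 0 ≤ (v / (1 + v ^ 2)) ^ 2 := by positivity
  nlinarith [sq_nonneg v]

lemma rotated_inv_contour_sq_re_ge {v : ℝ} (hv : 0 < v) :
    3 / ‖contour v ^ 2‖ ≤ ((3 - 4 * Complex.I) * (contour v ^ 2)⁻¹).re := by
  have hw : 0 < ‖contour v ^ 2‖ := by
    rw [norm_contour_sq]; positivity
  rw [Complex.mul_re, Complex.inv_re, Complex.inv_im, Complex.normSq_eq_norm_sq]
  have h := Complex.norm_le_abs_re_add_abs_im (contour v ^ 2)
  rw [abs_of_nonneg (contour_sq_re_nonneg v), abs_of_nonpos (contour_sq_im_nonpos v)] at h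
  have h3 := contour_sq_im_nonpos v
  simp only [Complex.sub_re, Complex.sub_im, Complex.mul_re, Complex.mul_im, Complex.I_re,
    Complex.I_im, Complex.re_ofNat, Complex.im_ofNat]
  rw [div_le_iff₀ hw]
  field_simp
  linarith

/-- Growth of the oscillatory Gaussian along the contour. -/
lemma norm_cexp_neg_contour_sq_mul_le (v : ℝ) {ζ : ℂ} (hζ : 0 ≤ ζ.re) :
    ‖Complex.exp (-(contour v ^ 2) * ζ / 4)‖ ≤
      Real.exp (|ζ.im| / 2) * Real.exp ((1 / 4 - v ^ 2) * ζ.re / 4) := by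
  rw [Complex.norm_exp, ← Real.exp_add, Real.exp_le_exp]
  have : (-(contour v ^ 2) * ζ / 4).re
      = (-(contour v ^ 2).re * ζ.re + (contour v ^ 2).im * ζ.im) / 4 := by
    rw [show (4 : ℂ) = ((4 : ℝ) : ℂ) by norm_num, Complex.div_ofReal_re, Complex.mul_re,
      Complex.neg_re, Complex.neg_im]
    ring
  rw [this]
  have h1 : (contour v ^ 2).im * ζ.im ≤ 2 * |ζ.im| := by
    refine (le_abs_self _).trans ?_
    rw [abs_mul]
    exact mul_le_mul_of_nonneg_right (abs_contour_sq_im_le v) (abs_nonneg _)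
  nlinarith [contour_sq_re_ge v]

/-- The amplitude `2 σ' σ^m / σ² · exp (τ / σ²)` along the contour `σ`. -/
def amp (m : ℕ) (τ : ℂ) (v : ℝ) : ℂ :=
  2 * contourDeriv v * contour v ^ m / contour v ^ 2 * Complex.exp (τ * (contour v ^ 2)⁻¹)

/-- The heat equation satisfied along the contour, in total derivative form. -/
lemma hasDerivAt_contour_gaussian (m : ℕ) (τ ζ : ℂ) {v : ℝ} (hv : 0 < v) :
    HasDerivAt (fun v : ℝ => contour v ^ (m + 1) * Complex.exp (τ * (contour v ^ 2)⁻¹) *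
        Complex.exp (-(contour v ^ 2) * ζ / 4))
      (-(amp m τ v * Complex.exp (-(contour v ^ 2) * ζ / 4) *
        (τ - (m + 1) / 2 * contour v ^ 2 + contour v ^ 4 * ζ / 4))) v := by
  have hc := contour_ne_zero hv
  have h := hasDerivAt_contour v
  have h2 := h.pow 2
  have h3 := (h2.inv (pow_ne_zero 2 hc)).const_mul τ
  have h4 := (((h2.neg).mul_const ζ).div_const 4)
  have := ((h.pow (m + 1)).mul h3.cexp).mul h4.cexp
  refine this.congr_deriv ?_
  simp only [Pi.pow_apply, Pi.neg_apply, Pi.inv_apply, Pi.mul_apply, amp]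
  generalize contour v = c at *
  push_cast
  field_simp
  ring

lemma norm_amp_le {m : ℕ} (hm : 2 ≤ m) {v : ℝ} (hv : 0 < v) :
    ‖amp m 1 v‖ ≤ 4 * Real.exp 2 * 2 ^ (m - 2) * v ^ (m - 2) := by
  have hc := contour_ne_zero hv
  obtain ⟨k, rfl⟩ := Nat.exists_eq_add_of_le' hm
  have : amp (k + 2) 1 v = 2 * contourDeriv v * contour v ^ k *
      Complex.exp (1 * (contour v ^ 2)⁻¹) := by
    unfold amp; field_simp; ring
  rw [this, norm_mul, norm_mul, norm_mul, norm_pow, Complex.norm_exp, one_mul]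
  have h1 := norm_contourDeriv_le v
  have h2 : ‖contour v‖ ^ k ≤ (2 * v) ^ k :=
    pow_le_pow_left₀ (norm_nonneg _) ((norm_contour_le v).trans_eq (by rw [abs_of_pos hv])) k
  have h3 := Real.exp_le_exp.mpr (inv_contour_sq_re_le hv)
  simp only [Complex.norm_ofNat, add_tsub_cancel_right]
  calc _ ≤ 2 * 2 * (2 * v) ^ k * Real.exp 2 := by gcongr
    _ = _ := by rw [mul_pow]; ring

lemma continuousOn_amp (m : ℕ) (τ : ℂ) : ContinuousOn (amp m τ) (Set.Ioi 0) := by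
  unfold amp
  have h : ∀ v ∈ Set.Ioi (0 : ℝ), contour v ^ 2 ≠ 0 := fun v hv =>
    pow_ne_zero 2 (contour_ne_zero hv)
  have h1 := continuous_contour.continuousOn (s := Set.Ioi 0)
  have h2 := continuous_contourDeriv.continuousOn (s := Set.Ioi 0)
  exact (((continuousOn_const.mul h2).mul (h1.pow m)).div (h1.pow 2) h).mul
    (continuousOn_const.mul ((h1.pow 2).inv₀ h)).cexp

/-- Functions on the half-line that are integrable against every Gaussian. -/
def GaussIntegrable (A : ℝ → ℂ) : Prop :=
  AEStronglyMeasurable A (volume.restrict (Set.Ioi 0)) ∧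
    ∀ c : ℝ, 0 < c → IntegrableOn (fun v => ‖A v‖ * Real.exp (-c * v ^ 2)) (Set.Ioi 0)

/-- The Gaussian transform of `A` along the contour. -/
def gaussTransform (A : ℝ → ℂ) (ζ : ℂ) : ℂ :=
  ∫ v in Set.Ioi (0 : ℝ), A v * Complex.exp (-(contour v ^ 2) * ζ / 4)

/-- The density whose Gaussian transform is the derivative of that of `A`. -/
def diffAmp (A : ℝ → ℂ) (v : ℝ) : ℂ := A v * (-(contour v ^ 2) / 4)

lemma GaussIntegrable.diffAmp {A : ℝ → ℂ} (hA : GaussIntegrable A) :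
    GaussIntegrable (diffAmp A) := by
  have hm : AEStronglyMeasurable (_root_.diffAmp A) (volume.restrict (Set.Ioi 0)) :=
    hA.1.mul (((continuous_contour.pow 2).neg.div_const 4).aestronglyMeasurable)
  refine ⟨hm, fun c hc => ?_⟩
  refine Integrable.mono' ((hA.2 (c / 2) (by positivity)).const_mul (2 / c + 1)) ?_ ?_
  · exact hm.norm.mul (by fun_prop)
  · refine Eventually.of_forall fun v => ?_
    rw [Real.norm_of_nonneg (by positivity), _root_.diffAmp, norm_mul, norm_div, norm_neg]
    have h1 : ‖contour v ^ 2‖ / ‖(4 : ℂ)‖ ≤ (2 / c + 1) * Real.exp (c / 2 * v ^ 2) := by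
      have h2 := norm_contour_sq_le v
      have h3 := Real.add_one_le_exp (c / 2 * v ^ 2)
      have h4 : (2 / c + 1) * (c / 2 * v ^ 2 + 1) ≤ (2 / c + 1) * Real.exp (c / 2 * v ^ 2) :=
        mul_le_mul_of_nonneg_left h3 (by positivity)
      have h5 : (2 / c + 1) * (c / 2 * v ^ 2 + 1) = v ^ 2 + 1 + 2 / c + c / 2 * v ^ 2 := by
        field_simp; ring
      have h6 : 0 ≤ 2 / c + c / 2 * v ^ 2 := by positivity
      rw [Complex.norm_ofNat]
      nlinarith [sq_nonneg v]
    have h7 : Real.exp (-(c / 2) * v ^ 2) = Real.exp (c / 2 * v ^ 2) * Real.exp (-c * v ^ 2) := by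
      rw [← Real.exp_add]; congr 1; ring
    rw [h7]
    calc _ ≤ ‖A v‖ * ((2 / c + 1) * Real.exp (c / 2 * v ^ 2)) * Real.exp (-c * v ^ 2) := by
          gcongr
      _ = _ := by ring

lemma norm_mul_cexp_le {A : ℝ → ℂ} {c M N : ℝ} {ζ : ℂ} (hc : 0 < c) (h1 : c ≤ ζ.re)
    (h2 : ζ.re ≤ M) (h3 : |ζ.im| ≤ N) (v : ℝ) :
    ‖A v * Complex.exp (-(contour v ^ 2) * ζ / 4)‖ ≤
      Real.exp (N / 2 + M / 16) * (‖A v‖ * Real.exp (-(c / 4) * v ^ 2)) := by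
  rw [norm_mul]
  have h := norm_cexp_neg_contour_sq_mul_le v (hc.le.trans h1)
  rw [← Real.exp_add] at h
  have h4 : Real.exp (|ζ.im| / 2 + (1 / 4 - v ^ 2) * ζ.re / 4) ≤
      Real.exp (N / 2 + M / 16) * Real.exp (-(c / 4) * v ^ 2) := by
    rw [← Real.exp_add, Real.exp_le_exp]
    nlinarith [sq_nonneg v]
  calc _ ≤ ‖A v‖ * (Real.exp (N / 2 + M / 16) * Real.exp (-(c / 4) * v ^ 2)) :=
        mul_le_mul_of_nonneg_left (h.trans h4) (norm_nonneg _)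
    _ = _ := by ring

lemma GaussIntegrable.aestronglyMeasurable_mul_cexp {A : ℝ → ℂ} (hA : GaussIntegrable A) (ζ : ℂ) :
    AEStronglyMeasurable (fun v : ℝ => A v * Complex.exp (-(contour v ^ 2) * ζ / 4))
      (volume.restrict (Set.Ioi 0)) := by
  refine hA.1.mul (Continuous.aestronglyMeasurable ?_)
  have := continuous_contour
  fun_prop

lemma GaussIntegrable.integrableOn {A : ℝ → ℂ} (hA : GaussIntegrable A) {ζ : ℂ}
    (hζ : 0 < ζ.re) :
    IntegrableOn (fun v : ℝ => A v * Complex.exp (-(contour v ^ 2) * ζ / 4)) (Set.Ioi 0) :=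
  Integrable.mono' ((hA.2 (ζ.re / 4) (by positivity)).const_mul _)
    (hA.aestronglyMeasurable_mul_cexp ζ)
    (Eventually.of_forall fun v => norm_mul_cexp_le hζ le_rfl le_rfl le_rfl v)

lemma GaussIntegrable.hasDerivAt {A : ℝ → ℂ} (hA : GaussIntegrable A) {ζ : ℂ} (hζ : 0 < ζ.re) :
    HasDerivAt (gaussTransform A) (gaussTransform (_root_.diffAmp A) ζ) ζ := by
  set s : Set ℂ := {z | ζ.re / 2 < z.re ∧ z.re < ζ.re + 1 ∧ |z.im| < |ζ.im| + 1} with hs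
  have hso : IsOpen s := by
    refine (isOpen_lt continuous_const Complex.continuous_re).inter
      ((isOpen_lt Complex.continuous_re continuous_const).inter
        (isOpen_lt Complex.continuous_im.abs continuous_const))
  have hsn : s ∈ nhds ζ := hso.mem_nhds ⟨by linarith, by linarith, by linarith⟩
  have hb : ∀ᵐ v : ℝ ∂(volume.restrict (Set.Ioi 0)), ∀ z ∈ s,
      ‖_root_.diffAmp A v * Complex.exp (-(contour v ^ 2) * z / 4)‖ ≤
        Real.exp ((|ζ.im| + 1) / 2 + (ζ.re + 1) / 16) *
          (‖_root_.diffAmp A v‖ * Real.exp (-(ζ.re / 2 / 4) * v ^ 2)) :=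
    Eventually.of_forall fun v z hz =>
      norm_mul_cexp_le (by positivity) hz.1.le hz.2.1.le hz.2.2.le v
  have hd : ∀ᵐ v : ℝ ∂(volume.restrict (Set.Ioi 0)), ∀ z ∈ s,
      HasDerivAt (fun z => A v * Complex.exp (-(contour v ^ 2) * z / 4))
        (_root_.diffAmp A v * Complex.exp (-(contour v ^ 2) * z / 4)) z := by
    refine Eventually.of_forall fun v z _ => ?_
    have : HasDerivAt (fun z : ℂ => -(contour v ^ 2) * z / 4) (-(contour v ^ 2) * 1 / 4) z :=
      ((hasDerivAt_id z).const_mul _).div_const 4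
    refine (this.cexp.const_mul (A v)).congr_deriv ?_
    simp only [_root_.diffAmp]
    ring
  have hi : Integrable (fun v => Real.exp ((|ζ.im| + 1) / 2 + (ζ.re + 1) / 16) *
      (‖_root_.diffAmp A v‖ * Real.exp (-(ζ.re / 2 / 4) * v ^ 2)))
      (volume.restrict (Set.Ioi 0)) :=
    (hA.diffAmp.2 _ (by positivity)).const_mul _
  exact (hasDerivAt_integral_of_dominated_loc_of_deriv_le (𝕜 := ℂ) hsn
    (F := fun (z : ℂ) (v : ℝ) => A v * Complex.exp (-(contour v ^ 2) * z / 4))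
    (F' := fun (z : ℂ) (v : ℝ) => _root_.diffAmp A v * Complex.exp (-(contour v ^ 2) * z / 4))
    (Eventually.of_forall fun z => hA.aestronglyMeasurable_mul_cexp z) (hA.integrableOn hζ)
    (hA.diffAmp.aestronglyMeasurable_mul_cexp ζ) hb hi hd).2

lemma integrableOn_pow_mul_exp (k : ℕ) {c : ℝ} (hc : 0 < c) :
    IntegrableOn (fun v : ℝ => v ^ k * Real.exp (-c * v ^ 2)) (Set.Ioi 0) := by
  have := integrable_rpow_mul_exp_neg_mul_sq hc (s := k)
    (by have : (0 : ℝ) ≤ k := k.cast_nonneg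
        linarith)
  simpa only [Real.rpow_natCast] using this.integrableOn

lemma gaussIntegrable_amp {m : ℕ} (hm : 2 ≤ m) : GaussIntegrable (amp m 1) := by
  have hmeas := (continuousOn_amp m 1).aestronglyMeasurable (μ := volume) measurableSet_Ioi
  refine ⟨hmeas, fun c hc => ?_⟩
  refine Integrable.mono' ((integrableOn_pow_mul_exp (m - 2) hc).const_mul
    (4 * Real.exp 2 * 2 ^ (m - 2))) (hmeas.norm.mul (by fun_prop)) ?_
  refine (ae_restrict_iff' measurableSet_Ioi).mpr (Eventually.of_forall fun v hv => ?_)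
  rw [Real.norm_of_nonneg (by positivity), ← mul_assoc]
  exact mul_le_mul_of_nonneg_right (norm_amp_le hm hv) (by positivity)

section

/-- The complex-valued linear form `⟪z, ·⟫`. -/
def linForm {n : ℕ} (z : EuclideanSpace ℝ (Fin n)) : EuclideanSpace ℝ (Fin n) →L[ℝ] ℂ :=
  Complex.ofRealCLM ∘L innerSL ℝ z

/-- The space of values of first-order jets. -/
abbrev JetSpace (n : ℕ) := ℂ × (EuclideanSpace ℝ (Fin n) →L[ℝ] ℂ)

/-- The Gaussian with complex width `w`. -/
def cgauss {n : ℕ} (w : ℂ) (z : EuclideanSpace ℝ (Fin n)) : ℂ :=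
  Complex.exp (-w * ((‖z‖ ^ 2 : ℝ) : ℂ) / 4)

/-- The jet of the radial function `z ↦ φ (‖z‖²)` when `φ'` is the derivative of `φ`. -/
def radialJet {n : ℕ} (a b : ℂ) (z : EuclideanSpace ℝ (Fin n)) : JetSpace n :=
  (a, (2 * b) • linForm z)

/-- The jet at `z` of the time slice `v` of the fundamental solution. -/
def sliceJet {n : ℕ} (v : ℝ) (z : EuclideanSpace ℝ (Fin n)) : JetSpace n :=
  radialJet (amp (n - 1) 1 v * cgauss (contour v ^ 2) z)
    (diffAmp (amp (n - 1) 1) v * cgauss (contour v ^ 2) z) z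

/-- The jet at `z` of the fundamental solution. -/
def fundJet {n : ℕ} (z : EuclideanSpace ℝ (Fin n)) : JetSpace n :=
  radialJet (gaussTransform (amp (n - 1) 1) ((‖z‖ ^ 2 : ℝ) : ℂ))
    (gaussTransform (diffAmp (amp (n - 1) 1)) ((‖z‖ ^ 2 : ℝ) : ℂ)) z

variable {n : ℕ}

@[simp] lemma linForm_apply (z y : EuclideanSpace ℝ (Fin n)) : linForm z y = (⟪z, y⟫ : ℝ) := rfl

lemma continuous_linForm : Continuous (linForm (n := n)) :=
  ((ContinuousLinearMap.compL ℝ (EuclideanSpace ℝ (Fin n)) ℝ ℂ Complex.ofRealCLM).continuous).comp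
    (innerSL ℝ).continuous

lemma norm_linForm_le (z : EuclideanSpace ℝ (Fin n)) : ‖linForm z‖ ≤ ‖z‖ := by
  refine ContinuousLinearMap.opNorm_le_bound _ (norm_nonneg _) fun y => ?_
  rw [linForm_apply, Complex.norm_real]
  exact norm_inner_le_norm z y

lemma hasFDerivAt_norm_sq_ofReal (z : EuclideanSpace ℝ (Fin n)) :
    HasFDerivAt (fun z : EuclideanSpace ℝ (Fin n) => ((‖z‖ ^ 2 : ℝ) : ℂ))
      ((2 : ℂ) • linForm z) z := by
  have := Complex.ofRealCLM.hasFDerivAt.comp z (hasStrictFDerivAt_norm_sq z).hasFDerivAt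
  refine this.congr_fderiv ?_
  ext y
  simp

lemma HasDerivAt.hasFDerivAt_norm_sq {φ : ℂ → ℂ} {φ' : ℂ} {z : EuclideanSpace ℝ (Fin n)}
    (h : HasDerivAt φ φ' ((‖z‖ ^ 2 : ℝ) : ℂ)) :
    HasFDerivAt (fun z : EuclideanSpace ℝ (Fin n) => φ ((‖z‖ ^ 2 : ℝ) : ℂ))
      ((2 * φ') • linForm z) z := by
  have := (h.hasFDerivAt.restrictScalars ℝ).comp z (hasFDerivAt_norm_sq_ofReal z)
  refine this.congr_fderiv ?_
  ext y
  simp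
  ring

lemma hasFDerivAt_cgauss (w : ℂ) (z : EuclideanSpace ℝ (Fin n)) :
    HasFDerivAt (cgauss w) ((2 * (-w / 4 * cgauss w z)) • linForm z) z := by
  have : HasDerivAt (fun ζ : ℂ => Complex.exp (-w * ζ / 4))
      (-w / 4 * Complex.exp (-w * ((‖z‖ ^ 2 : ℝ) : ℂ) / 4)) ((‖z‖ ^ 2 : ℝ) : ℂ) := by
    refine (((hasDerivAt_id _).const_mul (-w)).div_const 4).cexp.congr_deriv ?_
    simp only [id]
    ring
  exact this.hasFDerivAt_norm_sq

lemma continuous_cgauss : Continuous fun p : ℂ × EuclideanSpace ℝ (Fin n) => cgauss p.1 p.2 := by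
  unfold cgauss; fun_prop

lemma continuous_radialJet :
    Continuous fun p : ℂ × ℂ × EuclideanSpace ℝ (Fin n) => radialJet p.1 p.2.1 p.2.2 := by
  unfold radialJet
  exact continuous_fst.prodMk ((continuous_const.mul (continuous_fst.comp continuous_snd)).smul
    (continuous_linForm.comp (continuous_snd.comp continuous_snd)))

lemma integral_pow_mul_exp_scale (k : ℕ) {r : ℝ} (hr : 0 < r) :
    ∫ v in Set.Ioi (0 : ℝ), v ^ k * Real.exp (-(r ^ 2 / 4) * v ^ 2) =
      (r ^ (k + 1))⁻¹ * ∫ v in Set.Ioi (0 : ℝ), v ^ k * Real.exp (-(1 / 4) * v ^ 2) := by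
  have := integral_comp_mul_left_Ioi (fun u : ℝ => u ^ k * Real.exp (-(1 / 4) * u ^ 2)) 0 hr
  rw [mul_zero, smul_eq_mul] at this
  have h2 : ∀ v : ℝ, v ^ k * Real.exp (-(r ^ 2 / 4) * v ^ 2) =
      (r ^ k)⁻¹ * ((r * v) ^ k * Real.exp (-(1 / 4) * (r * v) ^ 2)) := by
    intro v
    rw [mul_pow, show -(1 / 4) * (r * v) ^ 2 = -(r ^ 2 / 4) * v ^ 2 by ring]
    field_simp
  simp_rw [h2]
  rw [integral_const_mul, this, pow_succ, mul_inv, mul_assoc]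

lemma integrableOn_inv_norm_pow (hn : 1 ≤ n) (R : ℝ) :
    IntegrableOn (fun z : EuclideanSpace ℝ (Fin n) => (‖z‖ ^ (n - 1))⁻¹) (ball 0 R) := by
  have : Nonempty (Fin n) := ⟨⟨0, hn⟩⟩
  have key := (integrable_fun_norm_addHaar (E := EuclideanSpace ℝ (Fin n)) volume
    (f := (Set.Iio R).indicator fun r : ℝ => (r ^ (n - 1))⁻¹)).mpr ?_
  · rw [← integrable_indicator_iff measurableSet_ball]
    refine key.congr (Eventually.of_forall fun z => ?_)
    by_cases hz : ‖z‖ < R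
    · simp [Set.indicator, hz]
    · simp [Set.indicator, hz]
  · rw [finrank_euclideanSpace_fin]
    have : IntegrableOn ((Set.Iio R).indicator fun _ : ℝ => (1 : ℝ)) (Set.Ioi 0) := by
      rw [IntegrableOn, integrable_indicator_iff measurableSet_Iio, IntegrableOn,
        Measure.restrict_restrict measurableSet_Iio]
      refine (integrableOn_const (by simp)).mono_set (t := Set.Icc 0 R) ?_
      rintro r ⟨h1, h2⟩
      exact ⟨le_of_lt h2, le_of_lt h1⟩
    refine this.congr_fun (fun r hr => ?_) measurableSet_Ioi
    by_cases hrR : r < R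
    · have hr' : r ≠ 0 := ne_of_gt hr
      simp [Set.indicator, hrR, hr']
    · simp [Set.indicator, hrR]

/-- The constant in the bound of `sliceJet`. -/
def sliceConst (n : ℕ) (R : ℝ) : ℝ := Real.exp (R ^ 2 / 16) * (4 * Real.exp 2 * 2 ^ (n - 3))

lemma sliceConst_nonneg (n : ℕ) (R : ℝ) : 0 ≤ sliceConst n R := by
  unfold sliceConst; positivity

lemma norm_sliceJet_le (hn : 3 ≤ n) {R v : ℝ} (hv : 0 < v) {z : EuclideanSpace ℝ (Fin n)}
    (hz0 : z ≠ 0) (hz : ‖z‖ ≤ R) :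
    ‖sliceJet v z‖ ≤ sliceConst n R * (v ^ (n - 3) * Real.exp (-(‖z‖ ^ 2 / 4) * v ^ 2)) +
      2 * sliceConst n R * ‖z‖ * (v ^ (n - 1) * Real.exp (-(‖z‖ ^ 2 / 4) * v ^ 2)) := by
  have hR : ‖z‖ ^ 2 ≤ R ^ 2 := pow_le_pow_left₀ (norm_nonneg _) hz 2
  have hz' : 0 < ‖z‖ := norm_pos_iff.mpr hz0
  have hb : ∀ A : ℝ → ℂ, ‖A v * cgauss (contour v ^ 2) z‖ ≤
      Real.exp (R ^ 2 / 16) * (‖A v‖ * Real.exp (-(‖z‖ ^ 2 / 4) * v ^ 2)) := fun A => by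
    have := norm_mul_cexp_le (A := A) (c := ‖z‖ ^ 2) (M := R ^ 2) (N := 0)
      (ζ := ((‖z‖ ^ 2 : ℝ) : ℂ)) (by positivity) (by rw [Complex.ofReal_re])
      (by rwa [Complex.ofReal_re]) (by rw [Complex.ofReal_im, abs_zero]) v
    rwa [zero_div, zero_add] at this
  have hA : ‖amp (n - 1) 1 v‖ ≤ 4 * Real.exp 2 * 2 ^ (n - 3) * v ^ (n - 3) :=
    norm_amp_le (by omega) hv
  have hA' : ‖diffAmp (amp (n - 1) 1) v‖ ≤ 4 * Real.exp 2 * 2 ^ (n - 3) * v ^ (n - 1) := by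
    rw [diffAmp, norm_mul, norm_div, norm_neg, norm_pow, Complex.norm_ofNat]
    have h1 : ‖contour v‖ ^ 2 / 4 ≤ v ^ 2 := by
      have := pow_le_pow_left₀ (norm_nonneg _) (norm_contour_le v) 2
      rw [mul_pow, sq_abs] at this
      linarith
    calc _ ≤ 4 * Real.exp 2 * 2 ^ (n - 3) * v ^ (n - 3) * v ^ 2 := by gcongr
      _ = _ := by
        rw [mul_assoc _ (v ^ (n - 3)), ← pow_add]; congr 2; omega
  set e := Real.exp (-(‖z‖ ^ 2 / 4) * v ^ 2)
  have he : 0 < e := Real.exp_pos _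
  have h1 : ‖amp (n - 1) 1 v * cgauss (contour v ^ 2) z‖ ≤ sliceConst n R * (v ^ (n - 3) * e) := by
    refine (hb _).trans ?_
    unfold sliceConst
    calc _ ≤ Real.exp (R ^ 2 / 16) * (4 * Real.exp 2 * 2 ^ (n - 3) * v ^ (n - 3) * e) := by
          gcongr
      _ = _ := by ring
  have h2 : ‖(2 * (diffAmp (amp (n - 1) 1) v * cgauss (contour v ^ 2) z)) • linForm z‖ ≤
      2 * sliceConst n R * ‖z‖ * (v ^ (n - 1) * e) := by
    rw [norm_smul, norm_mul, Complex.norm_ofNat]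
    calc _ ≤ 2 * (Real.exp (R ^ 2 / 16) * (4 * Real.exp 2 * 2 ^ (n - 3) * v ^ (n - 1) * e)) *
          ‖z‖ := by
          refine mul_le_mul (mul_le_mul_of_nonneg_left ((hb _).trans ?_) zero_le_two)
            (norm_linForm_le z) (norm_nonneg _) (by positivity)
          gcongr
      _ = _ := by unfold sliceConst; ring
  have hn1 := sliceConst_nonneg n R
  rw [sliceJet, radialJet, Prod.norm_mk]
  refine max_le (h1.trans (le_add_of_nonneg_right (by positivity)))
    (h2.trans (le_add_of_nonneg_left (by positivity)))

lemma aestronglyMeasurable_sliceJet (hn : 3 ≤ n)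
    (μ : Measure (EuclideanSpace ℝ (Fin n))) [SFinite μ] :
    AEStronglyMeasurable (fun p : ℝ × EuclideanSpace ℝ (Fin n) => sliceJet p.1 p.2)
      ((volume.restrict (Set.Ioi 0)).prod μ) := by
  have h1 := gaussIntegrable_amp (m := n - 1) (by omega)
  have hc : Continuous fun p : ℝ × EuclideanSpace ℝ (Fin n) => cgauss (contour p.1 ^ 2) p.2 :=
    continuous_cgauss.comp ((continuous_contour.comp continuous_fst).pow 2 |>.prodMk continuous_snd)
  have a1 := (h1.1.comp_fst (ν := μ)).mul hc.aestronglyMeasurable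
  have a2 := (h1.diffAmp.1.comp_fst (ν := μ)).mul hc.aestronglyMeasurable
  exact continuous_radialJet.comp_aestronglyMeasurable
    (a1.prodMk (a2.prodMk continuous_snd.aestronglyMeasurable))

lemma integrable_sliceJet (hn : 3 ≤ n) (R : ℝ) :
    Integrable (fun p : ℝ × EuclideanSpace ℝ (Fin n) => sliceJet p.1 p.2)
      ((volume.restrict (Set.Ioi 0)).prod (volume.restrict (ball 0 R))) := by
  have : Nonempty (Fin n) := ⟨⟨0, by omega⟩⟩
  set C := sliceConst n R
  have hC : 0 ≤ C := sliceConst_nonneg n R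
  set b : ℝ × EuclideanSpace ℝ (Fin n) → ℝ := fun p =>
    C * (p.1 ^ (n - 3) * Real.exp (-(‖p.2‖ ^ 2 / 4) * p.1 ^ 2)) +
      2 * C * ‖p.2‖ * (p.1 ^ (n - 1) * Real.exp (-(‖p.2‖ ^ 2 / 4) * p.1 ^ 2)) with hb
  have hne : ∀ᵐ z : EuclideanSpace ℝ (Fin n) ∂(volume.restrict (ball 0 R)), z ≠ 0 :=
    ae_restrict_of_ae (by simp [ae_iff])
  have hz : ∀ᵐ z : EuclideanSpace ℝ (Fin n) ∂(volume.restrict (ball 0 R)), ‖z‖ ≤ R := by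
    refine (ae_restrict_iff' measurableSet_ball).mpr (Eventually.of_forall fun z hz => ?_)
    simpa using (mem_ball_zero_iff.mp hz).le
  have hv : ∀ᵐ v : ℝ ∂(volume.restrict (Set.Ioi 0)), 0 < v :=
    ae_restrict_mem measurableSet_Ioi
  have hi : ∀ z : EuclideanSpace ℝ (Fin n), z ≠ 0 →
      Integrable (fun v => b (v, z)) (volume.restrict (Set.Ioi 0)) := fun z hz => by
    have hz' : 0 < ‖z‖ := norm_pos_iff.mpr hz
    have hc : 0 < ‖z‖ ^ 2 / 4 := by positivity
    exact ((integrableOn_pow_mul_exp (n - 3) hc).const_mul C).add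
      ((integrableOn_pow_mul_exp (n - 1) hc).const_mul (2 * C * ‖z‖))
  have hbi : Integrable b ((volume.restrict (Set.Ioi 0)).prod (volume.restrict (ball 0 R))) := by
    rw [integrable_prod_iff' (by rw [hb]; exact Continuous.aestronglyMeasurable (by fun_prop))]
    refine ⟨hne.mono hi, ?_⟩
    set c1 := ∫ v in Set.Ioi (0 : ℝ), v ^ (n - 3) * Real.exp (-(1 / 4) * v ^ 2)
    set c2 := ∫ v in Set.Ioi (0 : ℝ), v ^ (n - 1) * Real.exp (-(1 / 4) * v ^ 2)
    have hform : ∀ z : EuclideanSpace ℝ (Fin n), z ≠ 0 →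
        ∫ v in Set.Ioi (0 : ℝ), ‖b (v, z)‖ =
          (C * c1 * ‖z‖ + 2 * C * c2) * (‖z‖ ^ (n - 1))⁻¹ := fun z hz => by
      have hz' : 0 < ‖z‖ := norm_pos_iff.mpr hz
      have : ∫ v in Set.Ioi (0 : ℝ), ‖b (v, z)‖ = ∫ v in Set.Ioi (0 : ℝ), b (v, z) := by
        refine setIntegral_congr_fun measurableSet_Ioi fun v hv => ?_
        have : (0 : ℝ) < v := hv
        exact Real.norm_of_nonneg (by positivity)
      have hc : 0 < ‖z‖ ^ 2 / 4 := by positivity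
      rw [this, hb]
      simp only
      rw [integral_add ((integrableOn_pow_mul_exp (n - 3) hc).const_mul C)
        ((integrableOn_pow_mul_exp (n - 1) hc).const_mul (2 * C * ‖z‖)),
        integral_const_mul, integral_const_mul, integral_pow_mul_exp_scale _ hz',
        integral_pow_mul_exp_scale _ hz']
      change C * ((‖z‖ ^ (n - 3 + 1))⁻¹ * c1) + 2 * C * ‖z‖ * ((‖z‖ ^ (n - 1 + 1))⁻¹ * c2) = _
      generalize c1 = c1
      generalize c2 = c2
      obtain ⟨k, rfl⟩ := Nat.exists_eq_add_of_le' hn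
      simp only [Nat.add_sub_cancel, show k + 3 - 1 = k + 2 by omega]
      field_simp
      ring
    refine Integrable.congr ?_ (hne.mono fun z hz => (hform z hz).symm)
    have h0 := integrableOn_inv_norm_pow (n := n) (by omega) R
    refine Integrable.bdd_mul (c := C * |c1| * R + 2 * C * |c2|) h0
      (Continuous.aestronglyMeasurable (by fun_prop)) ?_
    filter_upwards [hz] with z hz
    refine (norm_add_le _ _).trans ?_
    rw [norm_mul, norm_mul, norm_mul, norm_mul, norm_norm, Real.norm_of_nonneg hC]
    simp only [Real.norm_eq_abs, Nat.abs_ofNat]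
    gcongr
  refine hbi.mono' (aestronglyMeasurable_sliceJet hn _) ?_
  have h1 := Measure.ae_prod_mem_iff_ae_ae_mem (μ := volume.restrict (Set.Ioi (0 : ℝ)))
    (ν := volume.restrict (ball (0 : EuclideanSpace ℝ (Fin n)) R))
    (s := {p | 0 < p.1 ∧ p.2 ≠ 0 ∧ ‖p.2‖ ≤ R}) (by measurability)
  filter_upwards [h1.mpr (hv.mono fun v hv => by
    filter_upwards [hne, hz] with z h h' using ⟨hv, h, h'⟩)] with p hp
  exact norm_sliceJet_le hn hp.1 hp.2.1 hp.2.2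

end

section

/-- The time slices of which the fundamental solution is a superposition, normalized to be an
approximate identity for large `v`. -/
def heatKernel {n : ℕ} (v : ℝ) (z : EuclideanSpace ℝ (Fin n)) : ℂ :=
  contour v ^ n * Complex.exp ((contour v ^ 2)⁻¹) * cgauss (contour v ^ 2) z

variable {n : ℕ}

lemma lap_eq_sum_fderiv {g : EuclideanSpace ℝ (Fin n) → ℂ} (hg : ContDiff ℝ 2 g)
    (x : EuclideanSpace ℝ (Fin n)) :
    lap g x = ∑ i : Fin n, fderiv ℝ (fun y => fderiv ℝ g y (EuclideanSpace.single i 1)) x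
      (EuclideanSpace.single i 1) := by
  refine Finset.sum_congr rfl fun i _ => ?_
  have hd : DifferentiableAt ℝ (fderiv ℝ g) x :=
    (hg.fderiv_right (m := 1) (by norm_num)).differentiable (by norm_num) x
  rw [iteratedFDeriv_two_apply, fderiv_clm_apply hd (differentiableAt_const _)]
  simp

lemma continuous_lap {g : EuclideanSpace ℝ (Fin n) → ℂ} (hg : ContDiff ℝ 2 g) :
    Continuous (lap g) := by
  unfold lap
  refine continuous_finsetSum _ fun i _ => ?_
  exact (ContinuousMultilinearMap.apply ℝ (fun _ : Fin 2 => EuclideanSpace ℝ (Fin n)) ℂ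
    ![EuclideanSpace.single i 1, EuclideanSpace.single i 1]).continuous.comp
    (hg.continuous_iteratedFDeriv (m := 2) le_rfl)

lemma hasCompactSupport_lap {g : EuclideanSpace ℝ (Fin n) → ℂ} (hg : HasCompactSupport g) :
    HasCompactSupport (lap g) := by
  refine (hg.iteratedFDeriv (𝕜 := ℝ) 2).mono fun x hx => ?_
  contrapose! hx
  rw [Function.notMem_support] at hx ⊢
  simp [lap, hx]

lemma integral_mul_fderiv_apply {a g : EuclideanSpace ℝ (Fin n) → ℂ} (ha : ContDiff ℝ 1 a)
    (hg : ContDiff ℝ 1 g) (hgs : HasCompactSupport g) (e : EuclideanSpace ℝ (Fin n)) :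
    ∫ y, a y * fderiv ℝ g y e = -∫ y, fderiv ℝ a y e * g y := by
  have ha' : Continuous fun y => fderiv ℝ a y e :=
    (ha.continuous_fderiv (by norm_num)).clm_apply continuous_const
  have hg' : Continuous fun y => fderiv ℝ g y e :=
    (hg.continuous_fderiv (by norm_num)).clm_apply continuous_const
  refine integral_mul_fderiv_eq_neg_fderiv_mul_of_integrable ?_ ?_ ?_
    (fun x _ => ha.differentiable (by norm_num) x) (fun x _ => hg.differentiable (by norm_num) x)
  · exact (ha'.mul hg.continuous).integrable_of_hasCompactSupport hgs.mul_left
  · exact (ha.continuous.mul hg').integrable_of_hasCompactSupport (hgs.fderiv_apply ℝ e).mul_left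
  · exact (ha.continuous.mul hg.continuous).integrable_of_hasCompactSupport hgs.mul_left

lemma contDiff_cgauss (w : ℂ) : ContDiff ℝ 2 (cgauss (n := n) w) := by
  have : ContDiff ℝ 2 fun z : EuclideanSpace ℝ (Fin n) => ((‖z‖ ^ 2 : ℝ) : ℂ) :=
    Complex.ofRealCLM.contDiff.comp (contDiff_norm_sq ℝ)
  exact ((contDiff_const.mul this).div_const 4).cexp

lemma hasFDerivAt_cgauss_sub (w : ℂ) (x y : EuclideanSpace ℝ (Fin n)) :
    HasFDerivAt (fun y => cgauss w (x - y)) ((w / 2 * cgauss w (x - y)) • linForm (x - y)) y := by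
  have h : HasFDerivAt (fun y : EuclideanSpace ℝ (Fin n) => x - y)
    (-ContinuousLinearMap.id ℝ _) y := (hasFDerivAt_id y).const_sub x
  refine ((hasFDerivAt_cgauss w (x - y)).comp y h).congr_fderiv ?_
  ext z
  simp
  ring

lemma integral_cgauss_mul_lap (w : ℂ) (x : EuclideanSpace ℝ (Fin n))
    {g : EuclideanSpace ℝ (Fin n) → ℂ} (hg : ContDiff ℝ 2 g) (hgs : HasCompactSupport g) :
    ∫ y, cgauss w (x - y) * lap g y =
      ∫ y, (-(n / 2) * w + w ^ 2 * ((‖x - y‖ ^ 2 : ℝ) : ℂ) / 4) * cgauss w (x - y) * g y := by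
  set e : Fin n → EuclideanSpace ℝ (Fin n) := fun i => EuclideanSpace.single i 1 with he
  have hk : ContDiff ℝ 2 fun y => cgauss w (x - y) :=
    (contDiff_cgauss w).comp (contDiff_const.sub contDiff_id)
  have hl : ∀ i, ContDiff ℝ 2 fun y => linForm (x - y) (e i) := fun i => by
    simp only [linForm_apply]
    exact Complex.ofRealCLM.contDiff.comp ((contDiff_const.sub contDiff_id).inner ℝ contDiff_const)
  set k1 : Fin n → EuclideanSpace ℝ (Fin n) → ℂ := fun i y =>
    w / 2 * cgauss w (x - y) * linForm (x - y) (e i) with hk1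
  have hk1c : ∀ i, ContDiff ℝ 2 (k1 i) := fun i => (contDiff_const.mul hk).mul (hl i)
  have hf1 : ∀ i y, fderiv ℝ (fun y => cgauss w (x - y)) y (e i) = k1 i y := fun i y => by
    rw [(hasFDerivAt_cgauss_sub w x y).fderiv]
    simp [hk1]
  have hf2 : ∀ i y, fderiv ℝ (k1 i) y (e i) =
      (-w / 2 + w ^ 2 / 4 * (linForm (x - y) (e i)) ^ 2) * cgauss w (x - y) := fun i y => by
    have h1 : HasFDerivAt (fun y => linForm (x - y) (e i)) (-linForm (e i)) y := by
      have h : HasFDerivAt (fun y : EuclideanSpace ℝ (Fin n) => x - y)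
        (-ContinuousLinearMap.id ℝ _) y := (hasFDerivAt_id y).const_sub x
      have h2 : (fun y => linForm (x - y) (e i)) = fun y => linForm (e i) (x - y) := by
        ext y; simp [real_inner_comm]
      rw [h2]
      refine ((linForm (e i)).hasFDerivAt.comp y h).congr_fderiv ?_
      ext z; simp
    have h4 : HasFDerivAt (k1 i) _ y := ((hasFDerivAt_cgauss_sub w x y).const_mul (w / 2)).mul h1
    rw [h4.fderiv]
    have h3 : linForm (e i) (e i) = 1 := by simp [he]
    simp only [add_apply, smul_apply,
      neg_apply, h3, smul_eq_mul]
    ring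
  have hg1 : ∀ i, ContDiff ℝ 1 fun y => fderiv ℝ g y (e i) := fun i =>
    (hg.fderiv_right (m := 1) (by norm_num)).clm_apply contDiff_const
  have step : ∀ i, ∫ y, cgauss w (x - y) * fderiv ℝ (fun y => fderiv ℝ g y (e i)) y (e i) =
      ∫ y, (-w / 2 + w ^ 2 / 4 * (linForm (x - y) (e i)) ^ 2) * cgauss w (x - y) * g y := by
    intro i
    rw [integral_mul_fderiv_apply (hk.of_le (by norm_num)) (hg1 i) (hgs.fderiv_apply ℝ _)]
    simp_rw [hf1]
    rw [integral_mul_fderiv_apply ((hk1c i).of_le (by norm_num)) (hg.of_le (by norm_num)) hgs,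
      neg_neg]
    simp_rw [hf2]
  simp_rw [lap_eq_sum_fderiv hg, Finset.mul_sum]
  rw [integral_finsetSum]
  · have := Finset.sum_congr (rfl : (Finset.univ : Finset (Fin n)) = _) fun i _ => step i
    refine this.trans ?_
    rw [← integral_finsetSum]
    · congr 1
      ext y
      rw [← Finset.sum_mul, ← Finset.sum_mul, Finset.sum_add_distrib, ← Finset.mul_sum,
        Finset.sum_const, Finset.card_univ, Fintype.card_fin, EuclideanSpace.norm_sq_eq]
      simp [he, EuclideanSpace.inner_single_right]
      left; left; ring
    · intro i _
      have : Continuous fun y => linForm (x - y) (e i) := (hl i).continuous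
      refine Continuous.integrable_of_hasCompactSupport ?_ hgs.mul_left
      have := hk.continuous
      have := hg.continuous
      fun_prop
  · intro i _
    have hc := ((hg1 i).continuous_fderiv (by norm_num)).clm_apply
      (continuous_const (y := e i))
    exact (hk.continuous.mul hc).integrable_of_hasCompactSupport
      ((hgs.fderiv_apply ℝ (e i)).fderiv_apply ℝ (e i)).mul_left

/-- Differentiation under the integral sign against a continuous compactly supported weight. -/
lemma hasFDerivAt_integral_mul_of_hasCompactSupport {H : Type*} [NormedAddCommGroup H]
    [NormedSpace ℝ H] [ProperSpace H] {Φ : H → EuclideanSpace ℝ (Fin n) → ℂ}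
    {Φ' : H → EuclideanSpace ℝ (Fin n) → H →L[ℝ] ℂ} {g : EuclideanSpace ℝ (Fin n) → ℂ}
    (hg : Continuous g) (hgs : HasCompactSupport g) {U : Set H} (hU : IsOpen U) {v₀ : H}
    (hv₀ : v₀ ∈ U) (hΦ : ∀ v ∈ U, Continuous (Φ v))
    (hΦ' : ContinuousOn (Function.uncurry Φ') (U ×ˢ Set.univ))
    (hd : ∀ v ∈ U, ∀ y, HasFDerivAt (fun v => Φ v y) (Φ' v y) v) :
    HasFDerivAt (fun v => ∫ y, g y * Φ v y) (∫ y, g y • Φ' v₀ y) v₀ := by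
  obtain ⟨ε, hε, hεU⟩ := Metric.isOpen_iff.mp hU v₀ hv₀
  have hsub : closedBall v₀ (ε / 2) ⊆ U :=
    (closedBall_subset_ball (by linarith)).trans hεU
  have hcomp : IsCompact (closedBall v₀ (ε / 2) ×ˢ tsupport g) :=
    (isCompact_closedBall _ _).prod hgs
  obtain ⟨C, hC⟩ := hcomp.exists_bound_of_continuousOn
    (hΦ'.mono (Set.prod_mono hsub (Set.subset_univ _)))
  have hslice : ∀ v ∈ U, Continuous (Φ' v) := fun v hv => by
    rw [← continuousOn_univ]
    exact hΦ'.comp (f := fun y => (v, y)) (Continuous.prodMk_right v).continuousOn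
      fun y _ => ⟨hv, trivial⟩
  refine hasFDerivAt_integral_of_dominated_of_fderiv_le (bound := fun y => C * ‖g y‖)
    (closedBall_mem_nhds v₀ (half_pos hε)) (F := fun v y => g y * Φ v y)
    (F' := fun v y => g y • Φ' v y) ?_ ?_ ?_ ?_ ?_ ?_
  · filter_upwards [hU.mem_nhds hv₀] with v hv
    exact (hg.mul (hΦ v hv)).aestronglyMeasurable
  · exact (hg.mul (hΦ v₀ hv₀)).integrable_of_hasCompactSupport hgs.mul_right
  · exact (hg.smul (hslice v₀ hv₀)).aestronglyMeasurable
  · refine Eventually.of_forall fun y v hv => ?_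
    rw [norm_smul, mul_comm]
    by_cases hy : y ∈ tsupport g
    · exact mul_le_mul_of_nonneg_right (hC (v, y) ⟨hv, hy⟩) (norm_nonneg _)
    · simp [image_eq_zero_of_notMem_tsupport hy]
  · exact (hg.norm.integrable_of_hasCompactSupport hgs.norm).const_mul C
  · exact Eventually.of_forall fun y v hv => (hd v (hsub hv) y).const_mul (g y)

end

section

variable {n : ℕ}

lemma fundJet_eq_integral (hn : 3 ≤ n) {z : EuclideanSpace ℝ (Fin n)} (hz : z ≠ 0) :
    fundJet z = ∫ v in Set.Ioi (0 : ℝ), sliceJet v z := by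
  have hz' : 0 < (((‖z‖ ^ 2 : ℝ) : ℂ)).re := by
    rw [Complex.ofReal_re]
    have := norm_pos_iff.mpr hz
    positivity
  have hA := gaussIntegrable_amp (m := n - 1) (by omega)
  have i1 := hA.integrableOn hz'
  have i2 := hA.diffAmp.integrableOn hz'
  have i2' : Integrable (fun v => (2 * (diffAmp (amp (n - 1) 1) v *
      Complex.exp (-(contour v ^ 2) * ((‖z‖ ^ 2 : ℝ) : ℂ) / 4))) • linForm z)
      (volume.restrict (Set.Ioi 0)) := (i2.const_mul 2).smul_const _
  simp only [fundJet, sliceJet, radialJet, cgauss]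
  rw [integral_pair i1 i2', integral_smul_const, integral_const_mul]
  rfl

lemma measurePreserving_sub_snd {α : Type*} [MeasurableSpace α] (μ : Measure α) [SFinite μ]
    (x : EuclideanSpace ℝ (Fin n)) :
    MeasurePreserving (fun p : α × EuclideanSpace ℝ (Fin n) => (p.1, x - p.2))
      (μ.prod volume) (μ.prod volume) :=
  (MeasurePreserving.id μ).prod (Measure.measurePreserving_sub_left volume x)

lemma integrable_smul_sliceJet (hn : 3 ≤ n) {g : EuclideanSpace ℝ (Fin n) → ℂ}
    (hg : Continuous g) (hgs : HasCompactSupport g) (x : EuclideanSpace ℝ (Fin n)) :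
    Integrable (fun p : ℝ × EuclideanSpace ℝ (Fin n) => g p.2 • sliceJet p.1 (x - p.2))
      ((volume.restrict (Set.Ioi 0)).prod volume) := by
  obtain ⟨R, hR⟩ := hgs.isCompact.isBounded.subset_ball x
  obtain ⟨C, hC⟩ := hg.bounded_above_of_compact_support hgs
  have h1 : Integrable (fun p : ℝ × EuclideanSpace ℝ (Fin n) => g (x - p.2) • sliceJet p.1 p.2)
      ((volume.restrict (Set.Ioi 0)).prod (volume.restrict (ball 0 R))) :=
    (integrable_sliceJet hn R).bdd_smul C
      (Continuous.aestronglyMeasurable (by fun_prop)) (Eventually.of_forall fun p => hC _)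
  have h2 : Integrable (fun p : ℝ × EuclideanSpace ℝ (Fin n) => g (x - p.2) • sliceJet p.1 p.2)
      ((volume.restrict (Set.Ioi 0)).prod volume) := by
    have h3 : IntegrableOn
        (fun p : ℝ × EuclideanSpace ℝ (Fin n) => g (x - p.2) • sliceJet p.1 p.2)
        (Set.univ ×ˢ ball 0 R) ((volume.restrict (Set.Ioi 0)).prod volume) := by
      rwa [IntegrableOn, ← Measure.prod_restrict, Measure.restrict_univ]
    refine (integrableOn_iff_integrable_of_support_subset (ε' := JetSpace n) ?_).mp h3
    intro p hp
    refine ⟨trivial, ?_⟩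
    have : g (x - p.2) ≠ 0 := fun h => hp (by simp only [h]; exact zero_smul ℂ (sliceJet p.1 p.2))
    have := hR (subset_tsupport g this)
    simpa [dist_eq_norm] using this
  have := ((measurePreserving_sub_snd (volume.restrict (Set.Ioi (0 : ℝ))) x).integrable_comp
    h2.aestronglyMeasurable).mpr h2
  simpa [Function.comp_def] using this

lemma continuous_heatKernel {v : ℝ} : Continuous (heatKernel (n := n) v) :=
  continuous_const.mul (continuous_cgauss.comp (Continuous.prodMk_right _))

/-- The derivative of `heatKernel` in `v`. -/
def heatKernelDeriv (v : ℝ) (z : EuclideanSpace ℝ (Fin n)) : ℂ :=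
  -(amp (n - 1) 1 v * cgauss (contour v ^ 2) z *
    (1 - n / 2 * contour v ^ 2 + contour v ^ 4 * ((‖z‖ ^ 2 : ℝ) : ℂ) / 4))

lemma hasDerivAt_heatKernel (hn : 1 ≤ n) {v : ℝ} (hv : 0 < v) (z : EuclideanSpace ℝ (Fin n)) :
    HasDerivAt (fun v => heatKernel v z) (heatKernelDeriv v z) v := by
  have := hasDerivAt_contour_gaussian (n - 1) 1 ((‖z‖ ^ 2 : ℝ) : ℂ) hv
  rw [Nat.sub_add_cancel hn, Nat.cast_sub hn] at this
  simpa [heatKernel, heatKernelDeriv, cgauss] using this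

lemma continuousOn_heatKernelDeriv (x : EuclideanSpace ℝ (Fin n)) :
    ContinuousOn (fun p : ℝ × EuclideanSpace ℝ (Fin n) => heatKernelDeriv p.1 (x - p.2))
      (Set.Ioi 0 ×ˢ Set.univ) := by
  have hcg : Continuous fun p : ℝ × EuclideanSpace ℝ (Fin n) =>
      cgauss (contour p.1 ^ 2) (x - p.2) :=
    continuous_cgauss.comp (((continuous_contour.comp continuous_fst).pow 2).prodMk
      (continuous_const.sub continuous_snd))
  have h1 : ContinuousOn (fun p : ℝ × EuclideanSpace ℝ (Fin n) => amp (n - 1) 1 p.1)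
      (Set.Ioi 0 ×ˢ Set.univ) :=
    (continuousOn_amp (n - 1) 1).comp continuous_fst.continuousOn fun p hp => hp.1
  have h2 : Continuous fun p : ℝ × EuclideanSpace ℝ (Fin n) =>
      1 - n / 2 * contour p.1 ^ 2 + contour p.1 ^ 4 * ((‖x - p.2‖ ^ 2 : ℝ) : ℂ) / 4 := by
    have := continuous_contour
    fun_prop
  exact ((h1.mul hcg.continuousOn).mul h2.continuousOn).neg

lemma integral_mul_heatKernelDeriv {g : EuclideanSpace ℝ (Fin n) → ℂ}
    (hg : ContDiff ℝ 2 g) (hgs : HasCompactSupport g) (x : EuclideanSpace ℝ (Fin n)) (v : ℝ) :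
    ∫ y, g y * heatKernelDeriv v (x - y) =
      -∫ y, (lap g y + g y) * (sliceJet v (x - y)).1 := by
  have h1 := integral_cgauss_mul_lap (contour v ^ 2) x hg hgs
  have hcv : Continuous fun y => cgauss (contour v ^ 2) (x - y) :=
    continuous_cgauss.comp (continuous_const.prodMk (continuous_const.sub continuous_id))
  have hl := continuous_lap hg
  have i1 : Integrable fun y => cgauss (contour v ^ 2) (x - y) * lap g y :=
    (hcv.mul hl).integrable_of_hasCompactSupport (hasCompactSupport_lap hgs).mul_left
  have i2 : Integrable fun y => cgauss (contour v ^ 2) (x - y) * g y :=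
    (hcv.mul hg.continuous).integrable_of_hasCompactSupport hgs.mul_left
  have i3 : Integrable fun y => (-(n / 2) * contour v ^ 2 + (contour v ^ 2) ^ 2 *
      ((‖x - y‖ ^ 2 : ℝ) : ℂ) / 4) * cgauss (contour v ^ 2) (x - y) * g y := by
    refine Continuous.integrable_of_hasCompactSupport ?_ hgs.mul_left
    have := hg.continuous
    fun_prop
  have e1 : ∫ y, (lap g y + g y) * (sliceJet v (x - y)).1 =
      amp (n - 1) 1 v * ((∫ y, cgauss (contour v ^ 2) (x - y) * lap g y) +
        ∫ y, cgauss (contour v ^ 2) (x - y) * g y) := by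
    rw [← integral_add i1 i2, ← integral_const_mul]
    congr 1; ext y
    simp only [sliceJet, radialJet]; ring
  have e2 : ∫ y, g y * heatKernelDeriv v (x - y) = -(amp (n - 1) 1 v *
      ((∫ y, (-(n / 2) * contour v ^ 2 + (contour v ^ 2) ^ 2 *
      ((‖x - y‖ ^ 2 : ℝ) : ℂ) / 4) * cgauss (contour v ^ 2) (x - y) * g y) +
        ∫ y, cgauss (contour v ^ 2) (x - y) * g y)) := by
    rw [← integral_add i3 i2, ← integral_const_mul, ← integral_neg]
    congr 1; ext y
    simp only [heatKernelDeriv]; ring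
  rw [e1, e2, h1]

lemma hasDerivAt_integral_heatKernel (hn : 1 ≤ n) {g : EuclideanSpace ℝ (Fin n) → ℂ}
    (hg : ContDiff ℝ 2 g) (hgs : HasCompactSupport g) (x : EuclideanSpace ℝ (Fin n)) {v : ℝ}
    (hv : 0 < v) :
    HasDerivAt (fun v => ∫ y, g y * heatKernel v (x - y))
      (-∫ y, (lap g y + g y) * (sliceJet v (x - y)).1) v := by
  have hDc := continuousOn_heatKernelDeriv x
  have hT := (ContinuousLinearMap.toSpanSingletonCLE (𝕜 := ℝ) (E := ℂ)).continuous
  have hT' : ContinuousOn (fun p : ℝ × EuclideanSpace ℝ (Fin n) =>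
      ContinuousLinearMap.toSpanSingleton ℝ (heatKernelDeriv p.1 (x - p.2)))
      (Set.Ioi 0 ×ˢ Set.univ) := hT.comp_continuousOn hDc
  have hd : ∀ v ∈ Set.Ioi (0 : ℝ), ∀ y : EuclideanSpace ℝ (Fin n),
      HasFDerivAt (fun v => heatKernel v (x - y))
        (ContinuousLinearMap.toSpanSingleton ℝ (heatKernelDeriv v (x - y))) v :=
    fun v hv y => (hasDerivAt_heatKernel hn hv (x - y)).hasFDerivAt
  have hk : ∀ v ∈ Set.Ioi (0 : ℝ), Continuous fun y => heatKernel v (x - y) :=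
    fun v _ => continuous_heatKernel.comp (continuous_const.sub continuous_id)
  have key := hasFDerivAt_integral_mul_of_hasCompactSupport hg.continuous hgs isOpen_Ioi
    (v₀ := v) hv (Φ := fun v y => heatKernel v (x - y))
    (Φ' := fun v y => ContinuousLinearMap.toSpanSingleton ℝ (heatKernelDeriv v (x - y))) hk hT' hd
  rw [← integral_mul_heatKernelDeriv hg hgs]
  have e : ∫ y, g y • ContinuousLinearMap.toSpanSingleton ℝ (heatKernelDeriv v (x - y)) =
      ContinuousLinearMap.toSpanSingleton ℝ (∫ y, g y * heatKernelDeriv v (x - y)) := by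
    refine Eq.trans ?_ ((ContinuousLinearMap.toSpanSingletonCLE (𝕜 := ℝ)
      (E := ℂ)).integral_comp_comm fun y => g y * heatKernelDeriv v (x - y))
    refine integral_congr_ae (Eventually.of_forall fun y => ?_)
    ext
    simp
  rw [e] at key
  exact hasDerivAt_iff_hasFDerivAt.mpr key

lemma norm_heatKernel_le {v : ℝ} (hv : 0 < v) (z : EuclideanSpace ℝ (Fin n)) :
    ‖heatKernel v z‖ ≤ (2 * v) ^ n * Real.exp 2 *
      Real.exp ((1 / 4 - v ^ 2) * ‖z‖ ^ 2 / 4) := by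
  have h1 : ‖contour v‖ ≤ 2 * v := by simpa [abs_of_pos hv] using norm_contour_le v
  have h2 : ‖Complex.exp ((contour v ^ 2)⁻¹)‖ ≤ Real.exp 2 := by
    rw [Complex.norm_exp, Real.exp_le_exp]
    exact inv_contour_sq_re_le hv
  have h3 := norm_cexp_neg_contour_sq_mul_le v (ζ := ((‖z‖ ^ 2 : ℝ) : ℂ))
    (by rw [Complex.ofReal_re]; positivity)
  rw [Complex.ofReal_im, abs_zero, zero_div, Real.exp_zero, one_mul, Complex.ofReal_re] at h3
  rw [heatKernel, norm_mul, norm_mul, norm_pow]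
  gcongr
  exact h3

lemma norm_heatKernel_le_pow {v : ℝ} (hv : 0 < v) (z : EuclideanSpace ℝ (Fin n)) :
    ‖heatKernel v z‖ ≤ (2 * v) ^ n * Real.exp 2 := by
  have h1 : ‖contour v‖ ≤ 2 * v := by simpa [abs_of_pos hv] using norm_contour_le v
  have h2 : ‖Complex.exp ((contour v ^ 2)⁻¹)‖ ≤ Real.exp 2 := by
    rw [Complex.norm_exp, Real.exp_le_exp]
    exact inv_contour_sq_re_le hv
  have h3 : ‖cgauss (contour v ^ 2) z‖ ≤ 1 := by
    rw [cgauss, Complex.norm_exp, Real.exp_le_one_iff]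
    have := contour_sq_re_nonneg v
    have h : (-contour v ^ 2 * ((‖z‖ ^ 2 : ℝ) : ℂ) / 4).re =
        -((contour v ^ 2).re * ‖z‖ ^ 2 / 4) := by
      rw [show (4 : ℂ) = ((4 : ℝ) : ℂ) by norm_num, Complex.div_ofReal_re, Complex.re_mul_ofReal,
        Complex.neg_re]
      ring
    rw [h, neg_nonpos]
    positivity
  rw [heatKernel, norm_mul, norm_mul, norm_pow]
  calc _ ≤ (2 * v) ^ n * Real.exp 2 * 1 := by gcongr
    _ = _ := mul_one _

end

section

variable {n : ℕ}

lemma integrable_exp_neg_mul_norm_sq {b : ℝ} (hb : 0 < b) :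
    Integrable fun u : EuclideanSpace ℝ (Fin n) => Real.exp (-b * ‖u‖ ^ 2) := by
  refine not_imp_comm.1 integral_undef ?_
  rw [GaussianFourier.integral_rexp_neg_mul_sq_norm hb]
  positivity

/-- The total mass of `u ↦ exp (-‖u‖² / 4)`. -/
def gaussMass (n : ℕ) : ℝ := ∫ u : EuclideanSpace ℝ (Fin n), Real.exp (-(1 / 4) * ‖u‖ ^ 2)

lemma gaussMass_pos (n : ℕ) : 0 < gaussMass n := by
  rw [gaussMass, GaussianFourier.integral_rexp_neg_mul_sq_norm (by norm_num)]
  positivity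

lemma tendsto_contour_div : Tendsto (fun v : ℝ => contour v / v) atTop (nhds 1) := by
  have h1 : Tendsto (fun v : ℝ => 1 + v ^ 2) atTop atTop :=
    tendsto_atTop_add_const_left _ _ (tendsto_pow_atTop two_ne_zero)
  have h2 : Tendsto (fun v : ℝ => 1 - ((1 + v ^ 2)⁻¹ : ℝ) * Complex.I) atTop
      (nhds (1 - ((0 : ℝ) : ℂ) * Complex.I)) :=
    tendsto_const_nhds.sub
      (((Complex.continuous_ofReal.tendsto _).comp h1.inv_tendsto_atTop).mul_const _)
  rw [Complex.ofReal_zero, zero_mul, sub_zero] at h2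
  refine h2.congr' ?_
  filter_upwards [eventually_gt_atTop 0] with v hv
  have hv' : (v : ℂ) ≠ 0 := by exact_mod_cast hv.ne'
  have h3 : (1 + (v : ℂ) ^ 2) ≠ 0 := by
    have : (1 + v ^ 2) ≠ 0 := by positivity
    exact_mod_cast this
  rw [contour]
  push_cast
  field_simp

lemma tendsto_integral_heatKernel_atTop {g : EuclideanSpace ℝ (Fin n) → ℂ}
    (hg : Continuous g) (hgs : HasCompactSupport g) (x : EuclideanSpace ℝ (Fin n)) :
    Tendsto (fun v => ∫ y, g y * heatKernel v (x - y)) atTop (nhds (gaussMass n * g x)) := by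
  obtain ⟨C, hC⟩ := hg.bounded_above_of_compact_support hgs
  have hC0 : 0 ≤ C := (norm_nonneg _).trans (hC 0)
  have hscale : ∀ v : ℝ, 0 < v → ∫ y, g y * heatKernel v (x - y) =
      ∫ u, ((v : ℂ) ^ n)⁻¹ * (g (x - v⁻¹ • u) * heatKernel v (v⁻¹ • u)) := by
    intro v hv
    have hv' : (v : ℂ) ≠ 0 := by exact_mod_cast hv.ne'
    rw [integral_const_mul, Measure.integral_comp_smul volume
      (fun z => g (x - z) * heatKernel v z), finrank_euclideanSpace_fin, inv_pow, inv_inv,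
      abs_of_pos (by positivity), ← integral_sub_left_eq_self _ _ x, Complex.real_smul,
      Complex.ofReal_pow, inv_mul_cancel_left₀ (pow_ne_zero _ hv')]
    simp only [sub_sub_cancel]
  have hlim : (gaussMass n : ℂ) * g x =
      ∫ u : EuclideanSpace ℝ (Fin n), g x * ((Real.exp (-(1 / 4) * ‖u‖ ^ 2) : ℝ) : ℂ) := by
    rw [integral_const_mul, integral_complex_ofReal, gaussMass, mul_comm]
  rw [hlim]
  refine Tendsto.congr' (f₁ := fun v : ℝ =>
    ∫ u, ((v : ℂ) ^ n)⁻¹ * (g (x - v⁻¹ • u) * heatKernel v (v⁻¹ • u))) ?_ ?_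
  · filter_upwards [eventually_gt_atTop 0] with v hv using (hscale v hv).symm
  refine tendsto_integral_filter_of_dominated_convergence
    (fun u => C * (2 ^ n * Real.exp 2) * Real.exp (-(3 / 16) * ‖u‖ ^ 2)) ?_ ?_ ?_ ?_
  · refine Eventually.of_forall fun v => Continuous.aestronglyMeasurable ?_
    have := continuous_heatKernel (n := n) (v := v)
    fun_prop
  · filter_upwards [eventually_ge_atTop 1] with v hv
    have hv0 : 0 < v := by linarith
    refine Eventually.of_forall fun u => ?_
    have h1 := norm_heatKernel_le hv0 (v⁻¹ • u)
    rw [norm_smul, Real.norm_of_nonneg (by positivity)] at h1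
    have h2 : (1 / 4 - v ^ 2) * (v⁻¹ * ‖u‖) ^ 2 / 4 ≤ -(3 / 16) * ‖u‖ ^ 2 := by
      have h3 : (1 / 4 - v ^ 2) * (v⁻¹ * ‖u‖) ^ 2 / 4 =
          (1 / 4 * (v⁻¹) ^ 2 - 1) * ‖u‖ ^ 2 / 4 := by field_simp
      have h4 : (v⁻¹) ^ 2 ≤ 1 := pow_le_one₀ (by positivity) (inv_le_one_of_one_le₀ hv)
      rw [h3]
      nlinarith [sq_nonneg ‖u‖]
    rw [norm_mul, norm_mul, norm_inv, norm_pow, Complex.norm_real, Real.norm_of_nonneg hv0.le]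
    calc _ ≤ (v ^ n)⁻¹ * (C * ((2 * v) ^ n * Real.exp 2 * Real.exp (-(3 / 16) * ‖u‖ ^ 2))) := by
          gcongr
          · exact hC _
          · exact h1.trans (by gcongr)
      _ = _ := by rw [mul_pow]; field_simp
  · exact (integrable_exp_neg_mul_norm_sq (by norm_num)).const_mul _
  · refine Eventually.of_forall fun u => ?_
    have hinv : Tendsto (fun v : ℝ => v⁻¹) atTop (nhds 0) := tendsto_inv_atTop_zero
    have t1 : Tendsto (fun v : ℝ => g (x - v⁻¹ • u)) atTop (nhds (g x)) := by
      have : Tendsto (fun v : ℝ => x - v⁻¹ • u) atTop (nhds (x - (0 : ℝ) • u)) :=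
        tendsto_const_nhds.sub (hinv.smul_const u)
      rw [zero_smul, sub_zero] at this
      exact (hg.tendsto x).comp this
    have t2 := tendsto_contour_div
    have t3 : Tendsto (fun v : ℝ => Complex.exp (((contour v / v) ^ 2)⁻¹ * ((v⁻¹ : ℝ) : ℂ) ^ 2))
        atTop (nhds (Complex.exp ((1 ^ 2)⁻¹ * ((0 : ℝ) : ℂ) ^ 2))) :=
      (Complex.continuous_exp.tendsto _).comp (((t2.pow 2).inv₀ (by norm_num)).mul
        (((Complex.continuous_ofReal.tendsto _).comp hinv).pow 2))
    have t4 : Tendsto (fun v : ℝ => Complex.exp (-(contour v / v) ^ 2 *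
        ((‖u‖ ^ 2 : ℝ) : ℂ) / 4)) atTop
        (nhds (Complex.exp (-1 ^ 2 * ((‖u‖ ^ 2 : ℝ) : ℂ) / 4))) :=
      (Complex.continuous_exp.tendsto _).comp (((t2.pow 2).neg.mul_const _).div_const _)
    have t5 := t1.mul (((t2.pow n).mul t3).mul t4)
    have e5 : g x * (1 ^ n * Complex.exp ((1 ^ 2)⁻¹ * ((0 : ℝ) : ℂ) ^ 2) *
        Complex.exp (-1 ^ 2 * ((‖u‖ ^ 2 : ℝ) : ℂ) / 4)) =
        g x * ((Real.exp (-(1 / 4) * ‖u‖ ^ 2) : ℝ) : ℂ) := by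
      simp
      left; ring_nf
    rw [e5] at t5
    refine t5.congr' ?_
    filter_upwards [eventually_gt_atTop 0] with v hv
    have hv' : (v : ℂ) ≠ 0 := by exact_mod_cast hv.ne'
    have hc := contour_ne_zero hv
    rw [heatKernel, cgauss, norm_smul, Real.norm_of_nonneg (by positivity)]
    have a1 : ((contour v / v) ^ 2)⁻¹ * ((v⁻¹ : ℝ) : ℂ) ^ 2 = (contour v ^ 2)⁻¹ := by
      push_cast; field_simp
    have a2 : -(contour v / v) ^ 2 * ((‖u‖ ^ 2 : ℝ) : ℂ) / 4 =
        -contour v ^ 2 * (((v⁻¹ * ‖u‖) ^ 2 : ℝ) : ℂ) / 4 := by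
      push_cast; field_simp
    rw [a1, a2, div_pow]
    field_simp

lemma continuousWithinAt_integral_heatKernel (hn : 1 ≤ n) {g : EuclideanSpace ℝ (Fin n) → ℂ}
    (hg : Continuous g) (hgs : HasCompactSupport g) (x : EuclideanSpace ℝ (Fin n)) :
    ContinuousWithinAt (fun v => ∫ y, g y * heatKernel v (x - y)) (Set.Ici 0) 0 ∧
      ∫ y, g y * heatKernel 0 (x - y) = 0 := by
  have h0 : ∀ z : EuclideanSpace ℝ (Fin n), heatKernel 0 z = 0 := fun z => by
    have hn0 : n ≠ 0 := by omega
    simp [heatKernel, contour, hn0]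
  have hz : ∫ y, g y * heatKernel 0 (x - y) = 0 := by simp [h0]
  refine ⟨?_, hz⟩
  rw [ContinuousWithinAt, hz]
  have hb : ∀ v ∈ Set.Ici (0 : ℝ), ‖∫ y, g y * heatKernel v (x - y)‖ ≤
      (2 * v) ^ n * (Real.exp 2 * ∫ y, ‖g y‖) := by
    intro v hv
    rcases eq_or_lt_of_le (Set.mem_Ici.mp hv) with h | h
    · rw [← h, hz, norm_zero]
      have : 0 ≤ ∫ y, ‖g y‖ := integral_nonneg fun y => norm_nonneg _
      positivity
    · rw [← integral_const_mul, ← integral_const_mul]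
      refine norm_integral_le_of_norm_le
        (((hg.norm.integrable_of_hasCompactSupport hgs.norm).const_mul _).const_mul _)
        (Eventually.of_forall fun y => ?_)
      rw [norm_mul, ← mul_assoc, mul_comm]
      exact mul_le_mul_of_nonneg_right (norm_heatKernel_le_pow h _) (norm_nonneg _)
  have hlim : Tendsto (fun v : ℝ => (2 * v) ^ n * (Real.exp 2 * ∫ y, ‖g y‖))
      (nhdsWithin 0 (Set.Ici 0)) (nhds 0) := by
    have : Continuous fun v : ℝ => (2 * v) ^ n * (Real.exp 2 * ∫ y, ‖g y‖) := by fun_prop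
    have h := this.tendsto 0
    simp only [mul_zero, zero_pow (by omega : n ≠ 0), zero_mul] at h
    exact h.mono_left nhdsWithin_le_nhds
  exact squeeze_zero_norm' (eventually_nhdsWithin_of_forall hb) hlim

/-- A compactly supported function is the potential of its image under `lap + 1`. -/
lemma gaussMass_mul_eq_integral (hn : 3 ≤ n) {g : EuclideanSpace ℝ (Fin n) → ℂ}
    (hg : ContDiff ℝ 2 g) (hgs : HasCompactSupport g) (x : EuclideanSpace ℝ (Fin n)) :
    (gaussMass n : ℂ) * g x =
      -∫ v in Set.Ioi (0 : ℝ), ∫ y, (lap g y + g y) * (sliceJet v (x - y)).1 := by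
  have hr : Continuous fun y => lap g y + g y := (continuous_lap hg).add hg.continuous
  have hrs : HasCompactSupport fun y => lap g y + g y := (hasCompactSupport_lap hgs).add hgs
  obtain ⟨h1, h2⟩ := continuousWithinAt_integral_heatKernel (by omega) hg.continuous hgs x
  have := integral_Ioi_of_hasDerivAt_of_tendsto h1
    (fun v hv => hasDerivAt_integral_heatKernel (by omega) hg hgs x hv)
    (Integrable.neg ?_) (tendsto_integral_heatKernel_atTop hg.continuous hgs x)
  · rw [h2, sub_zero, integral_neg] at this
    exact this.symm
  · exact (integrable_smul_sliceJet hn hr hrs x).fst.integral_prod_left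

end

section

variable {n : ℕ}

lemma continuous_sliceJet (v : ℝ) : Continuous (sliceJet (n := n) v) := by
  have h : Continuous fun z : EuclideanSpace ℝ (Fin n) => cgauss (contour v ^ 2) z :=
    continuous_cgauss.comp (Continuous.prodMk_right _)
  exact continuous_radialJet.comp
    ((continuous_const.mul h).prodMk ((continuous_const.mul h).prodMk continuous_id))

lemma hasFDerivAt_sliceJet_fst_sub (v : ℝ) (x y : EuclideanSpace ℝ (Fin n)) :
    HasFDerivAt (fun x => (sliceJet v (x - y)).1) (sliceJet v (x - y)).2 x := by
  have h : HasFDerivAt (fun x : EuclideanSpace ℝ (Fin n) => x - y)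
    (ContinuousLinearMap.id ℝ _) x := (hasFDerivAt_id x).sub_const y
  have h1 := (((hasFDerivAt_cgauss (contour v ^ 2) (x - y)).const_mul
    (amp (n - 1) 1 v)).comp x h)
  refine h1.congr_fderiv ?_
  ext z
  simp [sliceJet, radialJet, diffAmp]
  ring

lemma hasFDerivAt_integral_sliceJet {g : EuclideanSpace ℝ (Fin n) → ℂ}
    (hg : Continuous g) (hgs : HasCompactSupport g) (v : ℝ) (x : EuclideanSpace ℝ (Fin n)) :
    HasFDerivAt (fun x => ∫ y, g y * (sliceJet v (x - y)).1)
      (∫ y, g y • (sliceJet v (x - y)).2) x := by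
  have hc : ∀ x : EuclideanSpace ℝ (Fin n), Continuous fun y => (sliceJet v (x - y)).1 :=
    fun x => ((continuous_sliceJet v).comp (continuous_const.sub continuous_id)).fst
  have hc' : Continuous fun p : EuclideanSpace ℝ (Fin n) × EuclideanSpace ℝ (Fin n) =>
      (sliceJet v (p.1 - p.2)).2 :=
    ((continuous_sliceJet v).comp (continuous_fst.sub continuous_snd)).snd
  exact hasFDerivAt_integral_mul_of_hasCompactSupport hg hgs isOpen_univ (Set.mem_univ x)
    (Φ := fun x y => (sliceJet v (x - y)).1) (Φ' := fun x y => (sliceJet v (x - y)).2)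
    (fun x _ => hc x) hc'.continuousOn (fun x _ y => hasFDerivAt_sliceJet_fst_sub v x y)

lemma norm_integral_smul_sliceJet_snd_le {g : EuclideanSpace ℝ (Fin n) → ℂ}
    (hg : Continuous g) {C R r : ℝ} (hC : ∀ y, ‖g y‖ ≤ C) {x x' : EuclideanSpace ℝ (Fin n)}
    (hR : tsupport g ⊆ ball x R) (hx' : x' ∈ ball x r) (v : ℝ) :
    ‖∫ y, g y • (sliceJet v (x' - y)).2‖ ≤
      C * ∫ z in ball (0 : EuclideanSpace ℝ (Fin n)) (R + r), ‖sliceJet v z‖ := by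
  have hC0 : 0 ≤ C := (norm_nonneg _).trans (hC 0)
  have hsub : ∀ z ∉ ball (0 : EuclideanSpace ℝ (Fin n)) (R + r),
      ‖g (x' - z)‖ * ‖sliceJet v z‖ = 0 := by
    intro z hz
    have : g (x' - z) = 0 := by
      by_contra h
      have h1 := hR (subset_tsupport g h)
      rw [mem_ball, dist_eq_norm] at h1 hx'
      refine hz (mem_ball_zero_iff.mpr ?_)
      calc ‖z‖ = ‖(x' - x) - (x' - z - x)‖ := by congr 1; abel
        _ ≤ ‖x' - x‖ + ‖x' - z - x‖ := norm_sub_le _ _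
        _ < R + r := by linarith
    rw [this, norm_zero, zero_mul]
  have hcs := (continuous_sliceJet (n := n) v).norm
  have hi : ∀ f : EuclideanSpace ℝ (Fin n) → ℝ, Continuous f →
      IntegrableOn f (ball 0 (R + r)) := fun f hf =>
    (hf.continuousOn.integrableOn_compact (isCompact_closedBall 0 (R + r))).mono_set
      ball_subset_closedBall
  calc _ ≤ ∫ y, ‖g y • (sliceJet v (x' - y)).2‖ := norm_integral_le_integral_norm _
    _ = ∫ z, ‖g (x' - z) • (sliceJet v z).2‖ := by
        rw [← integral_sub_left_eq_self _ _ x']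
        simp only [sub_sub_cancel]
    _ = ∫ z in ball 0 (R + r), ‖g (x' - z) • (sliceJet v z).2‖ := by
        rw [setIntegral_eq_integral_of_forall_compl_eq_zero]
        intro z hz
        refine le_antisymm ?_ (norm_nonneg _)
        rw [← hsub z hz, norm_smul]
        exact mul_le_mul_of_nonneg_left (norm_snd_le _) (norm_nonneg _)
    _ ≤ ∫ z in ball 0 (R + r), C * ‖sliceJet v z‖ := by
        refine setIntegral_mono (hi _ ?_) (hi _ (continuous_const.mul hcs)) fun z => ?_
        · exact ((hg.comp (continuous_const.sub continuous_id)).smul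
            (continuous_sliceJet v).snd).norm
        · rw [norm_smul]
          exact mul_le_mul (hC _) (norm_snd_le _) (norm_nonneg _) hC0
    _ = _ := integral_const_mul _ _

/-- The jet of a compactly supported function is a superposition of jets of translated
fundamental solutions. -/
lemma jet_eq_integral_fundJet (hn : 3 ≤ n) {g : EuclideanSpace ℝ (Fin n) → ℂ}
    (hg : ContDiff ℝ 2 g) (hgs : HasCompactSupport g) (x : EuclideanSpace ℝ (Fin n)) :
    Integrable (fun y => (lap g y + g y) • fundJet (x - y)) ∧
      ((g x, fderiv ℝ g x) : JetSpace n) =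
        (-(gaussMass n : ℂ)⁻¹) • ∫ y, (lap g y + g y) • fundJet (x - y) := by
  set ρ := fun y => lap g y + g y with hρ
  have hr : Continuous ρ := (continuous_lap hg).add hg.continuous
  have hrs : HasCompactSupport ρ := (hasCompactSupport_lap hgs).add hgs
  have hI := fun x => integrable_smul_sliceJet hn hr hrs x
  have hne : ∀ᵐ y : EuclideanSpace ℝ (Fin n), x - y ≠ 0 := by
    have : Nonempty (Fin n) := ⟨⟨0, by omega⟩⟩
    simp [ae_iff, sub_eq_zero]
  have hfund : ∀ᵐ y : EuclideanSpace ℝ (Fin n),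
      ∫ v in Set.Ioi (0 : ℝ), ρ y • sliceJet v (x - y) = ρ y • fundJet (x - y) :=
    hne.mono fun y hy => by
      rw [fundJet_eq_integral hn hy]
      exact integral_smul (ρ y) fun v => sliceJet v (x - y)
  refine ⟨(hI x).integral_prod_right.congr hfund, ?_⟩
  have hm : (gaussMass n : ℂ) ≠ 0 := by exact_mod_cast (gaussMass_pos n).ne'
  have hswap : ∫ y, ρ y • fundJet (x - y) =
      ∫ v in Set.Ioi (0 : ℝ), ∫ y, ρ y • sliceJet v (x - y) := by
    rw [integral_integral_swap (f := fun v y => ρ y • sliceJet v (x - y)) (hI x)]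
    exact (integral_congr_ae hfund).symm
  have hval : ∀ x, g x = -(gaussMass n : ℂ)⁻¹ *
      ∫ v in Set.Ioi (0 : ℝ), ∫ y, ρ y * (sliceJet v (x - y)).1 := fun x => by
    have := gaussMass_mul_eq_integral hn hg hgs x
    rw [neg_mul, ← mul_neg, ← this, inv_mul_cancel_left₀ hm]
  obtain ⟨R, hR⟩ := hrs.isCompact.isBounded.subset_ball x
  obtain ⟨C, hC⟩ := hr.bounded_above_of_compact_support hrs
  have hder : HasFDerivAt (fun x => ∫ v in Set.Ioi (0 : ℝ), ∫ y, ρ y * (sliceJet v (x - y)).1)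
      (∫ v in Set.Ioi (0 : ℝ), ∫ y, ρ y • (sliceJet v (x - y)).2) x :=
    hasFDerivAt_integral_of_dominated_of_fderiv_le
      (bound := fun v => C * ∫ z in ball (0 : EuclideanSpace ℝ (Fin n)) (R + 1), ‖sliceJet v z‖)
      (ball_mem_nhds x one_pos)
      (Eventually.of_forall fun x => (hI x).fst.integral_prod_left.aestronglyMeasurable)
      (hI x).fst.integral_prod_left (hI x).snd.integral_prod_left.aestronglyMeasurable
      (Eventually.of_forall fun v x' hx' => norm_integral_smul_sliceJet_snd_le hr hC hR hx' v)
      ((integrable_sliceJet hn (R + 1)).norm.integral_prod_left.const_mul C)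
      (Eventually.of_forall fun v x' _ => hasFDerivAt_integral_sliceJet hr hrs v x')
  have hgder : fderiv ℝ g x = -(gaussMass n : ℂ)⁻¹ •
      ∫ v in Set.Ioi (0 : ℝ), ∫ y, ρ y • (sliceJet v (x - y)).2 := by
    rw [funext hval]
    exact (hder.const_mul _).fderiv
  rw [hswap]
  have hpair : ∫ v in Set.Ioi (0 : ℝ), ∫ y, ρ y • sliceJet v (x - y) =
      (∫ v in Set.Ioi (0 : ℝ), ∫ y, ρ y * (sliceJet v (x - y)).1,
        ∫ v in Set.Ioi (0 : ℝ), ∫ y, ρ y • (sliceJet v (x - y)).2) := by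
    refine Eq.trans (integral_congr_ae ?_)
      (integral_pair (hI x).fst.integral_prod_left (hI x).snd.integral_prod_left)
    filter_upwards [(hI x).prod_right_ae] with v hv
    exact integral_pair hv.fst hv.snd
  rw [hpair]
  exact Prod.ext (hval x) hgder

end

/-- The time parameter attached to a transversal frequency of squared length `t`. -/
def tilt (t : ℝ) : ℂ := 1 - (3 - 4 * Complex.I) * t

lemma tilt_ne_zero {t : ℝ} (ht : t ≠ 0) : tilt t ≠ 0 := by
  intro h
  have := congr_arg Complex.im h
  simp [tilt] at this
  exact ht this

lemma norm_cexp_tilt_le {v : ℝ} (hv : 0 < v) {t : ℝ} (ht : 0 ≤ t) :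
    ‖Complex.exp (tilt t * (contour v ^ 2)⁻¹)‖ ≤
      Real.exp 2 * Real.exp (-(3 * t / (2 * v ^ 2))) := by
  rw [Complex.norm_exp, ← Real.exp_add, Real.exp_le_exp]
  have h1 : (tilt t * (contour v ^ 2)⁻¹).re =
      ((contour v ^ 2)⁻¹).re - t * ((3 - 4 * Complex.I) * (contour v ^ 2)⁻¹).re := by
    rw [← Complex.re_ofReal_mul, ← Complex.sub_re]
    congr 1
    rw [tilt]; ring
  have h2 := inv_contour_sq_re_le hv
  have h3 := rotated_inv_contour_sq_re_ge hv
  have h4 : 3 / (2 * v ^ 2) ≤ 3 / ‖contour v ^ 2‖ := by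
    have h5 := div_one_add_sq_le v
    have h6 : 0 < ‖contour v ^ 2‖ := by rw [norm_contour_sq]; positivity
    refine div_le_div_of_nonneg_left (by norm_num) h6 ?_
    rw [norm_contour_sq]; linarith
  have h7 : t * (3 / (2 * v ^ 2)) ≤ t * ((3 - 4 * Complex.I) * (contour v ^ 2)⁻¹).re :=
    mul_le_mul_of_nonneg_left (h4.trans h3) ht
  rw [h1]
  have : t * (3 / (2 * v ^ 2)) = 3 * t / (2 * v ^ 2) := by ring
  linarith

lemma norm_amp_zero_tilt_le {v : ℝ} (hv : 0 < v) {t : ℝ} (ht : 0 ≤ t) :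
    ‖amp 0 (tilt t) v‖ ≤ 4 * Real.exp 2 * ((v ^ 2)⁻¹ * Real.exp (-(3 * t / (2 * v ^ 2)))) := by
  have h1 := norm_contourDeriv_le v
  have h2 := norm_cexp_tilt_le hv ht
  have h3 : v ^ 2 ≤ ‖contour v ^ 2‖ := by
    rw [norm_contour_sq]; nlinarith [sq_nonneg (v / (1 + v ^ 2))]
  have h4 : ‖contour v ^ 2‖⁻¹ ≤ (v ^ 2)⁻¹ := inv_anti₀ (by positivity) h3
  rw [amp, pow_zero, mul_one, norm_mul, norm_div, norm_mul, div_eq_mul_inv, Complex.norm_ofNat]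
  calc _ ≤ 2 * 2 * (v ^ 2)⁻¹ * (Real.exp 2 * Real.exp (-(3 * t / (2 * v ^ 2)))) := by gcongr
    _ = _ := by ring

lemma gaussIntegrable_amp_zero_tilt {t : ℝ} (ht : 0 < t) : GaussIntegrable (amp 0 (tilt t)) := by
  have hmeas := (continuousOn_amp 0 (tilt t)).aestronglyMeasurable (μ := volume) measurableSet_Ioi
  refine ⟨hmeas, fun c hc => ?_⟩
  refine Integrable.mono' ((integrableOn_pow_mul_exp 0 hc).const_mul
    (4 * Real.exp 2 * (2 / (3 * t)))) (hmeas.norm.mul (by fun_prop)) ?_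
  refine (ae_restrict_iff' measurableSet_Ioi).mpr (Eventually.of_forall fun v hv => ?_)
  rw [Real.norm_of_nonneg (by positivity), pow_zero, one_mul]
  refine mul_le_mul_of_nonneg_right ((norm_amp_zero_tilt_le hv ht.le).trans ?_) (by positivity)
  refine mul_le_mul_of_nonneg_left ?_ (by positivity)
  have hv' : 0 < v := hv
  set u := 3 * t / (2 * v ^ 2) with hu
  have h1 : (v ^ 2)⁻¹ = 2 / (3 * t) * u := by rw [hu]; field_simp
  have h2 : u * Real.exp (-u) ≤ 1 := by
    rw [Real.exp_neg, ← div_eq_mul_inv, div_le_one (Real.exp_pos _)]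
    linarith [Real.add_one_le_exp u]
  rw [h1, mul_assoc]
  exact mul_le_of_le_one_right (by positivity) h2

/-- The second-order equation satisfied by the transversal profiles. -/
lemma gaussTransform_amp_zero_tilt_ode {t : ℝ} (ht : 0 < t) {ζ : ℂ} (hζ : 0 < ζ.re) :
    4 * ζ * gaussTransform (diffAmp (diffAmp (amp 0 (tilt t)))) ζ +
      2 * gaussTransform (diffAmp (amp 0 (tilt t))) ζ +
      tilt t * gaussTransform (amp 0 (tilt t)) ζ = 0 := by
  have hA := gaussIntegrable_amp_zero_tilt ht
  set f : ℝ → ℂ := fun v => contour v ^ (0 + 1) * Complex.exp (tilt t * (contour v ^ 2)⁻¹) *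
        Complex.exp (-(contour v ^ 2) * ζ / 4) with hf
  have hbound : ∀ v : ℝ, 0 < v → ‖f v‖ ≤ 2 * v * Real.exp 2 * (Real.exp (|ζ.im| / 2) *
      Real.exp ((1 / 4 - v ^ 2) * ζ.re / 4)) := by
    intro v hv
    rw [hf, norm_mul, norm_mul, zero_add, pow_one]
    have h1 := norm_contour_le v
    rw [abs_of_pos hv] at h1
    have h2 : ‖Complex.exp (tilt t * (contour v ^ 2)⁻¹)‖ ≤ Real.exp 2 :=
      (norm_cexp_tilt_le hv ht.le).trans (mul_le_of_le_one_right (by positivity)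
        (Real.exp_le_one_iff.mpr (by rw [neg_nonpos]; positivity)))
    have h3 := norm_cexp_neg_contour_sq_mul_le v hζ.le
    gcongr
  have hf0 : f 0 = 0 := by simp [hf, contour]
  have hcont : ContinuousWithinAt f (Set.Ici 0) 0 := by
    rw [← Set.Ioi_insert, continuousWithinAt_insert_self, ContinuousWithinAt, hf0]
    refine squeeze_zero_norm' (Filter.eventually_of_mem self_mem_nhdsWithin
      fun v hv => hbound v hv) ?_
    have : Continuous fun v : ℝ => 2 * v * Real.exp 2 * (Real.exp (|ζ.im| / 2) *
      Real.exp ((1 / 4 - v ^ 2) * ζ.re / 4)) := by fun_prop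
    have h := this.tendsto 0
    simp only [mul_zero, zero_mul] at h
    exact h.mono_left nhdsWithin_le_nhds
  have htop : Tendsto f atTop (nhds 0) := by
    have h := tendsto_rpow_abs_mul_exp_neg_mul_sq_cocompact (a := ζ.re / 4) (by positivity) 1
    have h' := (h.mono_left atTop_le_cocompact).const_mul
      (2 * Real.exp 2 * Real.exp (|ζ.im| / 2) * Real.exp (ζ.re / 16))
    rw [mul_zero] at h'
    refine squeeze_zero_norm' ((eventually_gt_atTop 0).mono fun v hv => ?_) h'
    refine (hbound v hv).trans_eq ?_
    rw [abs_of_pos hv, Real.rpow_one,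
      show (1 / 4 - v ^ 2) * ζ.re / 4 = ζ.re / 16 + -(ζ.re / 4) * v ^ 2 by ring, Real.exp_add]
    ring
  have i0 := hA.integrableOn hζ
  have i1 := hA.diffAmp.integrableOn hζ
  have i2 := hA.diffAmp.diffAmp.integrableOn hζ
  have heq : ∀ v, -(amp 0 (tilt t) v * Complex.exp (-(contour v ^ 2) * ζ / 4) *
        (tilt t - ((0 : ℕ) + 1) / 2 * contour v ^ 2 + contour v ^ 4 * ζ / 4)) =
      -(4 * ζ * (diffAmp (diffAmp (amp 0 (tilt t))) v * Complex.exp (-(contour v ^ 2) * ζ / 4)) +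
        2 * (diffAmp (amp 0 (tilt t)) v * Complex.exp (-(contour v ^ 2) * ζ / 4)) +
        tilt t * (amp 0 (tilt t) v * Complex.exp (-(contour v ^ 2) * ζ / 4))) := by
    intro v
    simp only [diffAmp]
    push_cast
    ring
  have hint := ((i2.const_mul (4 * ζ)).add (i1.const_mul 2)).add (i0.const_mul (tilt t))
  have hmain := integral_Ioi_of_hasDerivAt_of_tendsto hcont
    (fun v hv => (hasDerivAt_contour_gaussian 0 (tilt t) ζ hv).congr_deriv (heq v))
    hint.neg htop
  rw [hf0, sub_zero, integral_neg, neg_eq_zero] at hmain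
  rw [← hmain, gaussTransform, gaussTransform, gaussTransform, ← integral_const_mul,
    ← integral_const_mul, ← integral_const_mul, ← integral_add (i2.const_mul _) (i1.const_mul _),
    ← integral_add ?_ (i0.const_mul _)]
  exact (i2.const_mul _).add (i1.const_mul _)

/-- Solutions of a linear second-order equation with constant coefficients on a half-line. -/
lemma exists_eq_exp_add_exp {g g' : ℝ → ℂ} {κ : ℂ} (hκ : κ ≠ 0)
    (hg : ∀ a, 0 < a → HasDerivAt g (g' a) a)
    (hg' : ∀ a, 0 < a → HasDerivAt g' (κ ^ 2 * g a) a) :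
    ∃ α β : ℂ, ∀ a, 0 < a → g a = α * Complex.exp (κ * a) + β * Complex.exp (-κ * a) := by
  have key : ∀ κ' : ℂ, κ' ^ 2 = κ ^ 2 → ∃ c : ℂ, ∀ a : ℝ, 0 < a →
      g' a + κ' * g a = c * Complex.exp (κ' * a) := by
    intro κ' hκ'
    have hd : ∀ a : ℝ, 0 < a → HasDerivAt
        (fun a : ℝ => Complex.exp (-κ' * a) * (g' a + κ' * g a)) 0 a := by
      intro a ha
      have h1 : HasDerivAt (fun a : ℝ => -κ' * (a : ℂ)) (-κ' * 1) a :=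
        (Complex.ofRealCLM.hasDerivAt (x := a)).const_mul _
      refine (h1.cexp.mul ((hg' a ha).add ((hg a ha).const_mul κ'))).congr_deriv ?_
      rw [← hκ', Pi.add_apply]
      ring
    refine ⟨Complex.exp (-κ' * (1 : ℝ)) * (g' 1 + κ' * g 1), fun a ha => ?_⟩
    have hc := (convex_Ioi (0 : ℝ)).is_const_of_fderivWithin_eq_zero (𝕜 := ℝ)
      (f := fun a : ℝ => Complex.exp (-κ' * a) * (g' a + κ' * g a))
      (fun a ha => (hd a ha).differentiableAt.differentiableWithinAt)
      (fun a ha => by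
        rw [fderivWithin_of_isOpen isOpen_Ioi ha]
        refine (hd a ha).hasFDerivAt.fderiv.trans ?_
        ext
        simp) ha (Set.mem_Ioi.mpr one_pos)
    rw [← hc, mul_right_comm, ← Complex.exp_add]
    simp
  obtain ⟨c, hc⟩ := key κ rfl
  obtain ⟨d, hd⟩ := key (-κ) (by ring)
  refine ⟨c / (2 * κ), -d / (2 * κ), fun a ha => ?_⟩
  have h1 := hc a ha
  have h2 := hd a ha
  have h3 : g a = (1 / (2 * κ)) * (2 * κ * g a) := by field_simp
  rw [h3]
  linear_combination (1 / (2 * κ)) * (h1 - h2)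

lemma exists_gaussTransform_eq_exp {t : ℝ} (ht : 0 < t) :
    ∃ κ α β : ℂ, κ ^ 2 = -tilt t ∧ ∀ a : ℝ, 0 < a →
      gaussTransform (amp 0 (tilt t)) ((a ^ 2 : ℝ) : ℂ) =
        α * Complex.exp (κ * a) + β * Complex.exp (-κ * a) := by
  obtain ⟨κ, hκ⟩ := IsAlgClosed.exists_pow_nat_eq (-tilt t) two_pos
  have hκ0 : κ ≠ 0 := by
    rintro rfl
    simp at hκ
    exact tilt_ne_zero ht.ne' hκ
  have hA := gaussIntegrable_amp_zero_tilt ht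
  have hre : ∀ a : ℝ, 0 < a → 0 < (((a ^ 2 : ℝ) : ℂ)).re := fun a ha => by
    rw [Complex.ofReal_re]; positivity
  have hsq : ∀ a : ℝ, HasDerivAt (fun a : ℝ => ((a ^ 2 : ℝ) : ℂ)) (2 * a) a := fun a => by
    have := (hasDerivAt_pow 2 a).ofReal_comp
    simpa using this
  have hchain : ∀ B : ℝ → ℂ, GaussIntegrable B → ∀ a : ℝ, 0 < a →
      HasDerivAt (fun a : ℝ => gaussTransform B ((a ^ 2 : ℝ) : ℂ))
        (gaussTransform (diffAmp B) ((a ^ 2 : ℝ) : ℂ) * (2 * a)) a := fun B hB a ha =>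
    HasDerivAt.comp (h₂ := gaussTransform B) a (hB.hasDerivAt (hre a ha)) (hsq a)
  obtain ⟨α, β, h⟩ := exists_eq_exp_add_exp hκ0 (hchain _ hA) (fun a ha => by
    have h2 : HasDerivAt (fun a : ℝ => 2 * (a : ℂ)) (2 * 1) a :=
      (Complex.ofRealCLM.hasDerivAt (x := a)).const_mul _
    refine ((hchain _ hA.diffAmp a ha).mul h2).congr_deriv ?_
    have := gaussTransform_amp_zero_tilt_ode ht (hre a ha)
    rw [hκ]
    push_cast at this ⊢
    linear_combination this)
  exact ⟨κ, α, β, hκ, h⟩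

section

variable {n m : ℕ}

/-- A time slice of a separated solution with transversal frequency `k`. -/
def tiltVal (e k : EuclideanSpace ℝ (Fin n)) (v : ℝ) (z : EuclideanSpace ℝ (Fin n)) : ℂ :=
  amp 0 (tilt (‖k‖ ^ 2)) v * Complex.exp (-(contour v ^ 2) * ((⟪z, e⟫ ^ 2 : ℝ) : ℂ) / 4) *
    Complex.exp ((1 + 2 * Complex.I) * (⟪k, z⟫ : ℝ))

/-- The jet of `tiltVal`. -/
def tiltJet (e k : EuclideanSpace ℝ (Fin n)) (v : ℝ) (z : EuclideanSpace ℝ (Fin n)) :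
    JetSpace n :=
  (tiltVal e k v z, tiltVal e k v z • ((1 + 2 * Complex.I) • linForm k -
    (contour v ^ 2 * (⟪z, e⟫ : ℝ) / 2) • linForm e))

lemma hasFDerivAt_inner_ofReal (k z : EuclideanSpace ℝ (Fin n)) :
    HasFDerivAt (fun z : EuclideanSpace ℝ (Fin n) => ((⟪k, z⟫ : ℝ) : ℂ)) (linForm k) z :=
  (linForm k).hasFDerivAt

lemma HasDerivAt.hasFDerivAt_inner_sq {φ : ℂ → ℂ} {φ' : ℂ} {e z : EuclideanSpace ℝ (Fin n)}
    (h : HasDerivAt φ φ' ((⟪z, e⟫ ^ 2 : ℝ) : ℂ)) :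
    HasFDerivAt (fun z : EuclideanSpace ℝ (Fin n) => φ ((⟪z, e⟫ ^ 2 : ℝ) : ℂ))
      ((2 * φ' * (⟪z, e⟫ : ℝ)) • linForm e) z := by
  have h1 : HasFDerivAt (fun z : EuclideanSpace ℝ (Fin n) => ((⟪z, e⟫ ^ 2 : ℝ) : ℂ))
      ((2 * ((⟪z, e⟫ : ℝ) : ℂ)) • linForm e) z := by
    have := (hasFDerivAt_inner_ofReal e z).pow 2
    refine (this.congr_fderiv ?_).congr_of_eventuallyEq (Eventually.of_forall fun z => ?_)
    · rw [real_inner_comm]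
      simp
    · simp only [real_inner_comm e]
      push_cast
      rfl
  refine (HasDerivAt.comp_hasFDerivAt z h h1).congr_fderiv ?_
  rw [smul_smul]
  congr 1
  ring

lemma hasFDerivAt_tiltVal (e k : EuclideanSpace ℝ (Fin n)) (v : ℝ)
    (z : EuclideanSpace ℝ (Fin n)) :
    HasFDerivAt (tiltVal e k v) (tiltJet e k v z).2 z := by
  have h1 : HasDerivAt (fun ζ : ℂ => Complex.exp (-(contour v ^ 2) * ζ / 4))
      (Complex.exp (-(contour v ^ 2) * ((⟪z, e⟫ ^ 2 : ℝ) : ℂ) / 4) *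
        (-(contour v ^ 2) * 1 / 4)) ((⟪z, e⟫ ^ 2 : ℝ) : ℂ) :=
    (((hasDerivAt_id _).const_mul _).div_const 4).cexp
  have h2 := ((hasFDerivAt_inner_ofReal k z).const_mul (1 + 2 * Complex.I)).cexp
  have h3 := (h1.hasFDerivAt_inner_sq.const_mul (amp 0 (tilt (‖k‖ ^ 2)) v)).mul h2
  refine h3.congr_fderiv ?_
  ext y
  simp [tiltJet, tiltVal]
  ring

lemma continuousOn_tiltJet (e : EuclideanSpace ℝ (Fin n)) :
    ContinuousOn (fun q : (EuclideanSpace ℝ (Fin n) × ℝ) × EuclideanSpace ℝ (Fin n) =>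
      tiltJet e q.1.1 q.1.2 q.2) {q | 0 < q.1.2} := by
  set S := {q : (EuclideanSpace ℝ (Fin n) × ℝ) × EuclideanSpace ℝ (Fin n) | 0 < q.1.2}
  have hne : ∀ q ∈ S, contour q.1.2 ^ 2 ≠ 0 := fun q hq => pow_ne_zero 2 (contour_ne_zero hq)
  have hv : Continuous fun q : (EuclideanSpace ℝ (Fin n) × ℝ) × EuclideanSpace ℝ (Fin n) =>
      q.1.2 := continuous_fst.snd
  have hk : Continuous fun q : (EuclideanSpace ℝ (Fin n) × ℝ) × EuclideanSpace ℝ (Fin n) =>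
      q.1.1 := continuous_fst.fst
  have h1 := (continuous_contour.comp hv).continuousOn (s := S)
  have h2 := (continuous_contourDeriv.comp hv).continuousOn (s := S)
  have hi : Continuous fun q : (EuclideanSpace ℝ (Fin n) × ℝ) × EuclideanSpace ℝ (Fin n) =>
      ((⟪q.2, e⟫ : ℝ) : ℂ) := Complex.continuous_ofReal.comp (continuous_snd.inner continuous_const)
  have hki : Continuous fun q : (EuclideanSpace ℝ (Fin n) × ℝ) × EuclideanSpace ℝ (Fin n) =>
      ((⟪q.1.1, q.2⟫ : ℝ) : ℂ) := Complex.continuous_ofReal.comp (hk.inner continuous_snd)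
  have ht : Continuous fun q : (EuclideanSpace ℝ (Fin n) × ℝ) × EuclideanSpace ℝ (Fin n) =>
      tilt (‖q.1.1‖ ^ 2) := by
    unfold tilt
    fun_prop
  have hamp : ContinuousOn (fun q : (EuclideanSpace ℝ (Fin n) × ℝ) × EuclideanSpace ℝ (Fin n) =>
      amp 0 (tilt (‖q.1.1‖ ^ 2)) q.1.2) S := by
    unfold amp
    exact (((continuousOn_const.mul h2).mul (h1.pow 0)).div (h1.pow 2) hne).mul
      (ht.continuousOn.mul ((h1.pow 2).inv₀ hne)).cexp
  have hval : ContinuousOn (fun q : (EuclideanSpace ℝ (Fin n) × ℝ) × EuclideanSpace ℝ (Fin n) =>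
      tiltVal e q.1.1 q.1.2 q.2) S := by
    unfold tiltVal
    refine (hamp.mul (ContinuousOn.cexp ?_)).mul
      (continuousOn_const.mul hki.continuousOn).cexp
    simp only [Complex.ofReal_pow]
    exact (((h1.pow 2).neg).mul (hi.continuousOn.pow 2)).div_const 4
  refine hval.prodMk (hval.smul (ContinuousOn.sub ?_ ?_))
  · exact ((continuous_linForm.comp hk).const_smul (1 + 2 * Complex.I)).continuousOn
  · exact (((h1.pow 2).mul hi.continuousOn).div_const 2).smul continuousOn_const

/-- The dominating function for the jets of the separated solutions. -/
def tiltBound (a K v : ℝ) : ℝ :=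
  4 * Real.exp 2 * Real.exp (a ^ 2 / 16) *
    ((3 + v ^ 2 * a) * (v ^ 2)⁻¹ * Real.exp (-(v ^ 2)⁻¹ * K ^ 2) * Real.exp (-1 * v ^ 2))

lemma norm_tiltVal_le {e k z : EuclideanSpace ℝ (Fin n)} {v r : ℝ} (hv : 0 < v)
    (hkz : ⟪k, z⟫ ≤ ‖k‖ * r) :
    ‖tiltVal e k v z‖ ≤ 4 * Real.exp 2 *
      ((v ^ 2)⁻¹ * Real.exp (-(3 * ‖k‖ ^ 2 / (2 * v ^ 2)))) *
      Real.exp ((1 / 4 - v ^ 2) * ⟪z, e⟫ ^ 2 / 4) * Real.exp (‖k‖ * r) := by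
  rw [tiltVal, norm_mul, norm_mul]
  have h1 := norm_amp_zero_tilt_le hv (sq_nonneg ‖k‖)
  have h2 := norm_cexp_neg_contour_sq_mul_le v (ζ := ((⟪z, e⟫ ^ 2 : ℝ) : ℂ))
    (by rw [Complex.ofReal_re]; positivity)
  rw [Complex.ofReal_im, abs_zero, zero_div, Real.exp_zero, one_mul, Complex.ofReal_re] at h2
  have h3 : ‖Complex.exp ((1 + 2 * Complex.I) * (⟪k, z⟫ : ℝ))‖ ≤ Real.exp (‖k‖ * r) := by
    rw [Complex.norm_exp, Real.exp_le_exp]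
    simpa using hkz
  gcongr

lemma norm_tiltJet_le {e k z : EuclideanSpace ℝ (Fin n)} {v r a b : ℝ} (he : ‖e‖ = 1)
    (hv : 0 < v) (hkz : ⟪k, z⟫ ≤ ‖k‖ * r) (hb : |⟪z, e⟫| ≤ b) (ha0 : 0 ≤ a) (ha : a ≤ |⟪z, e⟫|)
    (har : 2 * (r + 1) ^ 2 + 4 ≤ a ^ 2) :
    ‖tiltJet e k v z‖ ≤ tiltBound b ‖k‖ v := by
  have hb0 : 0 ≤ b := (abs_nonneg _).trans hb
  have hval := norm_tiltVal_le (e := e) hv hkz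
  have hfac : ‖(1 + 2 * Complex.I) • linForm k -
      (contour v ^ 2 * (⟪z, e⟫ : ℝ) / 2) • linForm e‖ ≤ (3 + v ^ 2 * b) * Real.exp ‖k‖ := by
    refine (norm_sub_le _ _).trans ?_
    rw [norm_smul, norm_smul, norm_div, norm_mul, Complex.norm_real, Complex.norm_ofNat,
      Real.norm_eq_abs]
    have h1 : ‖(1 + 2 * Complex.I : ℂ)‖ ≤ 3 := by
      refine (norm_add_le _ _).trans ?_
      simp
      norm_num
    have h2 := norm_linForm_le k
    have h3 := norm_linForm_le e
    rw [he] at h3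
    have h4 : ‖contour v ^ 2‖ ≤ 2 * v ^ 2 := by
      rw [norm_contour_sq]; linarith [div_one_add_sq_le v]
    have h5 : ‖contour v ^ 2‖ * |⟪z, e⟫| / 2 * ‖linForm e‖ ≤ 2 * v ^ 2 * b / 2 * 1 := by gcongr
    have h6 : ‖(1 + 2 * Complex.I : ℂ)‖ * ‖linForm k‖ ≤ 3 * ‖k‖ := by gcongr
    have h7 := Real.add_one_le_exp ‖k‖
    have h8 : v ^ 2 * b * 1 ≤ v ^ 2 * b * Real.exp ‖k‖ :=
      mul_le_mul_of_nonneg_left (Real.one_le_exp (norm_nonneg _)) (by positivity)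
    linarith
  have hone : 1 ≤ (3 + v ^ 2 * b) * Real.exp ‖k‖ := by
    have h7 := Real.one_le_exp (norm_nonneg k)
    have : 0 ≤ v ^ 2 * b * Real.exp ‖k‖ := by positivity
    nlinarith
  have hle : ‖tiltJet e k v z‖ ≤ ‖tiltVal e k v z‖ * ((3 + v ^ 2 * b) * Real.exp ‖k‖) := by
    refine max_le (le_mul_of_one_le_right (norm_nonneg _) hone) ?_
    simp only [tiltJet]
    rw [norm_smul]
    exact mul_le_mul_of_nonneg_left hfac (norm_nonneg _)
  refine hle.trans ((mul_le_mul_of_nonneg_right hval (by positivity)).trans ?_)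
  have hexp : Real.exp (-(3 * ‖k‖ ^ 2 / (2 * v ^ 2))) *
      Real.exp ((1 / 4 - v ^ 2) * ⟪z, e⟫ ^ 2 / 4) * Real.exp (‖k‖ * r) * Real.exp ‖k‖ ≤
      Real.exp (b ^ 2 / 16) * Real.exp (-(v ^ 2)⁻¹ * ‖k‖ ^ 2) * Real.exp (-1 * v ^ 2) := by
    simp only [← Real.exp_add]
    rw [Real.exp_le_exp]
    have h1 : ⟪z, e⟫ ^ 2 ≤ b ^ 2 := sq_le_sq' (abs_le.mp hb).1 (abs_le.mp hb).2
    have h2 : a ^ 2 ≤ ⟪z, e⟫ ^ 2 := by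
      rw [← sq_abs ⟪z, e⟫]; exact pow_le_pow_left₀ ha0 ha 2
    have h3 : ‖k‖ * (r + 1) ≤ ‖k‖ ^ 2 / (2 * v ^ 2) + (r + 1) ^ 2 * v ^ 2 / 2 := by
      have : ‖k‖ ^ 2 / (2 * v ^ 2) + (r + 1) ^ 2 * v ^ 2 / 2 - ‖k‖ * (r + 1) =
        (‖k‖ / v - (r + 1) * v) ^ 2 / 2 := by field_simp; ring
      linarith [sq_nonneg (‖k‖ / v - (r + 1) * v)]
    have h4 : 3 * ‖k‖ ^ 2 / (2 * v ^ 2) = (v ^ 2)⁻¹ * ‖k‖ ^ 2 + ‖k‖ ^ 2 / (2 * v ^ 2) := by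
      field_simp; ring
    have h5 : v ^ 2 * (2 * (r + 1) ^ 2 + 4) ≤ v ^ 2 * ⟪z, e⟫ ^ 2 :=
      mul_le_mul_of_nonneg_left (har.trans h2) (by positivity)
    rw [h4]
    linarith
  have := mul_le_mul_of_nonneg_left hexp
    (show 0 ≤ 4 * Real.exp 2 * (v ^ 2)⁻¹ * (3 + v ^ 2 * b) by positivity)
  rw [tiltBound]
  refine le_trans (le_of_eq ?_) (this.trans (le_of_eq ?_)) <;> ring

lemma integrable_tiltBound (hm : 2 ≤ m) (b : ℝ) :
    Integrable (fun p : EuclideanSpace ℝ (Fin m) × ℝ => tiltBound b ‖p.1‖ p.2)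
      (volume.prod (volume.restrict (Set.Ioi 0))) := by
  unfold tiltBound
  refine Integrable.const_mul ?_ _
  have hmeas : AEStronglyMeasurable (fun p : EuclideanSpace ℝ (Fin m) × ℝ =>
      (3 + p.2 ^ 2 * b) * (p.2 ^ 2)⁻¹ * Real.exp (-(p.2 ^ 2)⁻¹ * ‖p.1‖ ^ 2) *
        Real.exp (-1 * p.2 ^ 2)) (volume.prod (volume.restrict (Set.Ioi 0))) := by
    refine Measurable.aestronglyMeasurable ?_
    fun_prop
  rw [integrable_prod_iff' hmeas]
  have hpos : ∀ᵐ v : ℝ ∂volume.restrict (Set.Ioi 0), 0 < v := ae_restrict_mem measurableSet_Ioi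
  refine ⟨hpos.mono fun v hv => ?_, ?_⟩
  · exact ((integrable_exp_neg_mul_norm_sq (b := (v ^ 2)⁻¹) (by positivity)).const_mul
      ((3 + v ^ 2 * b) * (v ^ 2)⁻¹)).mul_const (Real.exp (-1 * v ^ 2))
  · have hint : ∀ v : ℝ, 0 < v → ∫ k : EuclideanSpace ℝ (Fin m),
        ‖(3 + v ^ 2 * b) * (v ^ 2)⁻¹ * Real.exp (-(v ^ 2)⁻¹ * ‖k‖ ^ 2) * Real.exp (-1 * v ^ 2)‖ =
        √π ^ m * (‖3 + v ^ 2 * b‖ * (v ^ (m - 2) * Real.exp (-1 * v ^ 2))) := by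
      intro v hv
      simp only [norm_mul, Real.norm_of_nonneg (Real.exp_pos _).le]
      rw [integral_mul_const, integral_const_mul,
        GaussianFourier.integral_rexp_neg_mul_sq_norm (by positivity), finrank_euclideanSpace_fin]
      have h1 : (π / (v ^ 2)⁻¹) ^ ((m : ℝ) / 2) = √π ^ m * v ^ m := by
        rw [div_inv_eq_mul, show (m : ℝ) / 2 = 1 / 2 * m by ring, Real.rpow_mul (by positivity),
          ← Real.sqrt_eq_rpow, Real.rpow_natCast, Real.sqrt_mul pi_pos.le, Real.sqrt_sq hv.le,
          mul_pow]
      have h2 : v ^ m = v ^ (m - 2) * v ^ 2 := by rw [← pow_add]; congr 1; omega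
      rw [h1, h2, norm_inv, norm_pow, Real.norm_of_nonneg hv.le]
      field_simp
    refine Integrable.congr ?_ (hpos.mono fun v hv => (hint v hv).symm)
    refine Integrable.const_mul ?_ _
    have h1 := integrableOn_pow_mul_exp (m - 2) one_pos
    have h2 := integrableOn_pow_mul_exp (m - 2 + 2) one_pos
    refine Integrable.mono' ((h1.const_mul 3).add (h2.const_mul |b|))
      (Measurable.aestronglyMeasurable (by fun_prop)) (hpos.mono fun v hv => ?_)
    rw [norm_mul, norm_norm, norm_mul, norm_pow, Real.norm_of_nonneg hv.le,
      Real.norm_of_nonneg (Real.exp_pos _).le]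
    have : ‖3 + v ^ 2 * b‖ ≤ 3 + v ^ 2 * |b| := by
      refine (norm_add_le _ _).trans ?_
      rw [norm_mul, Real.norm_eq_abs b, norm_pow, Real.norm_of_nonneg hv.le]
      norm_num
    refine (mul_le_mul_of_nonneg_right this (by positivity)).trans_eq ?_
    simp only [Pi.add_apply, pow_add]
    ring

end

section

variable {n m : ℕ}

lemma two_le_infty : (2 : WithTop ℕ∞) ≤ ((⊤ : ℕ∞) : WithTop ℕ∞) :=
  WithTop.coe_le_coe.mpr (le_top (a := (2 : ℕ∞)))

/-- The smooth complex-valued solutions of `Δf + f = 0`. -/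
def helmholtz (n : ℕ) : Submodule ℂ (EuclideanSpace ℝ (Fin n) → ℂ) where
  carrier := {f | ContDiff ℝ (⊤ : ℕ∞) f ∧ ∀ x, lap f x + f x = 0}
  zero_mem' := ⟨contDiff_const, fun x => by
    simp [lap, show (0 : EuclideanSpace ℝ (Fin n) → ℂ) = fun _ => 0 from rfl]⟩
  add_mem' := by
    rintro f g ⟨hf, hf'⟩ ⟨hg, hg'⟩
    refine ⟨hf.add hg, fun x => ?_⟩
    have : lap (f + g) x = lap f x + lap g x := by
      simp only [lap, ← Finset.sum_add_distrib]
      rw [iteratedFDeriv_add_apply (hf.of_le two_le_infty).contDiffAt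
        (hg.of_le two_le_infty).contDiffAt]
      rfl
    rw [this, Pi.add_apply]
    linear_combination hf' x + hg' x
  smul_mem' := by
    rintro c f ⟨hf, hf'⟩
    refine ⟨contDiff_const.smul hf, fun x => ?_⟩
    have : lap (c • f) x = c * lap f x := by
      simp only [lap, Finset.mul_sum]
      rw [iteratedFDeriv_const_smul_apply (hf.of_le two_le_infty).contDiffAt]
      rfl
    rw [this, Pi.smul_apply, smul_eq_mul]
    linear_combination c * hf' x

lemma sum_linForm_mul_linForm (a b : EuclideanSpace ℝ (Fin n)) :
    ∑ i, linForm a (EuclideanSpace.single i 1) * linForm b (EuclideanSpace.single i 1) =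
      ((⟪a, b⟫ : ℝ) : ℂ) := by
  simp only [linForm_apply, EuclideanSpace.inner_single_right, PiLp.inner_apply a b]
  push_cast
  refine Finset.sum_congr rfl fun i _ => ?_
  simp [mul_comm]

lemma cexp_mem_helmholtz {L : EuclideanSpace ℝ (Fin n) →L[ℝ] ℂ}
    (hL : ∑ i, L (EuclideanSpace.single i 1) ^ 2 = -1) :
    (fun x => Complex.exp (L x)) ∈ helmholtz n := by
  have hd : ContDiff ℝ (⊤ : ℕ∞) fun x => Complex.exp (L x) := L.contDiff.cexp
  refine ⟨hd, fun x => ?_⟩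
  have h1 : ∀ x, HasFDerivAt (fun x => Complex.exp (L x)) (Complex.exp (L x) • L) x := fun x =>
    L.hasFDerivAt.cexp
  have h2 : lap (fun x => Complex.exp (L x)) x =
      ∑ i, Complex.exp (L x) * L (EuclideanSpace.single i 1) ^ 2 := by
    rw [lap_eq_sum_fderiv (hd.of_le two_le_infty)]
    refine Finset.sum_congr rfl fun i _ => ?_
    have h3 : (fun y => fderiv ℝ (fun x => Complex.exp (L x)) y (EuclideanSpace.single i 1)) =
        fun y => Complex.exp (L y) * L (EuclideanSpace.single i 1) := by
      funext y
      rw [(h1 y).fderiv]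
      simp
    rw [h3, ((h1 x).mul_const _).fderiv]
    simp
    ring
  rw [h2, ← Finset.mul_sum, hL]
  ring

/-- The time integral of the separated solutions continues to a global solution. -/
lemma exists_helmholtz_eq_integral_tiltJet {e k : EuclideanSpace ℝ (Fin n)} (he : ‖e‖ = 1)
    (hk : k ≠ 0) (hke : ⟪k, e⟫ = 0) (y : EuclideanSpace ℝ (Fin n)) :
    ∃ f ∈ helmholtz n, ∀ x, ⟪x - y, e⟫ < 0 →
      ∫ v in Set.Ioi (0 : ℝ), tiltJet e k v (x - y) = ((f x, fderiv ℝ f x) : JetSpace n) := by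
  have ht : 0 < ‖k‖ ^ 2 := by positivity
  obtain ⟨κ, α, β, hκ, hφ⟩ := exists_gaussTransform_eq_exp ht
  have hA := gaussIntegrable_amp_zero_tilt ht
  set A := amp 0 (tilt (‖k‖ ^ 2)) with hAdef
  set ω : ℂ := 1 + 2 * Complex.I with hω
  have hω2 : ω ^ 2 = -(3 - 4 * Complex.I) := by
    rw [hω]; linear_combination 4 * Complex.I_sq
  have hsum : ∀ s : ℂ, s ^ 2 = κ ^ 2 →
      ∑ i, (ω • linForm k + s • linForm e) (EuclideanSpace.single i 1) ^ 2 = -1 := by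
    intro s hs
    have h1 : ∀ i, (ω • linForm k + s • linForm e) (EuclideanSpace.single i 1) ^ 2 =
        ω ^ 2 * (linForm k (EuclideanSpace.single i 1) * linForm k (EuclideanSpace.single i 1)) +
        2 * ω * s *
          (linForm k (EuclideanSpace.single i 1) * linForm e (EuclideanSpace.single i 1)) +
        s ^ 2 * (linForm e (EuclideanSpace.single i 1) *
          linForm e (EuclideanSpace.single i 1)) := by
      intro i
      simp only [add_apply, smul_apply, smul_eq_mul]
      ring
    rw [Finset.sum_congr rfl fun i _ => h1 i, Finset.sum_add_distrib, Finset.sum_add_distrib,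
      ← Finset.mul_sum, ← Finset.mul_sum, ← Finset.mul_sum, sum_linForm_mul_linForm,
      sum_linForm_mul_linForm, sum_linForm_mul_linForm, hke, real_inner_self_eq_norm_sq,
      real_inner_self_eq_norm_sq, he, hs, hκ, hω2, tilt]
    push_cast
    ring
  set Lp := ω • linForm k + κ • linForm e with hLp
  set Lm := ω • linForm k + (-κ) • linForm e with hLm
  set f : EuclideanSpace ℝ (Fin n) → ℂ :=
    (α * Complex.exp (-Lm y)) • (fun x => Complex.exp (Lm x)) +
      (β * Complex.exp (-Lp y)) • (fun x => Complex.exp (Lp x)) with hf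
  have hfmem : f ∈ helmholtz n := add_mem
    (Submodule.smul_mem _ _ (cexp_mem_helmholtz (hsum _ (by ring))))
    (Submodule.smul_mem _ _ (cexp_mem_helmholtz (hsum _ rfl)))
  set G : EuclideanSpace ℝ (Fin n) → ℂ := fun x =>
    gaussTransform A ((⟪x - y, e⟫ ^ 2 : ℝ) : ℂ) * Complex.exp (ω * (⟪k, x - y⟫ : ℝ)) with hG
  have hGf : ∀ x, ⟪x - y, e⟫ < 0 → G x = f x := by
    intro x hx
    have h1 := hφ (-⟪x - y, e⟫) (by linarith)
    rw [neg_sq] at h1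
    have hm : Lm x - Lm y = ω * (⟪k, x - y⟫ : ℝ) - κ * (⟪x - y, e⟫ : ℝ) := by
      rw [← map_sub, real_inner_comm e]
      simp [hLm, sub_eq_add_neg]
    have hp : Lp x - Lp y = ω * (⟪k, x - y⟫ : ℝ) + κ * (⟪x - y, e⟫ : ℝ) := by
      rw [← map_sub, real_inner_comm e]
      simp [hLp]
    simp only [hG, hf, Pi.add_apply, Pi.smul_apply, smul_eq_mul]
    rw [h1, mul_assoc α, mul_assoc β, ← Complex.exp_add, ← Complex.exp_add, neg_add_eq_sub,
      neg_add_eq_sub, hm, hp, add_mul, mul_assoc, mul_assoc, ← Complex.exp_add, ← Complex.exp_add]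
    push_cast
    congr 3 <;> ring
  refine ⟨f, hfmem, fun x hx => ?_⟩
  have hre : 0 < (((⟪x - y, e⟫ ^ 2 : ℝ) : ℂ)).re := by
    rw [Complex.ofReal_re]; exact sq_pos_of_neg hx
  have hsub : HasFDerivAt (fun x : EuclideanSpace ℝ (Fin n) => x - y)
    (ContinuousLinearMap.id ℝ _) x := (hasFDerivAt_id x).sub_const y
  have hGd : HasFDerivAt G (Complex.exp (ω * (⟪k, x - y⟫ : ℝ)) •
      (gaussTransform A ((⟪x - y, e⟫ ^ 2 : ℝ) : ℂ) • (ω • linForm k) +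
      (2 * gaussTransform (diffAmp A) ((⟪x - y, e⟫ ^ 2 : ℝ) : ℂ) * (⟪x - y, e⟫ : ℝ)) •
        linForm e)) x := by
    have h1 := (hA.hasDerivAt hre).hasFDerivAt_inner_sq
    have h2 := ((hasFDerivAt_inner_ofReal k (x - y)).const_mul ω).cexp
    refine ((h1.mul h2).comp x hsub).congr_fderiv ?_
    ext z
    simp
    ring
  have hfd := hGd.congr_of_eventuallyEq (f₁ := f) (by
    have : Continuous fun x : EuclideanSpace ℝ (Fin n) => ⟪x - y, e⟫ := by fun_prop
    filter_upwards [(isOpen_lt this continuous_const).mem_nhds hx] with x hx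
    exact (hGf x hx).symm)
  have i0 := (hA.integrableOn hre).mul_const (Complex.exp (ω * (⟪k, x - y⟫ : ℝ)))
  have i1 := (hA.diffAmp.integrableOn hre).mul_const
    (2 * (⟪x - y, e⟫ : ℝ) * Complex.exp (ω * (⟪k, x - y⟫ : ℝ)))
  have hval : ∀ v, tiltJet e k v (x - y) = ((A v * Complex.exp (-(contour v ^ 2) *
      ((⟪x - y, e⟫ ^ 2 : ℝ) : ℂ) / 4) * Complex.exp (ω * (⟪k, x - y⟫ : ℝ)),
      (A v * Complex.exp (-(contour v ^ 2) * ((⟪x - y, e⟫ ^ 2 : ℝ) : ℂ) / 4) *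
        Complex.exp (ω * (⟪k, x - y⟫ : ℝ))) • (ω • linForm k) +
      (diffAmp A v * Complex.exp (-(contour v ^ 2) * ((⟪x - y, e⟫ ^ 2 : ℝ) : ℂ) / 4) *
        (2 * (⟪x - y, e⟫ : ℝ) * Complex.exp (ω * (⟪k, x - y⟫ : ℝ)))) • linForm e) :
      JetSpace n) := by
    intro v
    refine Prod.ext rfl ?_
    ext z
    simp only [tiltJet, tiltVal, diffAmp, add_apply, smul_apply, sub_apply, smul_eq_mul]
    ring
  simp only [hval]
  refine (integral_pair i0 ((i0.smul_const _).add (i1.smul_const _))).trans (Prod.ext ?_ ?_)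
  · rw [← hGf x hx, integral_mul_const]
    rfl
  · rw [hfd.fderiv]
    refine (integral_add (i0.smul_const _) (i1.smul_const _)).trans ?_
    rw [integral_smul_const, integral_smul_const, integral_mul_const, integral_mul_const]
    simp only [gaussTransform, smul_add, smul_smul]
    congr 2 <;> ring

end

section

variable {n m : ℕ}

/-- Euclidean coordinates on the orthogonal complement of a unit vector. -/
lemma exists_orthogonal_frame (hn : n = m + 1) {e : EuclideanSpace ℝ (Fin n)} (he : ‖e‖ = 1) :
    ∃ (J : EuclideanSpace ℝ (Fin m) →ₗᵢ[ℝ] EuclideanSpace ℝ (Fin n))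
      (P : EuclideanSpace ℝ (Fin n) → EuclideanSpace ℝ (Fin m)),
      (∀ k, ⟪J k, e⟫ = 0) ∧ (∀ k z, ⟪J k, z⟫ = ⟪P z, k⟫) ∧
        ∀ z, ‖z‖ ^ 2 = ⟪z, e⟫ ^ 2 + ‖P z‖ ^ 2 := by
  have : Fact (Module.finrank ℝ (EuclideanSpace ℝ (Fin n)) = m + 1) := ⟨by simp [hn]⟩
  have he0 : e ≠ 0 := by rintro rfl; simp at he
  have hdim := Submodule.finrank_orthogonal_span_singleton (𝕜 := ℝ) (n := m) he0
  set V := (ℝ ∙ e)ᗮ with hV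
  set b := ((stdOrthonormalBasis ℝ V).reindex (finCongr hdim)).repr with hb
  refine ⟨V.subtypeₗᵢ.comp b.symm.toLinearIsometry, fun z => b (V.orthogonalProjectionOnto z),
    fun k => ?_, fun k z => ?_, fun z => ?_⟩
  · exact Submodule.mem_orthogonal_singleton_iff_inner_left.mp (b.symm k).2
  · have h1 : ⟪b (V.orthogonalProjectionOnto z), k⟫ = ⟪V.orthogonalProjectionOnto z, b.symm k⟫ := by
      rw [← b.symm.inner_map_map, b.symm_apply_apply]
    rw [h1, real_inner_comm]
    exact (Submodule.inner_orthogonalProjectionOnto_eq_of_mem_right (b.symm k) z).symm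
  · rw [Submodule.norm_sq_eq_add_norm_sq_projection z (ℝ ∙ e), b.norm_map]
    congr 1
    rw [← Submodule.norm_coe, ← Submodule.starProjection_apply,
      Submodule.starProjection_unit_singleton ℝ he, norm_smul, he, mul_one, Real.norm_eq_abs,
      sq_abs, real_inner_comm]

/-- The normalisation in the transversal decomposition of Gaussians. -/
def frameConst (m : ℕ) : ℂ := (√π / (2 - Complex.I)) ^ m

lemma two_sub_I_ne_zero : (2 - Complex.I : ℂ) ≠ 0 := fun h => by
  simpa using congr_arg Complex.re h

lemma frameConst_ne_zero (m : ℕ) : frameConst m ≠ 0 := by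
  refine pow_ne_zero _ (div_ne_zero ?_ two_sub_I_ne_zero)
  exact_mod_cast (Real.sqrt_pos.mpr pi_pos).ne'

lemma integral_tiltVal {e : EuclideanSpace ℝ (Fin n)}
    {J : EuclideanSpace ℝ (Fin m) →ₗᵢ[ℝ] EuclideanSpace ℝ (Fin n)}
    {P : EuclideanSpace ℝ (Fin n) → EuclideanSpace ℝ (Fin m)}
    (hP : ∀ k z, ⟪J k, z⟫ = ⟪P z, k⟫) (hPn : ∀ z, ‖z‖ ^ 2 = ⟪z, e⟫ ^ 2 + ‖P z‖ ^ 2)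
    {v : ℝ} (hv : 0 < v) (z : EuclideanSpace ℝ (Fin n)) :
    ∫ k, tiltVal e (J k) v z = frameConst m * (amp m 1 v * cgauss (contour v ^ 2) z) := by
  set σ := contour v with hσ
  have hσ0 : σ ≠ 0 := contour_ne_zero hv
  set ω : ℂ := 2 - Complex.I with hω
  have hω0 : ω ≠ 0 := two_sub_I_ne_zero
  have hω2 : ω ^ 2 = 3 - 4 * Complex.I := by rw [hω]; linear_combination Complex.I_sq
  set b : ℂ := (3 - 4 * Complex.I) * (σ ^ 2)⁻¹ with hb
  have hbre : 0 < b.re := by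
    refine lt_of_lt_of_le ?_ (rotated_inv_contour_sq_re_ge hv)
    rw [norm_contour_sq]; positivity
  have h1 : ∀ k, tiltVal e (J k) v z =
      (2 * contourDeriv v / σ ^ 2 * Complex.exp ((σ ^ 2)⁻¹) *
        Complex.exp (-(σ ^ 2) * ((⟪z, e⟫ ^ 2 : ℝ) : ℂ) / 4)) *
      Complex.exp (-b * ‖k‖ ^ 2 + (1 + 2 * Complex.I) * (⟪P z, k⟫ : ℝ)) := by
    intro k
    have h2 : tilt (‖k‖ ^ 2) * (σ ^ 2)⁻¹ = (σ ^ 2)⁻¹ + -b * ‖k‖ ^ 2 := by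
      rw [tilt, hb]; push_cast; ring
    rw [tiltVal, amp, J.norm_map, hP, ← hσ, h2, Complex.exp_add, Complex.exp_add, pow_zero]
    ring
  simp_rw [h1]
  rw [integral_const_mul, GaussianFourier.integral_cexp_neg_mul_sq_norm_add hbre,
    finrank_euclideanSpace_fin]
  have h3 : (π / b : ℂ) ^ ((m : ℂ) / 2) = frameConst m * σ ^ m := by
    have h4 : (π / b : ℂ) = (√π / ω * σ) ^ 2 := by
      have : ((√π : ℝ) : ℂ) ^ 2 = π := by
        rw [← Complex.ofReal_pow, Real.sq_sqrt pi_pos.le]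
      rw [hb, ← hω2, mul_pow, div_pow, this]
      field_simp
    have h5 : 0 < (√π / ω * σ).re := by
      have h6 : (√π / ω * σ : ℂ) = ((√π / 5 : ℝ) : ℂ) * ((2 + Complex.I) * σ) := by
        have : ω⁻¹ = (2 + Complex.I) / 5 := by
          rw [inv_eq_iff_eq_inv, eq_comm, inv_eq_iff_eq_inv, eq_comm]
          field_simp
          rw [hω]
          linear_combination Complex.I_sq
        rw [div_eq_mul_inv, this]
        push_cast
        ring
      rw [h6, Complex.re_ofReal_mul]
      refine mul_pos (by positivity) ?_
      have : ((2 + Complex.I) * σ).re = 2 * v + v / (1 + v ^ 2) := by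
        rw [Complex.mul_re, hσ, contour_re, contour_im]
        simp
      rw [this]
      positivity
    rw [h4, show (m : ℂ) / 2 = (2 : ℂ)⁻¹ * (m : ℕ) by ring, Complex.cpow_mul_nat,
      Complex.sq_cpow_two_inv h5, mul_pow, frameConst]
  have h7 : (1 + 2 * Complex.I) ^ 2 * (‖P z‖ : ℂ) ^ 2 / (4 * b) =
      -(σ ^ 2) * (‖P z‖ : ℂ) ^ 2 / 4 := by
    have : (1 + 2 * Complex.I) ^ 2 = -(3 - 4 * Complex.I) := by
      linear_combination 4 * Complex.I_sq
    have h0 : (3 - 4 * Complex.I : ℂ) ≠ 0 := hω2 ▸ pow_ne_zero 2 hω0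
    rw [this, hb]
    field_simp
  have h8 : cgauss (σ ^ 2) z = Complex.exp (-(σ ^ 2) * ((⟪z, e⟫ ^ 2 : ℝ) : ℂ) / 4) *
      Complex.exp (-(σ ^ 2) * (‖P z‖ : ℂ) ^ 2 / 4) := by
    rw [cgauss, hPn, ← Complex.exp_add]
    push_cast
    congr 1
    ring
  rw [h3, h7, h8, amp, one_mul, ← hσ]
  ring

/-- The region in which the transversal decomposition converges. -/
def tiltRegion (e : EuclideanSpace ℝ (Fin n)) (r a b : ℝ) : Set (EuclideanSpace ℝ (Fin n)) :=
  {z | ‖z - ⟪z, e⟫ • e‖ < r ∧ a < |⟪z, e⟫| ∧ |⟪z, e⟫| < b}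

lemma isOpen_tiltRegion (e : EuclideanSpace ℝ (Fin n)) (r a b : ℝ) :
    IsOpen (tiltRegion e r a b) := by
  have h : Continuous fun z : EuclideanSpace ℝ (Fin n) => ⟪z, e⟫ := by fun_prop
  have h' : Continuous fun z : EuclideanSpace ℝ (Fin n) => ‖z - ⟪z, e⟫ • e‖ := by fun_prop
  exact (isOpen_lt h' continuous_const).inter
    ((isOpen_lt continuous_const h.abs).inter (isOpen_lt h.abs continuous_const))

lemma norm_tiltJet_le_of_mem {e : EuclideanSpace ℝ (Fin n)} (he : ‖e‖ = 1)
    {J : EuclideanSpace ℝ (Fin m) →ₗᵢ[ℝ] EuclideanSpace ℝ (Fin n)} (hJ : ∀ k, ⟪J k, e⟫ = 0)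
    {r a b v : ℝ} (ha0 : 0 ≤ a) (har : 2 * (r + 1) ^ 2 + 4 ≤ a ^ 2)
    {z : EuclideanSpace ℝ (Fin n)} (hz : z ∈ tiltRegion e r a b)
    (k : EuclideanSpace ℝ (Fin m)) (hv : 0 < v) :
    ‖tiltJet e (J k) v z‖ ≤ tiltBound b ‖k‖ v := by
  rw [← J.norm_map k]
  refine norm_tiltJet_le he hv ?_ hz.2.2.le ha0 hz.2.1.le har
  have : ⟪J k, z⟫ = ⟪J k, z - ⟪z, e⟫ • e⟫ := by
    rw [inner_sub_right, inner_smul_right, hJ, mul_zero, sub_zero]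
  rw [this]
  exact (real_inner_le_norm _ _).trans
    (mul_le_mul_of_nonneg_left hz.1.le (norm_nonneg _))

lemma ae_snd_pos : ∀ᵐ p : EuclideanSpace ℝ (Fin m) × ℝ
    ∂((volume : Measure (EuclideanSpace ℝ (Fin m))).prod (volume.restrict (Set.Ioi 0))),
    0 < p.2 :=
  Measure.quasiMeasurePreserving_snd.ae (ae_restrict_mem measurableSet_Ioi)

lemma aestronglyMeasurable_of_continuousOn_snd_pos {E : Type*} [NormedAddCommGroup E]
    [SecondCountableTopologyEither (EuclideanSpace ℝ (Fin m) × ℝ) E]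
    {F : EuclideanSpace ℝ (Fin m) × ℝ → E} (hF : ContinuousOn F {p | 0 < p.2}) :
    AEStronglyMeasurable F
      ((volume : Measure (EuclideanSpace ℝ (Fin m))).prod (volume.restrict (Set.Ioi 0))) := by
  have h := Measure.prod_restrict (μ := (volume : Measure (EuclideanSpace ℝ (Fin m))))
    (ν := (volume : Measure ℝ)) Set.univ (Set.Ioi 0)
  have hs : (Set.univ : Set (EuclideanSpace ℝ (Fin m))) ×ˢ Set.Ioi (0 : ℝ) = {p | 0 < p.2} := by
    ext p
    simp
  rw [Measure.restrict_univ, hs] at h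
  rw [h]
  exact hF.aestronglyMeasurable (measurableSet_lt measurable_const measurable_snd)

lemma integrable_tiltJet (hm : 2 ≤ m) {e : EuclideanSpace ℝ (Fin n)} (he : ‖e‖ = 1)
    {J : EuclideanSpace ℝ (Fin m) →ₗᵢ[ℝ] EuclideanSpace ℝ (Fin n)} (hJ : ∀ k, ⟪J k, e⟫ = 0)
    {r a b : ℝ} (ha0 : 0 ≤ a) (har : 2 * (r + 1) ^ 2 + 4 ≤ a ^ 2)
    {z : EuclideanSpace ℝ (Fin n)} (hz : z ∈ tiltRegion e r a b) :
    Integrable (fun p : EuclideanSpace ℝ (Fin m) × ℝ => tiltJet e (J p.1) p.2 z)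
      (volume.prod (volume.restrict (Set.Ioi 0))) := by
  refine (integrable_tiltBound hm b).mono' (aestronglyMeasurable_of_continuousOn_snd_pos ?_)
    (ae_snd_pos.mono fun p hp => norm_tiltJet_le_of_mem he hJ ha0 har hz p.1 hp)
  exact (continuousOn_tiltJet e).comp (f := fun p : EuclideanSpace ℝ (Fin m) × ℝ =>
    ((J p.1, p.2), z)) (((J.continuous.comp continuous_fst).prodMk continuous_snd).prodMk
      continuous_const).continuousOn fun p hp => hp

lemma hasFDerivAt_fundJet_fst (hn : 3 ≤ n) {z : EuclideanSpace ℝ (Fin n)} (hz : z ≠ 0) :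
    HasFDerivAt (fun z : EuclideanSpace ℝ (Fin n) => (fundJet z).1) (fundJet z).2 z := by
  have h := gaussIntegrable_amp (m := n - 1) (by omega)
  exact (h.hasDerivAt (by rw [Complex.ofReal_re]; positivity)).hasFDerivAt_norm_sq

lemma fundJet_fst_eq_integral (hn : n = m + 1) (z : EuclideanSpace ℝ (Fin n)) :
    (fundJet z).1 = ∫ v in Set.Ioi (0 : ℝ), amp m 1 v * cgauss (contour v ^ 2) z := by
  subst hn
  rfl

lemma integral_tiltJet_fst (hm : 2 ≤ m) (hn : n = m + 1) {e : EuclideanSpace ℝ (Fin n)}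
    (he : ‖e‖ = 1) {J : EuclideanSpace ℝ (Fin m) →ₗᵢ[ℝ] EuclideanSpace ℝ (Fin n)}
    {P : EuclideanSpace ℝ (Fin n) → EuclideanSpace ℝ (Fin m)} (hJ : ∀ k, ⟪J k, e⟫ = 0)
    (hP : ∀ k z, ⟪J k, z⟫ = ⟪P z, k⟫) (hPn : ∀ z, ‖z‖ ^ 2 = ⟪z, e⟫ ^ 2 + ‖P z‖ ^ 2)
    {r a b : ℝ} (ha0 : 0 ≤ a) (har : 2 * (r + 1) ^ 2 + 4 ≤ a ^ 2)
    {z : EuclideanSpace ℝ (Fin n)} (hz : z ∈ tiltRegion e r a b) :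
    ∫ p : EuclideanSpace ℝ (Fin m) × ℝ, (tiltJet e (J p.1) p.2 z).1
      ∂(volume.prod (volume.restrict (Set.Ioi 0))) = frameConst m * (fundJet z).1 := by
  rw [integral_prod_symm _ (integrable_tiltJet hm he hJ ha0 har hz).fst,
    fundJet_fst_eq_integral hn, ← integral_const_mul]
  exact setIntegral_congr_fun measurableSet_Ioi fun v hv => integral_tiltVal hP hPn hv z

lemma hasFDerivAt_integral_tiltJet (hm : 2 ≤ m) {e : EuclideanSpace ℝ (Fin n)}
    (he : ‖e‖ = 1) {J : EuclideanSpace ℝ (Fin m) →ₗᵢ[ℝ] EuclideanSpace ℝ (Fin n)}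
    (hJ : ∀ k, ⟪J k, e⟫ = 0) {r a b : ℝ} (ha0 : 0 ≤ a) (har : 2 * (r + 1) ^ 2 + 4 ≤ a ^ 2)
    {z : EuclideanSpace ℝ (Fin n)} (hz : z ∈ tiltRegion e r a b) :
    HasFDerivAt (fun z => ∫ p : EuclideanSpace ℝ (Fin m) × ℝ, (tiltJet e (J p.1) p.2 z).1
        ∂(volume.prod (volume.restrict (Set.Ioi 0))))
      (∫ p : EuclideanSpace ℝ (Fin m) × ℝ, (tiltJet e (J p.1) p.2 z).2
        ∂(volume.prod (volume.restrict (Set.Ioi 0)))) z := by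
  have hint := fun z (hz : z ∈ tiltRegion e r a b) =>
    integrable_tiltJet hm he hJ ha0 har hz
  have hnhds := (isOpen_tiltRegion e r a b).mem_nhds hz
  exact hasFDerivAt_integral_of_dominated_of_fderiv_le
      (F := fun z (p : EuclideanSpace ℝ (Fin m) × ℝ) => (tiltJet e (J p.1) p.2 z).1)
      (F' := fun z p => (tiltJet e (J p.1) p.2 z).2)
      (bound := fun p => tiltBound b ‖p.1‖ p.2) hnhds
      (Filter.eventually_of_mem hnhds fun z hz => (hint z hz).fst.aestronglyMeasurable)
      (hint z hz).fst (hint z hz).snd.aestronglyMeasurable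
      (ae_snd_pos.mono fun p hp z hz => (norm_snd_le _).trans
        (norm_tiltJet_le_of_mem he hJ ha0 har hz p.1 hp))
      (integrable_tiltBound hm b)
      (Eventually.of_forall fun p z _ => hasFDerivAt_tiltVal e (J p.1) p.2 z)

/-- The fundamental jet is a superposition of jets of separated solutions. -/
lemma fundJet_eq_integral_tiltJet (hm : 2 ≤ m) (hn : n = m + 1) {e : EuclideanSpace ℝ (Fin n)}
    (he : ‖e‖ = 1) {J : EuclideanSpace ℝ (Fin m) →ₗᵢ[ℝ] EuclideanSpace ℝ (Fin n)}
    {P : EuclideanSpace ℝ (Fin n) → EuclideanSpace ℝ (Fin m)} (hJ : ∀ k, ⟪J k, e⟫ = 0)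
    (hP : ∀ k z, ⟪J k, z⟫ = ⟪P z, k⟫) (hPn : ∀ z, ‖z‖ ^ 2 = ⟪z, e⟫ ^ 2 + ‖P z‖ ^ 2)
    {r a b : ℝ} (ha0 : 0 ≤ a) (har : 2 * (r + 1) ^ 2 + 4 ≤ a ^ 2)
    {z : EuclideanSpace ℝ (Fin n)} (hz : z ∈ tiltRegion e r a b) :
    frameConst m • fundJet z = ∫ p : EuclideanSpace ℝ (Fin m) × ℝ, tiltJet e (J p.1) p.2 z
      ∂(volume.prod (volume.restrict (Set.Ioi 0))) := by
  have hint := integrable_tiltJet hm he hJ ha0 har hz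
  have hval := fun z (hz : z ∈ tiltRegion e r a b) =>
    integral_tiltJet_fst hm hn he hJ hP hPn ha0 har hz
  have hnhds := (isOpen_tiltRegion e r a b).mem_nhds hz
  have hz0 : z ≠ 0 := by
    rintro rfl
    have := hz.2.1
    rw [inner_zero_left, abs_zero] at this
    linarith
  have hd1 := (hasFDerivAt_integral_tiltJet hm he hJ ha0 har hz).congr_of_eventuallyEq
    (f₁ := fun z => frameConst m * (fundJet z).1)
    (Filter.eventually_of_mem hnhds fun z hz => (hval z hz).symm)
  have hd2 := (hasFDerivAt_fundJet_fst (by omega) hz0).const_mul (frameConst m)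
  refine Eq.trans (Prod.ext ?_ ?_) (integral_pair hint.fst hint.snd).symm
  · exact (hval z hz).symm
  · exact hd2.unique hd1

end

section

variable {n : ℕ}

/-- Continuous jet fields over `K`, as a Banach space. -/
def JetMaps (K : Set (EuclideanSpace ℝ (Fin n))) : Type := C(K, JetSpace n)

section

variable {K : Set (EuclideanSpace ℝ (Fin n))} [CompactSpace K]

instance : NormedAddCommGroup (JetMaps K) :=
  inferInstanceAs (NormedAddCommGroup C(K, JetSpace n))

instance : NormedSpace ℂ (JetMaps K) := inferInstanceAs (NormedSpace ℂ C(K, JetSpace n))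

instance : CompleteSpace (JetMaps K) := inferInstanceAs (CompleteSpace C(K, JetSpace n))

/-- Evaluation of a jet field at a point. -/
def evalJet (x : K) : JetMaps K →L[ℂ] JetSpace n :=
  ContinuousMap.evalCLM ℂ x

/-- The jet field with given values, if these depend continuously on the point. -/
def jetMap (f : K → JetSpace n) : JetMaps K := ContinuousMap.mkD f 0

lemma JetMaps.ext {F G : JetMaps K} (h : ∀ x, evalJet x F = evalJet x G) : F = G :=
  ContinuousMap.ext h

lemma JetMaps.norm_le {F : JetMaps K} {C : ℝ} (hC : 0 ≤ C) (h : ∀ x, ‖evalJet x F‖ ≤ C) :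
    ‖F‖ ≤ C :=
  (ContinuousMap.norm_le _ hC).mpr h

lemma JetMaps.norm_evalJet_le (F : JetMaps K) (x : K) : ‖evalJet x F‖ ≤ ‖F‖ :=
  ContinuousMap.norm_coe_le_norm (F : C(K, JetSpace n)) x

lemma evalJet_jetMap {f : K → JetSpace n} (hf : Continuous f) (x : K) :
    evalJet x (jetMap f) = f x :=
  ContinuousMap.mkD_apply_of_continuous hf

lemma evalJet_jetMap_of_uncurry {T : Type*} [TopologicalSpace T] {f : T → K → JetSpace n}
    {s : Set T} (hf : ContinuousOn (Function.uncurry f) (s ×ˢ Set.univ)) {t : T} (ht : t ∈ s)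
    (x : K) : evalJet x (jetMap (f t)) = f t x :=
  evalJet_jetMap (hf.comp_continuous (Continuous.prodMk_right t) fun _ => ⟨ht, trivial⟩) x

lemma continuousOn_jetMap {T : Type*} [TopologicalSpace T] {f : T → K → JetSpace n} {s : Set T}
    (hf : ContinuousOn (Function.uncurry f) (s ×ˢ Set.univ)) :
    ContinuousOn (fun t => jetMap (f t)) s :=
  ContinuousMap.continuousOn_mkD_of_uncurry f 0 hf

lemma evalJet_integral {α : Type*} [MeasurableSpace α] {μ : Measure α} {F : α → JetMaps K}
    (hF : Integrable F μ) (x : K) : evalJet x (∫ a, F a ∂μ) = ∫ a, evalJet x (F a) ∂μ :=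
  ((evalJet x).integral_comp_comm hF).symm

end

/-- The jets over `K` of complex solutions of the Helmholtz equation. -/
def helmholtzJets (K : Set (EuclideanSpace ℝ (Fin n))) [CompactSpace K] :
    Submodule ℂ (JetMaps K) where
  carrier := {F | ∃ f ∈ helmholtz n, ∀ x : K, evalJet x F = (f x, fderiv ℝ f x)}
  zero_mem' := by
    refine ⟨0, zero_mem _, fun x => ?_⟩
    rw [fderiv_zero]
    rfl
  add_mem' := by
    rintro F G ⟨f, hf, hF⟩ ⟨g, hg, hG⟩
    refine ⟨f + g, add_mem hf hg, fun x => ?_⟩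
    rw [map_add, hF, hG,
      fderiv_add (hf.1.differentiable (by simp) _) (hg.1.differentiable (by simp) _)]
    rfl
  smul_mem' := by
    rintro c F ⟨f, hf, hF⟩
    refine ⟨c • f, Submodule.smul_mem _ c hf, fun x => ?_⟩
    rw [map_smul, hF, fderiv_const_smul (hf.1.differentiable (by simp) _)]
    rfl

lemma continuousOn_fundJet (hn : 3 ≤ n) :
    ContinuousOn (fundJet : EuclideanSpace ℝ (Fin n) → JetSpace n) {0}ᶜ := by
  intro z hz
  have hA := gaussIntegrable_amp (m := n - 1) (by omega)
  have hz' : z ≠ 0 := hz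
  have hre : 0 < (((‖z‖ ^ 2 : ℝ) : ℂ)).re := by rw [Complex.ofReal_re]; positivity
  have hc : ContinuousAt (fun z : EuclideanSpace ℝ (Fin n) => ((‖z‖ ^ 2 : ℝ) : ℂ)) z := by
    fun_prop
  have h1 := ContinuousAt.comp (f := fun z : EuclideanSpace ℝ (Fin n) => ((‖z‖ ^ 2 : ℝ) : ℂ))
    (hA.hasDerivAt hre).continuousAt hc
  have h2 := ContinuousAt.comp (f := fun z : EuclideanSpace ℝ (Fin n) => ((‖z‖ ^ 2 : ℝ) : ℂ))
    (hA.diffAmp.hasDerivAt hre).continuousAt hc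
  exact (continuous_radialJet.continuousAt.comp
    (f := fun z => (_, _, z)) (h1.prodMk (h2.prodMk continuousAt_id))).continuousWithinAt

lemma continuousOn_fundJet_sub {K : Set (EuclideanSpace ℝ (Fin n))} (hn : 3 ≤ n) :
    ContinuousOn (Function.uncurry fun (y : EuclideanSpace ℝ (Fin n)) (x : K) =>
        fundJet ((x : EuclideanSpace ℝ (Fin n)) - y))
      (Kᶜ ×ˢ Set.univ) := by
  refine (continuousOn_fundJet hn).comp (f := fun p : EuclideanSpace ℝ (Fin n) × K =>
    (p.2 : EuclideanSpace ℝ (Fin n)) - p.1) (by fun_prop) ?_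
  rintro ⟨y, x⟩ hp
  exact fun h => hp.1 (sub_eq_zero.mp h ▸ x.2)

/-- The jet over `K` of the fundamental solution with pole at `y`. -/
def poleJet (K : Set (EuclideanSpace ℝ (Fin n))) (y : EuclideanSpace ℝ (Fin n)) : JetMaps K :=
  jetMap fun x : K => fundJet ((x : EuclideanSpace ℝ (Fin n)) - y)

variable {K : Set (EuclideanSpace ℝ (Fin n))} [CompactSpace K]

lemma poleJet_apply (hn : 3 ≤ n) {y : EuclideanSpace ℝ (Fin n)} (hy : y ∉ K) (x : K) :
    evalJet x (poleJet K y) = fundJet ((x : EuclideanSpace ℝ (Fin n)) - y) :=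
  evalJet_jetMap_of_uncurry
    (f := fun y (x : K) => fundJet ((x : EuclideanSpace ℝ (Fin n)) - y))
    (continuousOn_fundJet_sub hn) hy x

lemma continuousOn_poleJet (hn : 3 ≤ n) : ContinuousOn (poleJet K) Kᶜ :=
  continuousOn_jetMap (f := fun y (x : K) => fundJet ((x : EuclideanSpace ℝ (Fin n)) - y))
    (continuousOn_fundJet_sub hn)

/-- A functional annihilating the Helmholtz jets annihilates the poles far away from `K`. -/
lemma map_poleJet_eq_zero_of_far (hn : 3 ≤ n)
    {ℓ : JetMaps K →L[ℂ] ℂ} (hℓ : ∀ F ∈ helmholtzJets K, ℓ F = 0)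
    {e : EuclideanSpace ℝ (Fin n)} (he : ‖e‖ = 1) {r a b : ℝ} (ha0 : 0 ≤ a) (hb0 : 0 ≤ b)
    (har : 2 * (r + 1) ^ 2 + 4 ≤ a ^ 2) {y : EuclideanSpace ℝ (Fin n)}
    (hy : ∀ x ∈ K, x - y ∈ tiltRegion e r a b ∧ ⟪x - y, e⟫ < 0) : ℓ (poleJet K y) = 0 := by
  obtain ⟨m, rfl⟩ : ∃ m, n = m + 1 := ⟨n - 1, by omega⟩
  have hm : 2 ≤ m := by omega
  have : Nonempty (Fin m) := ⟨⟨0, by omega⟩⟩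
  obtain ⟨J, P, hJ, hP, hPn⟩ := exists_orthogonal_frame rfl he
  have hyK : y ∉ K := fun h => by simpa using (hy y h).2
  set G : EuclideanSpace ℝ (Fin m) × ℝ → K → JetSpace (m + 1) := fun p x =>
    tiltJet e (J p.1) p.2 ((x : EuclideanSpace ℝ (Fin (m + 1))) - y) with hG
  set F : EuclideanSpace ℝ (Fin m) × ℝ → JetMaps K := fun p => jetMap (G p) with hF
  have hcont : ContinuousOn (Function.uncurry G) ({p | 0 < p.2} ×ˢ Set.univ) :=
    (continuousOn_tiltJet e).comp
      (f := fun q : (EuclideanSpace ℝ (Fin m) × ℝ) × K =>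
        ((J q.1.1, q.1.2), (q.2 : EuclideanSpace ℝ (Fin (m + 1))) - y))
      (by fun_prop) fun q hq => hq.1
  have hFapp : ∀ p : EuclideanSpace ℝ (Fin m) × ℝ, 0 < p.2 → ∀ x : K,
      evalJet x (F p) = tiltJet e (J p.1) p.2 (x - y) := fun p hp x =>
    evalJet_jetMap_of_uncurry (f := G) hcont hp x
  have hFint : Integrable F (volume.prod (volume.restrict (Set.Ioi 0))) := by
    refine (integrable_tiltBound hm b).mono' (aestronglyMeasurable_of_continuousOn_snd_pos
      (continuousOn_jetMap hcont)) (ae_snd_pos.mono fun p hp => ?_)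
    have h0 : 0 ≤ tiltBound b ‖p.1‖ p.2 := by
      have : 0 < p.2 := hp
      unfold tiltBound
      positivity
    refine JetMaps.norm_le h0 fun x => ?_
    rw [hFapp p hp]
    exact norm_tiltJet_le_of_mem he hJ ha0 har (hy x x.2).1 p.1 hp
  have hE : frameConst m • poleJet K y = ∫ p, F p ∂(volume.prod (volume.restrict (Set.Ioi 0))) := by
    refine JetMaps.ext fun x => ?_
    rw [map_smul, poleJet_apply hn hyK, evalJet_integral hFint,
      fundJet_eq_integral_tiltJet hm rfl he hJ hP hPn ha0 har (hy x x.2).1]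
    exact integral_congr_ae (ae_snd_pos.mono fun p hp => (hFapp p hp x).symm)
  have h0 : frameConst m * ℓ (poleJet K y) = 0 := by
    rw [← smul_eq_mul, ← map_smul, hE, ← ContinuousLinearMap.integral_comp_comm ℓ hFint,
      integral_prod _ (ℓ.integrable_comp hFint)]
    refine integral_eq_zero_of_ae ?_
    have hne : ∀ᵐ k : EuclideanSpace ℝ (Fin m), k ≠ 0 := by
      simp [ae_iff]
    filter_upwards [hFint.prod_right_ae, hne] with k hk hk0
    rw [ContinuousLinearMap.integral_comp_comm ℓ hk]
    refine hℓ _ ?_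
    obtain ⟨f, hf, hfk⟩ := exists_helmholtz_eq_integral_tiltJet he
      (fun h => hk0 (J.injective (h.trans J.map_zero.symm))) (hJ k) y
    refine ⟨f, hf, fun x => ?_⟩
    rw [evalJet_integral hk, ← hfk x (hy x x.2).2]
    exact setIntegral_congr_fun measurableSet_Ioi fun v hv => hFapp (k, v) hv x
  exact (mul_eq_zero.mp h0).resolve_left (frameConst_ne_zero m)

/-- A functional annihilating the Helmholtz jets annihilates the poles in some open ball. -/
lemma exists_ball_map_poleJet_eq_zero (hn : 3 ≤ n)
    {ℓ : JetMaps K →L[ℂ] ℂ} (hℓ : ∀ F ∈ helmholtzJets K, ℓ F = 0) :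
    ∃ y₀, ∀ y ∈ ball y₀ 1, y ∉ K ∧ ℓ (poleJet K y) = 0 := by
  obtain ⟨R, hR0, hR⟩ : ∃ R : ℝ, 0 < R ∧ ∀ x ∈ K, ‖x‖ ≤ R :=
    (isCompact_iff_compactSpace.mpr ‹_›).isBounded.exists_pos_norm_le
  set e : EuclideanSpace ℝ (Fin n) := EuclideanSpace.single ⟨0, by omega⟩ 1 with hedef
  have he : ‖e‖ = 1 := by simp [hedef]
  set r : ℝ := 2 * (R + 1) + 1
  set a : ℝ := 2 * (r + 1) + 4
  set s : ℝ := a + R + 2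
  have key : ∀ y ∈ ball (s • e) 1, ∀ x, ‖x‖ ≤ R → x - y ∈ tiltRegion e r a (s + R + 2) ∧
      ⟪x - y, e⟫ < 0 := by
    intro y hy x hx
    set w := x - (y - s • e) with hw
    have hwn : ‖w‖ < R + 1 := by
      rw [mem_ball, dist_eq_norm] at hy
      exact (norm_sub_le _ _).trans_lt (by linarith)
    have hxy : x - y = w - s • e := by rw [hw]; abel
    have hi : |⟪w, e⟫| ≤ ‖w‖ := by
      simpa [he] using abs_real_inner_le_norm w e
    have hin : ⟪x - y, e⟫ = ⟪w, e⟫ - s := by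
      rw [hxy, inner_sub_left, real_inner_smul_left, real_inner_self_eq_norm_sq, he]; ring
    have hi' := abs_le.mp hi
    have hneg : ⟪x - y, e⟫ < 0 := by
      rw [hin]
      simp only [s, a, r]
      linarith
    refine ⟨⟨?_, ?_, ?_⟩, hneg⟩
    · have : x - y - ⟪x - y, e⟫ • e = w - ⟪w, e⟫ • e := by
        rw [hin, hxy, sub_smul]; abel
      rw [this]
      refine (norm_sub_le _ _).trans_lt ?_
      rw [norm_smul, he, mul_one, Real.norm_eq_abs]
      simp only [r]
      linarith
    · rw [abs_of_neg hneg, hin]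
      simp only [s]
      linarith
    · rw [abs_of_neg hneg, hin]
      linarith
  refine ⟨s • e, fun y hy => ⟨fun h => ?_, ?_⟩⟩
  · simpa using (key y hy y (hR y h)).2
  · refine map_poleJet_eq_zero_of_far hn hℓ he (by positivity) (by positivity) ?_
      fun x hx => key y hy x (hR x hx)
    have : 0 < r := by positivity
    simp only [a]
    nlinarith

end

section

variable {n : ℕ}

lemma evalJet_circleIntegral {K : Set (EuclideanSpace ℝ (Fin n))} [CompactSpace K]
    {Ψ : ℂ → JetMaps K} {c : ℂ} {R : ℝ} (hΨ : CircleIntegrable Ψ c R) (x : K) :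
    evalJet x (∮ z in C(c, R), Ψ z) = ∮ z in C(c, R), evalJet x (Ψ z) := by
  rw [circleIntegral, circleIntegral, ← (evalJet x).intervalIntegral_comp_comm hΨ.out]
  simp_rw [map_smul]

/-- A continuous family of jet fields which is pointwise holomorphic is holomorphic. -/
lemma analyticOnNhd_of_evalJet {K : Set (EuclideanSpace ℝ (Fin n))} [CompactSpace K]
    {Ψ : ℂ → JetMaps K} {c : ℂ} {R : NNReal} (hR : 0 < R)
    (hc : ContinuousOn Ψ (closedBall c R))
    (hd : ∀ x : K, DifferentiableOn ℂ (fun z => evalJet x (Ψ z)) (closedBall c R)) :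
    AnalyticOnNhd ℂ Ψ (ball c R) := by
  have hcs := hc.mono sphere_subset_closedBall
  have hF := hasFPowerSeriesOn_cauchy_integral (hcs.circleIntegrable R.2) hR
  have hF' : AnalyticOnNhd ℂ (fun w => (2 * π * Complex.I : ℂ)⁻¹ •
      ∮ z in C(c, R), (z - w)⁻¹ • Ψ z) (ball c R) := by
    intro w hw
    refine hF.analyticAt_of_mem ?_
    simpa [Metric.eball_coe] using hw
  refine hF'.congr isOpen_ball fun w hw => JetMaps.ext fun x => ?_
  have hint : CircleIntegrable (fun z => (z - w)⁻¹ • Ψ z) c R := by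
    refine ContinuousOn.circleIntegrable R.2 (ContinuousOn.smul (ContinuousOn.inv₀
      (continuous_id.sub continuous_const).continuousOn fun z hz h => ?_) hcs)
    change z - w = 0 at h
    rw [sub_eq_zero.mp h] at hz
    exact (mem_ball.mp hw).ne (mem_sphere.mp hz)
  rw [map_smul, evalJet_circleIntegral hint]
  simp_rw [map_smul]
  refine (DifferentiableOn.diffContOnCl ?_).two_pi_i_inv_smul_circleIntegral_sub_inv_smul hw
  rw [closure_ball _ (NNReal.coe_pos.mpr hR).ne']
  exact hd x

/-- The holomorphic extension of `s ↦ ‖a - s • e‖²`. -/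
def complexNormSq (a e : EuclideanSpace ℝ (Fin n)) (s : ℂ) : ℂ :=
  ((‖a‖ ^ 2 : ℝ) : ℂ) - 2 * s * (⟪a, e⟫ : ℝ) + s ^ 2 * ((‖e‖ ^ 2 : ℝ) : ℂ)

/-- The holomorphic extension of `s ↦ fundJet (a - s • e)`. -/
def lineJet (a e : EuclideanSpace ℝ (Fin n)) (s : ℂ) : JetSpace n :=
  (gaussTransform (amp (n - 1) 1) (complexNormSq a e s),
    (2 * gaussTransform (diffAmp (amp (n - 1) 1)) (complexNormSq a e s)) •
      (linForm a - s • linForm e))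

lemma complexNormSq_ofReal (a e : EuclideanSpace ℝ (Fin n)) (t : ℝ) :
    complexNormSq a e t = ((‖a - t • e‖ ^ 2 : ℝ) : ℂ) := by
  rw [norm_sub_sq_real, norm_smul, mul_pow, Real.norm_eq_abs, sq_abs, inner_smul_right,
    complexNormSq]
  push_cast
  ring

lemma lineJet_ofReal (a e : EuclideanSpace ℝ (Fin n)) (t : ℝ) :
    lineJet a e t = fundJet (a - t • e) := by
  have h : linForm a - (t : ℂ) • linForm e = linForm (a - t • e) := by
    ext z
    simp [inner_sub_left, real_inner_smul_left]
  rw [lineJet, fundJet, radialJet, complexNormSq_ofReal, h]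

lemma complexNormSq_re_pos {a e : EuclideanSpace ℝ (Fin n)} {s : ℂ} {r : ℝ}
    (hs : ‖s‖ < 2) (he : ‖e‖ < 2 * r) (ha : 19 * r ≤ ‖a‖) : 0 < (complexNormSq a e s).re := by
  have h1 : |s.re| < 2 := (Complex.abs_re_le_norm s).trans_lt hs
  have h2 : |s.re * ⟪a, e⟫| ≤ 2 * (‖a‖ * (2 * r)) := by
    rw [abs_mul]
    exact mul_le_mul h1.le ((abs_real_inner_le_norm a e).trans (by gcongr)) (abs_nonneg _)
      (by norm_num)
  have h3 : (s ^ 2).re ≥ -4 := by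
    have := (abs_le.mp (Complex.abs_re_le_norm (s ^ 2))).1
    rw [norm_pow] at this
    nlinarith [norm_nonneg s]
  have h4 : ‖e‖ ^ 2 ≤ 4 * r ^ 2 := by nlinarith [norm_nonneg e]
  have h5 : (complexNormSq a e s).re = ‖a‖ ^ 2 - 2 * (s.re * ⟪a, e⟫) + (s ^ 2).re * ‖e‖ ^ 2 := by
    rw [complexNormSq, Complex.add_re, Complex.sub_re, Complex.re_mul_ofReal,
      Complex.re_mul_ofReal, Complex.ofReal_re]
    simp
    ring
  have h6 := (abs_le.mp h2).2
  have h7 : (s ^ 2).re * ‖e‖ ^ 2 ≥ -4 * (4 * r ^ 2) := by nlinarith [sq_nonneg ‖e‖]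
  have hr : 0 < r := by linarith [norm_nonneg e]
  rw [h5]
  nlinarith [mul_pos hr hr]

lemma continuousOn_lineJet (hn : 3 ≤ n) (e : EuclideanSpace ℝ (Fin n)) :
    ContinuousOn (fun q : ℂ × EuclideanSpace ℝ (Fin n) => lineJet q.2 e q.1)
      {q | 0 < (complexNormSq q.2 e q.1).re} := by
  have hA := gaussIntegrable_amp (m := n - 1) (by omega)
  have hS : Continuous fun q : ℂ × EuclideanSpace ℝ (Fin n) => complexNormSq q.2 e q.1 := by
    unfold complexNormSq
    fun_prop
  intro q hq
  have h1 := ContinuousAt.comp (f := fun q : ℂ × EuclideanSpace ℝ (Fin n) =>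
    complexNormSq q.2 e q.1) (x := q) (hA.hasDerivAt hq).continuousAt hS.continuousAt
  have h2 := ContinuousAt.comp (f := fun q : ℂ × EuclideanSpace ℝ (Fin n) =>
    complexNormSq q.2 e q.1) (x := q) (hA.diffAmp.hasDerivAt hq).continuousAt hS.continuousAt
  have h3 : Continuous fun q : ℂ × EuclideanSpace ℝ (Fin n) =>
      linForm q.2 - q.1 • linForm e :=
    (continuous_linForm.comp continuous_snd).sub (continuous_fst.smul continuous_const)
  exact (h1.prodMk ((continuousAt_const.mul h2).smul h3.continuousAt)).continuousWithinAt

lemma differentiableAt_lineJet (hn : 3 ≤ n) {a e : EuclideanSpace ℝ (Fin n)} {s : ℂ}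
    (hs : 0 < (complexNormSq a e s).re) : DifferentiableAt ℂ (lineJet a e) s := by
  have hA := gaussIntegrable_amp (m := n - 1) (by omega)
  have hS : DifferentiableAt ℂ (complexNormSq a e) s := by
    unfold complexNormSq
    fun_prop
  have h1 := DifferentiableAt.comp s (hA.hasDerivAt hs).differentiableAt hS
  have h2 := DifferentiableAt.comp s (hA.diffAmp.hasDerivAt hs).differentiableAt hS
  have h3 : DifferentiableAt ℂ (fun s : ℂ => linForm a - s • linForm e) s :=
    (differentiableAt_const _).sub (differentiableAt_id.smul_const _)
  exact h1.prodMk ((h2.const_mul 2).smul h3)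

variable {K : Set (EuclideanSpace ℝ (Fin n))} [CompactSpace K]

/-- Local unique continuation for the potential of a functional. -/
lemma map_poleJet_eq_zero_of_eventually (hn : 3 ≤ n) (ℓ : JetMaps K →L[ℂ] ℂ) {r : ℝ}
    {y₁ y₂ : EuclideanSpace ℝ (Fin n)} (hK : ∀ x ∈ K, 19 * r ≤ ‖x - y₁‖)
    (h12 : ‖y₂ - y₁‖ < 2 * r) (h1 : ∀ᶠ y in nhds y₁, ℓ (poleJet K y) = 0) :
    ℓ (poleJet K y₂) = 0 := by
  set e := y₂ - y₁ with he
  set G : ℂ → K → JetSpace n := fun s x => lineJet ((x : EuclideanSpace ℝ (Fin n)) - y₁) e s with hG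
  have hpos : ∀ s : ℂ, ‖s‖ < 2 → ∀ x : K,
      0 < (complexNormSq ((x : EuclideanSpace ℝ (Fin n)) - y₁) e s).re :=
    fun s hs x => complexNormSq_re_pos hs h12 (hK x x.2)
  have hcont : ContinuousOn (Function.uncurry G) (ball 0 2 ×ˢ Set.univ) :=
    (continuousOn_lineJet hn e).comp (f := fun q : ℂ × K =>
      (q.1, (q.2 : EuclideanSpace ℝ (Fin n)) - y₁)) (by fun_prop)
      fun q hq => hpos q.1 (mem_ball_zero_iff.mp hq.1) q.2
  have hsub : closedBall (0 : ℂ) (3 / 2 : NNReal) ⊆ ball 0 2 :=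
    closedBall_subset_ball (by norm_num)
  have hana : AnalyticOnNhd ℂ (fun s => jetMap (G s)) (ball 0 (3 / 2 : NNReal)) := by
    refine analyticOnNhd_of_evalJet (by norm_num) ((continuousOn_jetMap hcont).mono hsub)
      fun x => DifferentiableOn.congr (f := lineJet ((x : EuclideanSpace ℝ (Fin n)) - y₁) e)
        (fun s hs => ?_)
        fun s hs => evalJet_jetMap_of_uncurry (f := G) hcont (hsub hs) x
    exact (differentiableAt_lineJet hn
      (hpos s (mem_ball_zero_iff.mp (hsub hs)) x)).differentiableWithinAt
  have hana' : AnalyticOnNhd ℂ (fun s => ℓ (jetMap (G s))) (ball 0 (3 / 2 : NNReal)) :=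
    fun s hs => (ℓ.analyticAt _).comp (hana s hs)
  have hreal : ∀ t : ℝ, jetMap (G t) = poleJet K (y₁ + t • e) := by
    intro t
    simp only [hG, poleJet, lineJet_ofReal]
    congr 1
    ext1 x
    rw [sub_sub]
  have hfreq : ∃ᶠ s in nhdsWithin (0 : ℂ) {0}ᶜ, ℓ (jetMap (G s)) = 0 := by
    have ht : Tendsto (fun t : ℝ => (t : ℂ)) (nhdsWithin 0 {0}ᶜ) (nhdsWithin (0 : ℂ) {0}ᶜ) := by
      refine tendsto_nhdsWithin_iff.mpr ⟨?_, ?_⟩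
      · exact (Complex.continuous_ofReal.tendsto' 0 0 (by simp)).mono_left nhdsWithin_le_nhds
      · filter_upwards [self_mem_nhdsWithin] with t ht
        simpa using ht
    refine ht.frequently (Eventually.frequently ?_)
    have hl : Tendsto (fun t : ℝ => y₁ + t • e) (nhdsWithin 0 {0}ᶜ) (nhds y₁) := by
      refine Tendsto.mono_left ?_ nhdsWithin_le_nhds
      exact Continuous.tendsto' (by fun_prop) _ _ (by simp)
    filter_upwards [hl.eventually h1] with t ht
    rw [hreal, ht]
  have hz := hana'.eqOn_zero_of_preconnected_of_frequently_eq_zero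
    (convex_ball 0 _).isPreconnected (mem_ball_self (by norm_num)) hfreq
    (show (1 : ℂ) ∈ ball 0 _ by rw [mem_ball_zero_iff]; norm_num)
  have h := hreal 1
  rw [Complex.ofReal_one, one_smul, he, add_sub_cancel] at h
  rw [← h]
  exact hz

/-- A functional annihilating the Helmholtz jets annihilates all poles off `K`, provided the
complement of `K` is connected. -/
lemma map_poleJet_eq_zero (hn : 3 ≤ n) (hK : IsConnected Kᶜ) {ℓ : JetMaps K →L[ℂ] ℂ}
    (hℓ : ∀ F ∈ helmholtzJets K, ℓ F = 0) {y : EuclideanSpace ℝ (Fin n)} (hy : y ∉ K) :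
    ℓ (poleJet K y) = 0 := by
  have hopen : IsOpen Kᶜ := (isCompact_iff_compactSpace.mpr ‹_›).isClosed.isOpen_compl
  obtain ⟨y₀, hy₀⟩ := exists_ball_map_poleJet_eq_zero hn hℓ
  refine (hK.isPreconnected.subset_of_closure_inter_subset
    (u := {y | ∀ᶠ z in nhds y, ℓ (poleJet K z) = 0}) isOpen_setOfPred_eventually_nhds
    ⟨y₀, (hy₀ y₀ (mem_ball_self one_pos)).1, ?_⟩ ?_ hy).self_of_nhds
  · filter_upwards [ball_mem_nhds y₀ one_pos] with z hz using (hy₀ z hz).2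
  · rintro w ⟨hw, hwK⟩
    obtain ⟨R, hR, hRK⟩ := Metric.isOpen_iff.mp hopen w hwK
    set r := R / 20 with hr
    have hr0 : 0 < r := by positivity
    obtain ⟨y₁, hy₁, hwy⟩ := Metric.mem_closure_iff.mp hw r hr0
    refine Filter.eventually_of_mem (ball_mem_nhds w hr0) fun z hz => ?_
    have hz' : dist z w < r := hz
    refine map_poleJet_eq_zero_of_eventually hn ℓ (r := r) (y₁ := y₁) (fun x hx => ?_) ?_ hy₁
    · have h1 : R ≤ dist x w := not_lt.mp fun h => hRK h hx
      have h2 := dist_triangle_right x w y₁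
      rw [← dist_eq_norm]
      linarith
    · rw [← dist_eq_norm]
      have := dist_triangle z w y₁
      linarith

end

section

variable {n : ℕ}

lemma integrableOn_fundJet (hn : 3 ≤ n) (R : ℝ) :
    IntegrableOn (fundJet : EuclideanSpace ℝ (Fin n) → JetSpace n) (ball 0 R) := by
  have : Nonempty (Fin n) := ⟨⟨0, by omega⟩⟩
  have hne : ∀ᵐ z : EuclideanSpace ℝ (Fin n), z ≠ 0 := by simp [ae_iff]
  refine (integrable_sliceJet hn R).integral_prod_right.congr ?_
  filter_upwards [ae_restrict_of_ae hne] with z hz using (fundJet_eq_integral hn hz).symm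

/-- A null set has neighbourhoods on which the potential of a density is uniformly small. -/
lemma exists_isOpen_norm_setIntegral_fundJet_le (hn : 3 ≤ n) {K : Set (EuclideanSpace ℝ (Fin n))}
    (hKb : Bornology.IsBounded K) (hK0 : volume K = 0) {ρ : EuclideanSpace ℝ (Fin n) → ℂ}
    (hρ : Continuous ρ) (hρs : HasCompactSupport ρ) {ε : ℝ} (hε : 0 < ε) :
    ∃ U, IsOpen U ∧ K ⊆ U ∧ ∀ x ∈ K, ‖∫ y in U, ρ y • fundJet (x - y)‖ ≤ ε := by
  obtain ⟨C₀, hC₀⟩ := hρ.bounded_above_of_compact_support hρs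
  set C := max C₀ 1
  have hC : ∀ y, ‖ρ y‖ ≤ C := fun y => (hC₀ y).trans (le_max_left _ _)
  have hC1 : 0 < C := lt_of_lt_of_le one_pos (le_max_right _ _)
  obtain ⟨R, hR0, hR⟩ := (hKb.union hρs.isCompact.isBounded).exists_pos_norm_le
  set φ : EuclideanSpace ℝ (Fin n) → ENNReal :=
    (ball 0 (2 * R + 1)).indicator fun z => ‖(fundJet z : JetSpace n)‖ₑ with hφ
  have hfin : ∫⁻ z, φ z ≠ ⊤ := by
    rw [hφ, lintegral_indicator measurableSet_ball]
    exact (integrableOn_fundJet hn (2 * R + 1)).hasFiniteIntegral.ne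
  obtain ⟨d, hd, hsmall⟩ := exists_pos_setLIntegral_lt_of_measure_lt hfin
    (ε := ENNReal.ofReal (ε / C)) (by simp; positivity)
  obtain ⟨U, hKU, hUo, hUd⟩ := K.exists_isOpen_lt_of_lt d (by rwa [hK0])
  refine ⟨U, hUo, hKU, fun x hx => ?_⟩
  have hpt : ∀ y, ‖ρ y • (fundJet (x - y) : JetSpace n)‖ₑ ≤ ENNReal.ofReal C * φ (x - y) := by
    intro y
    by_cases hy : y ∈ tsupport ρ
    · have hmem : x - y ∈ ball (0 : EuclideanSpace ℝ (Fin n)) (2 * R + 1) := by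
        rw [mem_ball_zero_iff]
        refine (norm_sub_le _ _).trans_lt ?_
        linarith [hR x (Or.inl hx), hR y (Or.inr hy)]
      rw [enorm_smul, hφ, Set.indicator_of_mem hmem]
      gcongr
      rw [← ofReal_norm]
      exact ENNReal.ofReal_le_ofReal (hC y)
    · rw [image_eq_zero_of_notMem_tsupport hy, enorm_smul, enorm_zero, zero_mul]
      exact zero_le
  have htr : ∫⁻ y in U, φ (x - y) < ENNReal.ofReal (ε / C) := by
    have hpre : (fun y => x - y) ⁻¹' ((fun y => x - y) ⁻¹' U) = U := by ext; simp
    have hmp := Measure.measurePreserving_sub_left (volume : Measure (EuclideanSpace ℝ (Fin n))) x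
    have hemb : MeasurableEmbedding fun y : EuclideanSpace ℝ (Fin n) => x - y :=
      (Homeomorph.subLeft x).measurableEmbedding
    have := hmp.setLIntegral_comp_preimage_emb hemb φ ((fun y => x - y) ⁻¹' U)
    rw [hpre] at this
    rw [this]
    exact hsmall _ (by rwa [hmp.measure_preimage_emb hemb])
  have hle : ‖∫ y in U, ρ y • (fundJet (x - y) : JetSpace n)‖ₑ ≤ ENNReal.ofReal ε := by
    calc ‖∫ y in U, ρ y • (fundJet (x - y) : JetSpace n)‖ₑ
        ≤ ∫⁻ y in U, ‖ρ y • (fundJet (x - y) : JetSpace n)‖ₑ := enorm_integral_le_lintegral_enorm _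
      _ ≤ ∫⁻ y in U, ENNReal.ofReal C * φ (x - y) := lintegral_mono hpt
      _ = ENNReal.ofReal C * ∫⁻ y in U, φ (x - y) := lintegral_const_mul' _ _ ENNReal.ofReal_ne_top
      _ ≤ ENNReal.ofReal C * ENNReal.ofReal (ε / C) := by gcongr
      _ = ENNReal.ofReal ε := by
        rw [← ENNReal.ofReal_mul hC1.le, mul_div_cancel₀ _ hC1.ne']
  rwa [← ofReal_norm, ENNReal.ofReal_le_ofReal_iff hε.le] at hle

variable {K : Set (EuclideanSpace ℝ (Fin n))} [CompactSpace K]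

/-- Over a null set, jets of `C_c²` functions are approximated by superpositions of poles. -/
lemma exists_pole_superposition (hn : 3 ≤ n) (hK0 : volume K = 0)
    {g : EuclideanSpace ℝ (Fin n) → ℂ} (hg : ContDiff ℝ 2 g) (hgs : HasCompactSupport g)
    {ε : ℝ} (hε : 0 < ε) :
    ∃ M : JetMaps K, (∀ ℓ : JetMaps K →L[ℂ] ℂ, (∀ y, y ∉ K → ℓ (poleJet K y) = 0) → ℓ M = 0) ∧
      ‖jetMap (fun x : K => ((g x, fderiv ℝ g x) : JetSpace n)) - M‖ ≤ ε := by
  set ρ : EuclideanSpace ℝ (Fin n) → ℂ := fun y => lap g y + g y with hρdef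
  have hρ : Continuous ρ := (continuous_lap hg).add hg.continuous
  have hρs : HasCompactSupport ρ := (hasCompactSupport_lap hgs).add hgs
  have hK : IsCompact K := isCompact_iff_compactSpace.mpr ‹_›
  set c : ℂ := -(gaussMass n : ℂ)⁻¹ with hc
  have hc0 : 0 < ‖c‖ := by
    have := (gaussMass_pos n).ne'
    rw [norm_pos_iff, hc]
    simpa using this
  obtain ⟨U, hUo, hKU, hU⟩ := exists_isOpen_norm_setIntegral_fundJet_le hn hK.isBounded hK0 hρ hρs
    (ε := ε / ‖c‖) (by positivity)
  set T := tsupport ρ \ U with hT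
  have hTc : IsCompact T := hρs.isCompact.diff hUo
  have hTK : T ⊆ Kᶜ := fun y hy h => hy.2 (hKU h)
  have hint : IntegrableOn (fun y => ρ y • poleJet K y) T :=
    (hρ.continuousOn.smul ((continuousOn_poleJet hn).mono hTK)).integrableOn_compact hTc
  refine ⟨c • ∫ y in T, ρ y • poleJet K y, fun ℓ hℓ => ?_, JetMaps.norm_le hε.le fun x => ?_⟩
  · rw [map_smul, ← ContinuousLinearMap.integral_comp_comm ℓ hint, smul_eq_mul,
      setIntegral_eq_zero_of_forall_eq_zero fun y hy => ?_, mul_zero]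
    rw [map_smul, hℓ y (hTK hy), smul_zero]
  · obtain ⟨hi, hjet⟩ := jet_eq_integral_fundJet hn hg hgs (x : EuclideanSpace ℝ (Fin n))
    have hcont : Continuous fun x : K => ((g x, fderiv ℝ g x) : JetSpace n) :=
      ((hg.continuous.prodMk (hg.continuous_fderiv (by simp))).comp continuous_subtype_val)
    have hTint : ∫ y in T, evalJet x (ρ y • poleJet K y) =
        ∫ y in Uᶜ, ρ y • (fundJet ((x : EuclideanSpace ℝ (Fin n)) - y) : JetSpace n) := by
      rw [setIntegral_eq_of_subset_of_forall_sdiff_eq_zero hUo.measurableSet.compl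
        (s := T) (fun y hy => hy.2) fun y hy => ?_]
      · refine setIntegral_congr_fun hTc.measurableSet fun y hy => ?_
        rw [map_smul, poleJet_apply hn (hTK hy)]
      · have : y ∉ tsupport ρ := fun h => hy.2 ⟨h, hy.1⟩
        rw [image_eq_zero_of_notMem_tsupport this]
        exact zero_smul ℂ (fundJet ((x : EuclideanSpace ℝ (Fin n)) - y) : JetSpace n)
    rw [map_sub, evalJet_jetMap hcont, map_smul, evalJet_integral hint, hTint, hjet,
      ← integral_add_compl hUo.measurableSet hi]
    have : c • ((∫ y in U, ρ y • (fundJet ((x : EuclideanSpace ℝ (Fin n)) - y) : JetSpace n)) +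
        ∫ y in Uᶜ, ρ y • (fundJet ((x : EuclideanSpace ℝ (Fin n)) - y) : JetSpace n)) -
        c • ∫ y in Uᶜ, ρ y • (fundJet ((x : EuclideanSpace ℝ (Fin n)) - y) : JetSpace n) =
        c • ∫ y in U, ρ y • (fundJet ((x : EuclideanSpace ℝ (Fin n)) - y) : JetSpace n) := by
      rw [smul_add, add_sub_cancel_right]
    refine (congrArg norm this).trans_le ?_
    rw [norm_smul]
    calc ‖c‖ * _ ≤ ‖c‖ * (ε / ‖c‖) := by gcongr; exact hU x x.2
      _ = ε := mul_div_cancel₀ _ hc0.ne'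

lemma jetMap_mem_closure_helmholtzJets (hn : 3 ≤ n) (hK0 : volume K = 0) (hK : IsConnected Kᶜ)
    {g : EuclideanSpace ℝ (Fin n) → ℂ} (hg : ContDiff ℝ 2 g) (hgs : HasCompactSupport g) :
    jetMap (fun x : K => ((g x, fderiv ℝ g x) : JetSpace n)) ∈
      closure (helmholtzJets K : Set (JetMaps K)) := by
  set G := jetMap (fun x : K => ((g x, fderiv ℝ g x) : JetSpace n))
  by_contra hG
  obtain ⟨ℓ, u, hlt, hu⟩ := RCLike.geometric_hahn_banach_closed_point (𝕜 := ℂ)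
    ((helmholtzJets K).restrictScalars ℝ).convex.closure isClosed_closure hG
  have hlt' : ∀ F ∈ helmholtzJets K, (ℓ F).re < u := fun F hF => hlt F (subset_closure hF)
  have hu0 : 0 < u := by simpa using hlt' 0 (zero_mem _)
  have hℓ : ∀ F ∈ helmholtzJets K, ℓ F = 0 := by
    intro F hF
    by_contra hne
    have := hlt' (((u : ℂ) / ℓ F) • F) (Submodule.smul_mem _ _ hF)
    rw [map_smul, smul_eq_mul, div_mul_cancel₀ _ hne] at this
    simp at this
  have hker : G ∈ closure {F | ℓ F = 0} := by
    rw [Metric.mem_closure_iff]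
    intro ε hε
    obtain ⟨M, hM, hGM⟩ := exists_pole_superposition (K := K) hn hK0 hg hgs (half_pos hε)
    exact ⟨M, hM ℓ fun y hy => map_poleJet_eq_zero hn hK hℓ hy, by
      rw [dist_eq_norm]; exact hGM.trans_lt (half_lt_self hε)⟩
  rw [(isClosed_eq ℓ.continuous continuous_const).closure_eq] at hker
  have hker' : ℓ G = 0 := hker
  rw [hker'] at hu
  simp at hu
  exact hu.not_gt hu0

lemma lap_re {f : EuclideanSpace ℝ (Fin n) → ℂ} (hf : ContDiff ℝ 2 f)
    (x : EuclideanSpace ℝ (Fin n)) : lap (fun y => (f y).re) x = (lap f x).re := by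
  have := Complex.reCLM.iteratedFDeriv_comp_left hf.contDiffAt (x := x) (i := 2) le_rfl
  unfold lap
  rw [Complex.re_sum]
  refine Finset.sum_congr rfl fun i _ => ?_
  exact congrArg (fun L => L ![EuclideanSpace.single i 1, EuclideanSpace.single i 1]) this

end

/-- Mergelyan-type approximation: if `K ⊂ ℝⁿ` is compact, of Lebesgue measure zero,
with connected complement, then every `h ∈ C_c²(ℝⁿ)` can be approximated on `K`,
together with its gradient, by a global solution of `Δf + f = 0`. -/
theorem stmt11 (n : ℕ) (hn : 3 ≤ n) (K : Set (EuclideanSpace ℝ (Fin n)))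
    (hKc : IsCompact K) (hK0 : volume K = 0) (hKconn : IsConnected Kᶜ)
    (δ : ℝ) (hδ : 0 < δ)
    (h : EuclideanSpace ℝ (Fin n) → ℝ) (hh : ContDiff ℝ 2 h)
    (hsupp : HasCompactSupport h) :
    ∃ f : EuclideanSpace ℝ (Fin n) → ℝ,
      ContDiff ℝ (⊤ : ℕ∞) f ∧
      (∀ x, lap f x + f x = 0) ∧
      ∀ x ∈ K, |f x - h x| + ‖gradient f x - gradient h x‖ ≤ δ := by
  have : CompactSpace K := isCompact_iff_compactSpace.mp hKc
  set g : EuclideanSpace ℝ (Fin n) → ℂ := fun y => (h y : ℂ) with hgdef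
  have hg : ContDiff ℝ 2 g := Complex.ofRealCLM.contDiff.comp hh
  have hgs : HasCompactSupport g := hsupp.comp_left (g := Complex.ofReal) Complex.ofReal_zero
  have hcont : Continuous fun x : K => ((g x, fderiv ℝ g x) : JetSpace n) :=
    (hg.continuous.prodMk (hg.continuous_fderiv (by simp))).comp continuous_subtype_val
  obtain ⟨F, ⟨f, hf, hFf⟩, hdist⟩ := Metric.mem_closure_iff.mp
    (jetMap_mem_closure_helmholtzJets (K := K) hn hK0 hKconn hg hgs) (δ / 2) (half_pos hδ)
  have hre : ContDiff ℝ (⊤ : ℕ∞) fun y => (f y).re := Complex.reCLM.contDiff.comp hf.1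
  refine ⟨fun y => (f y).re, hre, fun x => ?_, fun x hx => ?_⟩
  · rw [lap_re (hf.1.of_le two_le_infty), ← Complex.add_re, hf.2 x, Complex.zero_re]
  have hnorm : ‖((g x, fderiv ℝ g x) : JetSpace n) - (f x, fderiv ℝ f x)‖ ≤ δ / 2 := by
    have := JetMaps.norm_evalJet_le (jetMap (fun x : K => ((g x, fderiv ℝ g x) : JetSpace n)) - F)
      ⟨x, hx⟩
    rw [map_sub, evalJet_jetMap hcont, hFf, ← dist_eq_norm (jetMap _) F] at this
    exact this.trans hdist.le
  have hfst : ‖g x - f x‖ ≤ δ / 2 := (norm_fst_le _).trans hnorm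
  have hsnd : ‖fderiv ℝ g x - fderiv ℝ f x‖ ≤ δ / 2 := (norm_snd_le _).trans hnorm
  have hval : |(f x).re - h x| ≤ δ / 2 := by
    have : (f x).re - h x = -(g x - f x).re := by simp [hgdef]
    rw [this, abs_neg]
    exact (Complex.abs_re_le_norm _).trans hfst
  have hdf : fderiv ℝ (fun y => (f y).re) x = Complex.reCLM ∘L fderiv ℝ f x :=
    (Complex.reCLM.hasFDerivAt.comp x (hf.1.differentiable (by simp) x).hasFDerivAt).fderiv
  have hdh : fderiv ℝ h x = Complex.reCLM ∘L fderiv ℝ g x :=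
    (Complex.reCLM.hasFDerivAt.comp x (hg.differentiable (by simp) x).hasFDerivAt).fderiv
  have hgrad : ‖gradient (fun y => (f y).re) x - gradient h x‖ ≤ δ / 2 := by
    rw [gradient, gradient, ← map_sub, LinearIsometryEquiv.norm_map, hdf, hdh,
      ← ContinuousLinearMap.comp_sub]
    rw [norm_sub_rev] at hsnd
    refine (ContinuousLinearMap.opNorm_comp_le _ _).trans ?_
    rw [Complex.reCLM_norm, one_mul]
    exact hsnd
  linarith

end
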